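/- Let D range over discriminants of quadratic fields (fundamental discriminants ≠ 1), and for such D let #Cl₃(D) denote the number of 3-torsion elements in the ideal class group of the quadratic field of discriminant D. Then lim_{X→∞} (∑_{0<D<X} #Cl₃(D)) / (∑_{0<D<X} 1) = 4/3 and lim_{X→∞} (∑_{−X<D<0} #Cl₃(D)) / (∑_{−X<D<0} 1) = 2. -/

import Mathlib

open Filter

/-- The discriminant of a number field presented as a subfield of `ℂ`
(junk value `0` in the infinite-dimensional case). -/
noncomputable def fieldDisc (K : IntermediateField ℚ ℂ) : ℤ :=
  letI := Classical.dec (FiniteDimensional ℚ K)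
  if h : FiniteDimensional ℚ K then
    letI := h
    letI : NumberField K := ⟨⟩
    NumberField.discr K
  else 0

/-- `D` is the discriminant of a quadratic field. -/
def IsQuadraticDisc (D : ℤ) : Prop :=
  ∃ K : IntermediateField ℚ ℂ, Module.finrank ℚ K = 2 ∧ fieldDisc K = D

/-- The number of 3-torsion elements of the class group of the quadratic field of
discriminant `D` (junk value `0` if `D` is not a quadratic field discriminant). -/
noncomputable def h3 (D : ℤ) : ℕ :=
  letI := Classical.dec (∃ K : IntermediateField ℚ ℂ, Module.finrank ℚ K = 2 ∧ fieldDisc K = D)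
  if h : ∃ K : IntermediateField ℚ ℂ, Module.finrank ℚ K = 2 ∧ fieldDisc K = D then
    Nat.card { g : ClassGroup (NumberField.RingOfIntegers h.choose) // g ^ 3 = 1 }
  else 0

open scoped Classical in
/-- `∑ w(D)` over quadratic field discriminants `D` with `lo < D < hi`. -/
noncomputable def discSum (lo hi : ℝ) (w : ℤ → ℝ) : ℝ :=
  ∑' D : ℤ, if lo < (D : ℝ) ∧ (D : ℝ) < hi ∧ IsQuadraticDisc D then w D else 0

namespace CubicForm

open Matrix

/-- The leading coefficient of the Hessian of the cubic form
`v 0 X³ + 3 v 1 X²Y + 3 v 2 XY² + v 3 Y³`. -/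
def hessP {R : Type*} [CommRing R] (v : Fin 4 → R) : R := v 1 ^ 2 - v 0 * v 2

/-- The middle coefficient of the Hessian. -/
def hessQ {R : Type*} [CommRing R] (v : Fin 4 → R) : R := v 1 * v 2 - v 0 * v 3

/-- The last coefficient of the Hessian. -/
def hessR {R : Type*} [CommRing R] (v : Fin 4 → R) : R := v 2 ^ 2 - v 1 * v 3

/-- The reduced discriminant of a binary cubic form, i.e. the discriminant of its Hessian. -/
def disc {R : Type*} [CommRing R] (v : Fin 4 → R) : R := hessQ v ^ 2 - 4 * hessP v * hessR v

/-- The substitution `(X, Y) ↦ (pX + qY, rX + sY)` in a binary cubic form. -/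
def subst {R : Type*} [CommRing R] (p q r s : R) (v : Fin 4 → R) : Fin 4 → R :=
  ![v 0 * p ^ 3 + 3 * v 1 * p ^ 2 * r + 3 * v 2 * p * r ^ 2 + v 3 * r ^ 3,
    v 0 * p ^ 2 * q + v 1 * (p ^ 2 * s + 2 * p * q * r) + v 2 * (2 * p * r * s + q * r ^ 2)
      + v 3 * r ^ 2 * s,
    v 0 * p * q ^ 2 + v 1 * (2 * p * q * s + q ^ 2 * r) + v 2 * (p * s ^ 2 + 2 * q * r * s)
      + v 3 * r * s ^ 2,
    v 0 * q ^ 3 + 3 * v 1 * q ^ 2 * s + 3 * v 2 * q * s ^ 2 + v 3 * s ^ 3]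

section subst

variable {R : Type*} [CommRing R]

lemma subst_subst (p q r s p' q' r' s' : R) (v : Fin 4 → R) :
    subst p' q' r' s' (subst p q r s v) =
      subst (p * p' + q * r') (p * q' + q * s') (r * p' + s * r') (r * q' + s * s') v := by
  ext i
  fin_cases i <;> simp [subst] <;> ring

lemma subst_one (v : Fin 4 → R) : subst 1 0 0 1 v = v := by
  ext i
  fin_cases i <;> simp [subst]

lemma hessP_subst (p q r s : R) (v : Fin 4 → R) :
    hessP (subst p q r s v) =
      (p * s - q * r) ^ 2 * (hessP v * p ^ 2 + hessQ v * p * r + hessR v * r ^ 2) := by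
  simp [subst, hessP, hessQ, hessR]; ring

lemma hessQ_subst (p q r s : R) (v : Fin 4 → R) :
    hessQ (subst p q r s v) = (p * s - q * r) ^ 2 *
      (2 * hessP v * p * q + hessQ v * (p * s + q * r) + 2 * hessR v * r * s) := by
  simp [subst, hessP, hessQ, hessR]; ring

lemma hessR_subst (p q r s : R) (v : Fin 4 → R) :
    hessR (subst p q r s v) =
      (p * s - q * r) ^ 2 * (hessP v * q ^ 2 + hessQ v * q * s + hessR v * s ^ 2) := by
  simp [subst, hessP, hessQ, hessR]; ring

lemma disc_subst (p q r s : R) (v : Fin 4 → R) :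
    disc (subst p q r s v) = (p * s - q * r) ^ 6 * disc v := by
  simp only [disc, hessP_subst, hessQ_subst, hessR_subst]; ring

lemma subst_map {S : Type*} [CommRing S] (f : R →+* S) (p q r s : R) (v : Fin 4 → R) :
    (fun i => f (subst p q r s v i)) = subst (f p) (f q) (f r) (f s) (fun i => f (v i)) := by
  have h2 : f 2 = 2 := map_ofNat f 2
  have h3 : f 3 = 3 := map_ofNat f 3
  ext i
  fin_cases i <;> simp [subst, h2, h3]

lemma disc_map {S : Type*} [CommRing S] (f : R →+* S) (v : Fin 4 → R) :
    disc (fun i => f (v i)) = f (disc v) := by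
  have h4 : f 4 = 4 := map_ofNat f 4
  simp [disc, hessP, hessQ, hessR, h4]

lemma disc_smul (t : R) (v : Fin 4 → R) : disc (t • v) = t ^ 4 * disc v := by
  simp [disc, hessP, hessQ, hessR]; ring

end subst

/-- The left action of `SL(2, ℤ)` on integral binary cubic forms. -/
def act (g : SpecialLinearGroup (Fin 2) ℤ) (v : Fin 4 → ℤ) : Fin 4 → ℤ :=
  subst (g 1 1) (-g 0 1) (-g 1 0) (g 0 0) v

lemma det_eq (g : SpecialLinearGroup (Fin 2) ℤ) : g 0 0 * g 1 1 - g 0 1 * g 1 0 = 1 := by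
  have := g.det_coe
  rwa [det_fin_two] at this

lemma act_one (v : Fin 4 → ℤ) : act 1 v = v := by
  simp [act, subst_one]

lemma act_mul (g h : SpecialLinearGroup (Fin 2) ℤ) (v : Fin 4 → ℤ) :
    act (g * h) v = act g (act h v) := by
  have key : ∀ i j, (g * h) i j = g i 0 * h 0 j + g i 1 * h 1 j := fun i j => by
    change (g.1 * h.1) i j = _
    rw [mul_apply, Fin.sum_univ_two]
  simp only [act, subst_subst, key]
  congr 1 <;> ring

lemma act_inv_act (g : SpecialLinearGroup (Fin 2) ℤ) (v : Fin 4 → ℤ) :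
    act g⁻¹ (act g v) = v := by
  rw [← act_mul, inv_mul_cancel, act_one]

lemma act_act_inv (g : SpecialLinearGroup (Fin 2) ℤ) (v : Fin 4 → ℤ) :
    act g (act g⁻¹ v) = v := by
  rw [← act_mul, mul_inv_cancel, act_one]

lemma disc_act (g : SpecialLinearGroup (Fin 2) ℤ) (v : Fin 4 → ℤ) : disc (act g v) = disc v := by
  have h := det_eq g
  rw [act, disc_subst, show g 1 1 * g 0 0 - -g 0 1 * -g 1 0 = 1 by linear_combination h]
  ring

lemma act_neg_one (v : Fin 4 → ℤ) : act (-1) v = -v := by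
  ext i
  fin_cases i <;> simp [act, subst]

lemma act_neg (g : SpecialLinearGroup (Fin 2) ℤ) (v : Fin 4 → ℤ) : act (-g) v = -act g v := by
  rw [← act_neg_one (act g v), ← act_mul, neg_one_mul]

/-- Equivalence of integral binary cubic forms under `SL(2, ℤ)`. -/
def orbitSetoid : Setoid (Fin 4 → ℤ) where
  r v w := ∃ g, act g v = w
  iseqv :=
    { refl := fun v => ⟨1, act_one v⟩
      symm := by
        rintro v w ⟨g, rfl⟩
        exact ⟨g⁻¹, act_inv_act g v⟩
      trans := by
        rintro u v w ⟨g, rfl⟩ ⟨h, rfl⟩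
        exact ⟨h * g, act_mul h g u⟩ }

/-- The `SL(2, ℤ)`-orbits of integral binary cubic forms. -/
abbrev Orbit : Type := Quotient orbitSetoid

/-- The discriminant of an orbit. -/
def Orbit.disc : Orbit → ℤ :=
  Quotient.lift CubicForm.disc (by rintro v w ⟨g, rfl⟩; exact (disc_act g v).symm)

@[simp] lemma Orbit.disc_mk (v : Fin 4 → ℤ) :
    Orbit.disc (Quotient.mk orbitSetoid v) = CubicForm.disc v := rfl

lemma orbit_eq_iff {v w : Fin 4 → ℤ} :
    (Quotient.mk orbitSetoid v = Quotient.mk orbitSetoid w) ↔ ∃ g, act g v = w :=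
  Quotient.eq (r := orbitSetoid)

end CubicForm

namespace CubicForm

open NumberField Module Matrix

/-- A square root `ω` of the discriminant `D` of a quadratic field `K`, together with the
conjugation of `K` and the description of the ring of integers in terms of `ω`. -/
structure QuadData (K : Type*) [Field K] [NumberField K] (D : ℤ) where
  ω : K
  σ : K →+* K
  sq : ω ^ 2 = D
  σω : σ ω = -ω
  repr : ∀ x : K, ∃ p q : ℚ, x = p + q * ω
  indep : ∀ p q : ℚ, (p + q * ω : K) = 0 → p = 0 ∧ q = 0
  int : ∀ x : K, IsIntegral ℤ x ↔ ∃ m n : ℤ, 2 ∣ m - D * n ∧ 2 * x = m + n * ω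
  tr : ∀ x : K, (Algebra.trace ℚ K x : K) = x + σ x
  nm : ∀ x : K, (Algebra.norm ℚ x : K) = x * σ x

section existence

variable {K : Type*} [Field K] [NumberField K]

lemma exists_generator (b : Basis (Fin 2) ℤ (𝓞 K)) :
    ∃ (τ : 𝓞 K) (M : Matrix (Fin 2) (Fin 2) ℤ), M.det = 1 ∧
      (∀ x : 𝓞 K, ∃ m n : ℤ, x = m + n * τ) ∧ ![1, τ] = (b ᵥ* M.map (algebraMap ℤ (𝓞 K))) := by
  obtain ⟨m, n, h1⟩ : ∃ m n : ℤ, (1 : 𝓞 K) = m * b 0 + n * b 1 :=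
    ⟨b.repr 1 0, b.repr 1 1, by
      conv_lhs => rw [← b.sum_repr 1]
      simp [Fin.sum_univ_two]⟩
  have hcop : IsCoprime m n := by
    rw [Int.isCoprime_iff_gcd_eq_one]
    obtain ⟨m', hm⟩ := Int.gcd_dvd_left (a := m) (b := n)
    obtain ⟨n', hn⟩ := Int.gcd_dvd_right (a := m) (b := n)
    have h2 : (algebraMap ℤ (𝓞 K) (Int.gcd m n)) * (m' * b 0 + n' * b 1) = 1 := by
      have hm' := congrArg (Int.cast : ℤ → 𝓞 K) hm
      have hn' := congrArg (Int.cast : ℤ → 𝓞 K) hn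
      rw [Int.cast_mul] at hm' hn'
      rw [eq_intCast]
      linear_combination -h1 - b 0 * hm' - b 1 * hn'
    have h3 : IsUnit (Algebra.norm ℤ (algebraMap ℤ (𝓞 K) (Int.gcd m n))) :=
      (IsUnit.of_mul_eq_one _ h2).map _
    rw [Algebra.norm_algebraMap, finrank_eq_card_basis b] at h3
    simp only [Fintype.card_fin] at h3
    have h4 := (isUnit_pow_iff two_ne_zero).1 h3
    rw [Int.isUnit_iff] at h4
    omega
  obtain ⟨u, v, huv⟩ := hcop
  have huv' : ((u * m + v * n : ℤ) : 𝓞 K) = 1 := by rw [huv]; simp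
  push_cast at huv'
  refine ⟨-v * b 0 + u * b 1, !![m, -v; n, u], ?_, fun x => ?_, ?_⟩
  · rw [Matrix.det_fin_two_of]; linarith
  · refine ⟨b.repr x 0 * u + b.repr x 1 * v, - b.repr x 0 * n + b.repr x 1 * m, ?_⟩
    conv_lhs => rw [← b.sum_repr x]
    simp only [Fin.sum_univ_two, zsmul_eq_mul]
    push_cast
    linear_combination (b.repr x 0 * u + b.repr x 1 * v : 𝓞 K) * (-h1)
      + (- b.repr x 0 * b 0 - b.repr x 1 * b 1 : 𝓞 K) * huv'
  · ext i
    fin_cases i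
    · have h2 := congrArg (fun y : 𝓞 K => (y : K)) h1
      simp [Matrix.vecMul, dotProduct, Fin.sum_univ_two] at h2 ⊢
      rw [h2]; ring
    · simp [Matrix.vecMul, dotProduct, Fin.sum_univ_two]
      ring

open scoped Classical in
theorem exists_quadData (h : finrank ℚ K = 2) : Nonempty (QuadData K (discr K)) := by
  have hr : finrank ℤ (𝓞 K) = 2 := by rw [RingOfIntegers.rank, h]
  let b : Basis (Fin 2) ℤ (𝓞 K) := finBasisOfFinrankEq ℤ (𝓞 K) hr
  obtain ⟨τ, M, hM, hτ, hbM⟩ := exists_generator b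
  have : Algebra.IsQuadraticExtension ℚ K := ⟨h⟩
  have hcard : Nat.card (K ≃ₐ[ℚ] K) = 2 := by rw [IsGalois.card_aut_eq_finrank, h]
  obtain ⟨s, hs⟩ : ∃ s : K ≃ₐ[ℚ] K, s ≠ 1 := by
    by_contra! hc
    have : Subsingleton (K ≃ₐ[ℚ] K) := ⟨fun a b => by rw [hc a, hc b]⟩
    rw [Nat.card_of_subsingleton (1 : K ≃ₐ[ℚ] K)] at hcard
    omega
  have huniv : (Finset.univ : Finset (K ≃ₐ[ℚ] K)) = {1, s} := by
    symm
    apply Finset.eq_univ_of_card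
    rw [Finset.card_pair hs.symm, ← Nat.card_eq_fintype_card, hcard]
  have htr' : ∀ x : K, (Algebra.trace ℚ K x : K) = x + s x := fun x => by
    rw [← eq_ratCast (algebraMap ℚ K), trace_eq_sum_automorphisms, huniv, Finset.sum_pair hs.symm]
    rfl
  have hnm' : ∀ x : K, (Algebra.norm ℚ x : K) = x * s x := fun x => by
    rw [← eq_ratCast (algebraMap ℚ K), Algebra.norm_eq_prod_automorphisms, huniv,
      Finset.prod_pair hs.symm]
    rfl
  have htr := htr' τ
  have hnm := hnm' τ
  rw [← Algebra.coe_trace_int] at htr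
  rw [← Algebra.coe_norm_int] at hnm
  set t := Algebra.trace ℤ (𝓞 K) τ with ht
  set n := Algebra.norm ℤ τ with hn
  have hsq : (τ : K) ^ 2 = t * τ - n := by
    have h1 : (t : K) = τ + s τ := by rw [← htr]; simp
    have h2 : (n : K) = τ * s τ := by rw [← hnm]; simp
    rw [h1, h2]; ring
  have hsq' : τ ^ 2 = t * τ - n := by
    apply RingOfIntegers.ext
    push_cast
    simpa using hsq
  have hD : discr K = t ^ 2 - 4 * n := by
    rw [← discr_eq_discr K b]
    have h1 := Algebra.discr_of_matrix_vecMul (A := ℤ) (⇑b) M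
    rw [← hbM, hM, one_pow, one_mul] at h1
    rw [← h1, Algebra.discr_def, Matrix.det_fin_two]
    have e1 : Algebra.trace ℤ (𝓞 K) (1 : 𝓞 K) = 2 := by
      have := Algebra.trace_algebraMap (R := ℤ) (S := 𝓞 K) 1
      rw [map_one, hr] at this
      simpa using this
    have e2 : Algebra.trace ℤ (𝓞 K) (τ * τ) = t * t - n * 2 := by
      have : τ * τ = t • τ - n • (1 : 𝓞 K) := by
        rw [← pow_two, hsq']; simp
      rw [this, map_sub, map_smul, map_smul, e1, ← ht]
      simp
    simp only [Algebra.traceMatrix_apply, Algebra.traceForm_apply, Matrix.cons_val_zero,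
      Matrix.cons_val_one, mul_one, one_mul, e1, e2, ← ht]
    ring
  have hstau : s τ = t - τ := by
    have h1 : (t : K) = τ + s τ := by rw [← htr]; simp
    rw [h1]; ring
  set w : K := 2 * τ - t with hw
  have hww : w ^ 2 = (discr K : ℤ) := by
    rw [hD]; push_cast; linear_combination 4 * hsq
  have hsw : s w = - w := by
    rw [hw, map_sub, map_mul, hstau]
    have : s (t : K) = t := map_intCast s t
    rw [this, map_ofNat]; ring
  have hrepr : ∀ x : K, ∃ p q : ℚ, x = p + q * w := by
    intro x
    obtain ⟨a, d, hd, rfl⟩ := IsFractionRing.div_surjective (A := 𝓞 K) x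
    have key : ∀ a : 𝓞 K, ∃ p q : ℚ, (a : K) = p + q * w := by
      intro a
      obtain ⟨k, l, rfl⟩ := hτ a
      refine ⟨k + l * t / 2, l / 2, ?_⟩
      push_cast
      rw [hw]; simp; ring
    obtain ⟨x, hx⟩ : ∃ x : K, x = algebraMap (𝓞 K) K a / algebraMap (𝓞 K) K d := ⟨_, rfl⟩
    obtain ⟨p, q, h1⟩ := key a
    obtain ⟨p', q', h2⟩ := key d
    have hd0 : (d : K) ≠ 0 := by
      simpa using nonZeroDivisors.ne_zero hd
    -- multiply numerator and denominator by the conjugate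
    have hsd : s (d : K) = p' - q' * w := by
      rw [h2, map_add, map_mul, hsw]; simp; ring
    have hsd0 : s (d : K) ≠ 0 := by simpa using hd0
    have hN : (d : K) * s d = ((p' ^ 2 - discr K * q' ^ 2 : ℚ) : K) := by
      rw [hsd, h2]; push_cast; linear_combination (- q' ^ 2 : K) * hww
    have hN0 : ((p' ^ 2 - discr K * q' ^ 2 : ℚ) : K) ≠ 0 := by
      rw [← hN]; exact mul_ne_zero hd0 hsd0
    refine ⟨(p * p' - discr K * q * q') / (p' ^ 2 - discr K * q' ^ 2),
      (q * p' - p * q') / (p' ^ 2 - discr K * q' ^ 2), ?_⟩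
    have : (algebraMap (𝓞 K) K a / algebraMap (𝓞 K) K d) = (a * s d) / (d * s d) := by
      rw [mul_div_mul_right _ _ hsd0]
    rw [this, hN, hsd, h1]
    have hc : ∀ y z : ℚ, ((y / z : ℚ) : K) = y / z := fun y z => by push_cast; rfl
    rw [hc, hc]
    rw [div_mul_eq_mul_div, ← add_div]
    congr 1
    push_cast
    linear_combination (-q * q' : K) * hww
  have hindep : ∀ p q : ℚ, (p + q * w : K) = 0 → p = 0 ∧ q = 0 := by
    intro p q hpq
    by_cases hq : q = 0
    · subst hq
      simp at hpq
      exact ⟨hpq, rfl⟩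
    · exfalso
      have hw' : w = ((-p / q : ℚ) : K) := by
        have : (q : K) ≠ 0 := by exact_mod_cast hq
        push_cast; field_simp; linear_combination hpq
      apply hs
      ext x
      obtain ⟨a, c, rfl⟩ := hrepr x
      rw [hw']
      simp
  refine ⟨⟨w, s, hww, hsw, hrepr, hindep, fun x => ⟨fun hx => ?_, ?_⟩, htr', hnm'⟩⟩
  · obtain ⟨k, l, hkl⟩ := hτ ⟨x, hx⟩
    refine ⟨2 * k + l * t, l, ?_, ?_⟩
    · have e : 2 * k + l * t - discr K * l = 2 * (k + 2 * n * l) - l * ((t - 1) * t) := by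
        rw [hD]; ring
      rw [e]
      refine dvd_sub (dvd_mul_right _ _) (Dvd.dvd.mul_left ?_ _)
      have := Int.even_mul_pred_self t
      rw [mul_comm] at this
      exact this.two_dvd
    · have : x = k + l * τ := by
        have := congrArg (fun y : 𝓞 K => (y : K)) hkl
        simp only [map_add, map_mul, map_intCast] at this
        exact this
      rw [this, hw]; push_cast; ring
  · rintro ⟨k, l, ⟨c, hc⟩, hx⟩
    have he : ∃ c', k - l * t = 2 * c' := by
      have e : k - l * t = 2 * (c - 2 * n * l) + l * ((t - 1) * t) := by
        rw [hD] at hc; linear_combination hc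
      have := Int.even_mul_pred_self t
      rw [mul_comm] at this
      obtain ⟨r, hr⟩ := this.two_dvd
      exact ⟨c - 2 * n * l + l * r, by rw [e, hr]; ring⟩
    obtain ⟨c', hc'⟩ := he
    have : x = ((c' + l * τ : 𝓞 K) : K) := by
      have h2 : (2 : K) ≠ 0 := two_ne_zero
      apply mul_left_cancel₀ h2
      rw [hx, hw]
      have : ((k - l * t : ℤ) : K) = ((2 * c' : ℤ) : K) := by rw [hc']
      push_cast at this
      simp
      linear_combination this
    rw [this]
    exact RingOfIntegers.isIntegral_coe _

end existence

end CubicForm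

namespace CubicForm

open NumberField Module nonZeroDivisors

section selmer

set_option linter.unusedSectionVars false

variable (R K : Type*) [CommRing R] [IsDedekindDomain R] [Field K] [Algebra R K]
  [IsFractionRing R K]

lemma toPrincipalIdeal_eq_one_iff (x : Kˣ) :
    toPrincipalIdeal R K x = 1 ↔ ∃ u : Rˣ, algebraMap R K u = x := by
  rw [toPrincipalIdeal_eq_iff, Units.val_one]
  constructor
  · intro h
    have h1 : (x : K) ∈ (1 : FractionalIdeal R⁰ K) := by
      rw [← h]; exact FractionalIdeal.mem_spanSingleton_self _ _
    have h2 : (1 : K) ∈ FractionalIdeal.spanSingleton R⁰ (x : K) := by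
      rw [h]; exact FractionalIdeal.one_mem_one _
    obtain ⟨r, hr⟩ := (FractionalIdeal.mem_one_iff _).1 h1
    obtain ⟨s, hs⟩ := (FractionalIdeal.mem_spanSingleton _).1 h2
    refine ⟨⟨r, s, ?_, ?_⟩, hr⟩ <;>
    · apply IsFractionRing.injective R K
      rw [map_mul, hr, map_one, ← hs, Algebra.smul_def]
      try ring
  · rintro ⟨u, hu⟩
    rw [← hu]
    refine le_antisymm ?_ ?_
    · rw [FractionalIdeal.spanSingleton_le_iff_mem]
      exact (FractionalIdeal.mem_one_iff _).2 ⟨u, rfl⟩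
    · rw [FractionalIdeal.one_le, FractionalIdeal.mem_spanSingleton]
      exact ⟨(u⁻¹ : Rˣ), by rw [Algebra.smul_def, ← map_mul]; simp⟩

/-- Pairs `(I, δ)` of an invertible fractional ideal and a generator of its cube. -/
noncomputable def cubePairs : Subgroup ((FractionalIdeal R⁰ K)ˣ × Kˣ) :=
  MonoidHom.eqLocus ((powMonoidHom 3).comp (MonoidHom.fst _ _))
    ((toPrincipalIdeal R K).comp (MonoidHom.snd _ _))

variable {R K} in
lemma mem_cubePairs {x : (FractionalIdeal R⁰ K)ˣ × Kˣ} :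
    x ∈ cubePairs R K ↔ x.1 ^ 3 = toPrincipalIdeal R K x.2 := Iff.rfl

/-- The trivial pairs `((κ), κ³)`. -/
noncomputable def trivialPair : Kˣ →* cubePairs R K :=
  ((toPrincipalIdeal R K).prod (powMonoidHom 3)).codRestrict _ fun κ => by
    simp [mem_cubePairs]

/-- The pairs `((1), u)` with `u` a unit. -/
noncomputable def unitPair : Rˣ →* cubePairs R K :=
  ((1 : Rˣ →* (FractionalIdeal R⁰ K)ˣ).prod (Units.map (algebraMap R K))).codRestrict _ fun u => by
    rw [mem_cubePairs]
    simp only [MonoidHom.prod_apply, MonoidHom.one_apply, one_pow]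
    rw [eq_comm, toPrincipalIdeal_eq_one_iff]
    exact ⟨u, rfl⟩

/-- The ideal class of a pair. -/
noncomputable def pairClass : cubePairs R K →* ClassGroup R :=
  ((ClassGroup.mk (R := R) (K := K)).comp (MonoidHom.fst _ _)).comp (cubePairs R K).subtype

lemma classGroup_mk_eq_one_iff (I : (FractionalIdeal R⁰ K)ˣ) :
    ClassGroup.mk (R := R) (K := K) I = 1 ↔ ∃ x, toPrincipalIdeal R K x = I := by
  rw [← (ClassGroup.equiv (R := R) K).injective.eq_iff, map_one, ClassGroup.equiv_mk]
  simp

lemma classGroup_mk_surjective :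
    Function.Surjective (ClassGroup.mk (R := R) (K := K)) := fun g => by
  obtain ⟨I, hI⟩ := QuotientGroup.mk_surjective (ClassGroup.equiv (R := R) K g)
  refine ⟨I, (ClassGroup.equiv (R := R) K).injective ?_⟩
  rw [ClassGroup.equiv_mk, ← hI]
  simp
  rfl

lemma pairClass_range : ((pairClass R K).range : Set (ClassGroup R)) = {g | g ^ 3 = 1} := by
  ext g
  constructor
  · rintro ⟨⟨⟨I, δ⟩, h⟩, rfl⟩
    change ClassGroup.mk (R := R) (K := K) I ^ 3 = 1
    rw [← map_pow, classGroup_mk_eq_one_iff]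
    exact ⟨δ, (mem_cubePairs.1 h).symm⟩
  · intro hg
    obtain ⟨I, rfl⟩ := classGroup_mk_surjective R K g
    rw [Set.mem_ofPred_eq, ← map_pow, classGroup_mk_eq_one_iff] at hg
    obtain ⟨δ, hδ⟩ := hg
    exact ⟨⟨(I, δ), mem_cubePairs.2 hδ.symm⟩, rfl⟩

lemma pairClass_ker :
    (pairClass R K).ker = (unitPair R K).range ⊔ (trivialPair R K).range := by
  apply le_antisymm
  · rintro ⟨⟨I, δ⟩, h⟩ h1
    obtain ⟨κ, hκ⟩ := (classGroup_mk_eq_one_iff R K I).1 h1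
    have h2 : toPrincipalIdeal R K (δ / κ ^ 3) = 1 := by
      rw [map_div, map_pow, hκ, ← mem_cubePairs.1 h, div_self']
    obtain ⟨u, hu⟩ := (toPrincipalIdeal_eq_one_iff R K _).1 h2
    refine Subgroup.mem_sup.2 ⟨_, ⟨u, rfl⟩, _, ⟨κ, rfl⟩, ?_⟩
    apply Subtype.ext
    refine Prod.ext ?_ ?_
    · change 1 * toPrincipalIdeal R K κ = I
      rw [hκ, one_mul]
    · apply Units.ext
      change algebraMap R K u * (κ : K) ^ 3 = δ
      rw [hu]
      simp
  · rw [sup_le_iff]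
    constructor
    · rintro _ ⟨u, rfl⟩
      change ClassGroup.mk (R := R) (K := K) 1 = 1
      rw [map_one]
    · rintro _ ⟨κ, rfl⟩
      change ClassGroup.mk (R := R) (K := K) (toPrincipalIdeal R K κ) = 1
      rw [classGroup_mk_eq_one_iff]
      exact ⟨κ, rfl⟩

theorem index_trivialPair :
    (trivialPair R K).range.index = (powMonoidHom 3 : Rˣ →* Rˣ).range.index *
      Nat.card {g : ClassGroup R // g ^ 3 = 1} := by
  have h1 : (trivialPair R K).range ≤ (pairClass R K).ker := by
    rw [pairClass_ker]; exact le_sup_right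
  rw [← Subgroup.relIndex_mul_index h1, Subgroup.index_ker, pairClass_ker,
    Subgroup.relIndex_sup_right, ← Subgroup.index_comap]
  congr 1
  · congr 1
    ext u
    rw [Subgroup.mem_comap]
    constructor
    · rintro ⟨κ, hκ⟩
      have e1 : toPrincipalIdeal R K κ = 1 := congrArg (fun z => z.1.1) hκ
      have e2 : (κ : K) ^ 3 = algebraMap R K u := congrArg (fun z => (z.1.2 : K)) hκ
      obtain ⟨w, hw⟩ := (toPrincipalIdeal_eq_one_iff R K _).1 e1
      refine ⟨w, Units.ext (IsFractionRing.injective R K ?_)⟩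
      rw [← e2, ← hw]
      simp
    · rintro ⟨w, rfl⟩
      refine ⟨Units.map (algebraMap R K) w, Subtype.ext (Prod.ext ?_ (Units.ext ?_))⟩
      · exact (toPrincipalIdeal_eq_one_iff R K _).2 ⟨w, rfl⟩
      · change algebraMap R K w ^ 3 = algebraMap R K (w ^ 3 : R)
        simp
  · exact congrArg (fun s : Set (ClassGroup R) => Nat.card s) (pairClass_range R K)

end selmer

end CubicForm

namespace CubicForm

open NumberField Module

section units

variable {K : Type*} [Field K] [NumberField K] {D : ℤ}

lemma isTotallyReal_of_pos (q : QuadData K D) (hD : 0 < D) : IsTotallyReal K := by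
  refine ⟨fun v => ?_⟩
  rw [InfinitePlace.isReal_iff, ComplexEmbedding.isReal_iff]
  set φ := v.embedding
  have h1 : (φ q.ω) ^ 2 = D := by rw [← map_pow, q.sq, map_intCast]
  have h2 : (starRingEnd ℂ) (φ q.ω) = φ q.ω := by
    have hD' : (0 : ℝ) < D := by exact_mod_cast hD
    have h3 : ((φ q.ω) - (Real.sqrt D : ℂ)) * ((φ q.ω) + (Real.sqrt D : ℂ)) = 0 := by
      have : ((Real.sqrt D : ℂ)) ^ 2 = (D : ℂ) := by
        rw [← Complex.ofReal_pow, Real.sq_sqrt hD'.le]; simp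
      linear_combination h1 - this
    rcases mul_eq_zero.1 h3 with h | h
    · rw [sub_eq_zero.1 h, Complex.conj_ofReal]
    · rw [eq_neg_of_add_eq_zero_left h, map_neg, Complex.conj_ofReal]
  ext x
  obtain ⟨a, b, rfl⟩ := q.repr x
  rw [ComplexEmbedding.conjugate_coe_eq]
  simp [h2]

lemma torsion_sq [IsTotallyReal K] (z : (𝓞 K)ˣ) (hz : z ∈ Units.torsion K) : z ^ 2 = 1 := by
  obtain ⟨φ⟩ : Nonempty (K →+* ℂ) := inferInstance
  have h1 := (Units.mem_torsion K).1 hz (InfinitePlace.mk φ)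
  rw [InfinitePlace.apply] at h1
  have h2 := IsTotallyReal.complexEmbedding_isReal φ
  rw [ComplexEmbedding.isReal_iff] at h2
  have h3 : (starRingEnd ℂ) (φ z) = φ z := by
    have := DFunLike.congr_fun h2 (z : K)
    rwa [ComplexEmbedding.conjugate_coe_eq] at this
  have h4 : (φ z) ^ 2 = 1 := by
    rw [pow_two]
    nth_rw 2 [← h3]
    rw [Complex.mul_conj, Complex.normSq_eq_norm_sq, h1]
    simp
  apply Units.ext
  apply RingOfIntegers.ext
  apply φ.injective
  simpa using h4

lemma finrank_eq_two (q : QuadData K D) (hD : D ≠ 0) : finrank ℚ K = 2 := by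
  have hω : q.ω ≠ 0 := fun h => by
    have := q.sq; rw [h] at this; simp at this; exact hD (by exact_mod_cast this.symm)
  have h1 : Algebra.trace ℚ K 1 = finrank ℚ K := by
    simpa using Algebra.trace_algebraMap (R := ℚ) (S := K) 1
  have h2 := q.tr 1
  rw [h1, map_one] at h2
  have h3 : ((finrank ℚ K : ℕ) : K) = ((2 : ℕ) : K) := by
    push_cast at h2 ⊢; rw [h2]; norm_num
  exact_mod_cast h3

theorem index_cubes_of_pos (q : QuadData K D) (hD : 0 < D) :
    (powMonoidHom 3 : (𝓞 K)ˣ →* (𝓞 K)ˣ).range.index = 3 := by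
  have hr := isTotallyReal_of_pos q hD
  have hrank : Units.rank K = 1 := by
    have h1 := InfinitePlace.card_add_two_mul_card_eq_rank K
    have h2 := InfinitePlace.card_eq_nrRealPlaces_add_nrComplexPlaces K
    rw [IsTotallyReal.nrComplexPlaces_eq_zero] at h1 h2
    rw [finrank_eq_two q hD.ne'] at h1
    rw [Units.rank, h2]
    omega
  obtain ⟨i, hi⟩ : ∃ i : Fin (Units.rank K), ∀ j, j = i := by
    rw [hrank]; exact ⟨0, fun j => Subsingleton.elim _ _⟩
  have hprod : ∀ f : Fin (Units.rank K) → ℤ, ∏ j, Units.fundSystem K j ^ f j =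
      Units.fundSystem K i ^ f i := fun f =>
    Fintype.prod_eq_single i fun j hj => absurd (hi j) hj
  set ε := Units.fundSystem K i
  set C := (powMonoidHom 3 : (𝓞 K)ˣ →* (𝓞 K)ˣ).range with hC
  let θ : Multiplicative ℤ →* (𝓞 K)ˣ ⧸ C := zpowersHom _ (QuotientGroup.mk ε)
  have hθ : ∀ k : ℤ, θ (Multiplicative.ofAdd k) = QuotientGroup.mk (ε ^ k) := fun k => by
    simp [θ]
  have hsurj : θ.range = ⊤ := by
    rw [MonoidHom.range_eq_top]
    intro y
    obtain ⟨x, rfl⟩ := QuotientGroup.mk_surjective y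
    obtain ⟨⟨ζ, e⟩, h, -⟩ := Units.exist_unique_eq_mul_prod K x
    refine ⟨Multiplicative.ofAdd (e i), ?_⟩
    rw [hθ, h, hprod, eq_comm, QuotientGroup.eq]
    refine ⟨(ζ : (𝓞 K)ˣ)⁻¹, ?_⟩
    have := torsion_sq (ζ : (𝓞 K)ˣ) ζ.2
    simp only [powMonoidHom_apply, inv_pow, mul_inv_rev]
    rw [pow_succ, this]
    simp [mul_comm]
  have hker : θ.ker = AddSubgroup.toSubgroup (AddSubgroup.zmultiples (3 : ℤ)) := by
    ext k
    obtain ⟨k, rfl⟩ := Multiplicative.ofAdd.surjective k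
    rw [MonoidHom.mem_ker, hθ, QuotientGroup.eq_one_iff]
    change _ ↔ k ∈ AddSubgroup.zmultiples (3 : ℤ)
    rw [Int.mem_zmultiples_iff]
    constructor
    · rintro ⟨w, hw⟩
      obtain ⟨⟨ζ, e⟩, h, -⟩ := Units.exist_unique_eq_mul_prod K w
      rw [hprod] at h
      have hw' : w ^ 3 = ε ^ k := hw
      have u := (Units.exist_unique_eq_mul_prod K (ε ^ k)).unique
        (y₁ := (1, fun _ => k)) (y₂ := (ζ ^ 3, fun j => 3 * e j))
        (by rw [hprod]; simp [ε])
        (by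
          rw [hprod, ← hw', h]
          simp only [SubgroupClass.coe_pow]
          rw [mul_pow, mul_comm 3 (e i), zpow_mul]; rfl)
      have := congrFun (congrArg Prod.snd u) i
      exact ⟨e i, this⟩
    · rintro ⟨m, rfl⟩
      exact ⟨ε ^ m, by simp [mul_comm 3 m, zpow_mul]⟩
  rw [Subgroup.index, ← Subgroup.card_top, ← hsurj, ← Subgroup.index_ker, hker]
  exact Int.index_zmultiples 3

theorem index_cubes_of_neg (q : QuadData K D) (hD : D < -4) :
    (powMonoidHom 3 : (𝓞 K)ˣ →* (𝓞 K)ˣ).range.index = 1 := by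
  rw [Subgroup.index_eq_one, MonoidHom.range_eq_top]
  intro u
  refine ⟨u, ?_⟩
  have h1 : u ^ 2 = 1 := by
    obtain ⟨m, n, h, hx⟩ := (q.int (u : K)).1 (RingOfIntegers.isIntegral_coe _)
    have hN : (Algebra.norm ℚ (u : K)) = 1 ∨ (Algebra.norm ℚ (u : K)) = -1 := by
      have := (NumberField.isUnit_iff_norm).1 u.isUnit
      rcases abs_eq (zero_le_one' ℚ) |>.1 this with h | h
      · left; simpa using h
      · right; simpa using h
    have h2 := q.nm u
    have hσ : 2 * q.σ u = m - n * q.ω := by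
      have := congrArg q.σ hx
      rw [map_mul, map_ofNat] at this
      simpa [q.σω, sub_eq_add_neg] using this
    have h4 : ((m ^ 2 - D * n ^ 2 : ℤ) : K) = ((4 * Algebra.norm ℚ (u : K) : ℚ) : K) := by
      push_cast
      rw [h2]
      linear_combination (- 2 * q.σ u : K) * hx - (m + n * q.ω : K) * hσ + (n : K) ^ 2 * q.sq
    have h5 : ((m ^ 2 - D * n ^ 2 : ℤ) : ℚ) = 4 * Algebra.norm ℚ (u : K) := by
      exact_mod_cast h4
    have h6 : m ^ 2 - D * n ^ 2 = 4 ∨ m ^ 2 - D * n ^ 2 = -4 := by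
      rcases hN with h | h <;> rw [h] at h5
      · left
        apply Int.cast_injective (α := ℚ)
        rw [h5]; norm_num
      · right
        apply Int.cast_injective (α := ℚ)
        rw [h5]; norm_num
    have hn : n = 0 := by
      by_contra hn
      have hn2 : 1 ≤ n ^ 2 := by have := sq_pos_of_ne_zero hn; omega
      rcases h6 with h | h <;> nlinarith [sq_nonneg m]
    subst hn
    have hm : m ^ 2 = 4 := by
      rcases h6 with h | h <;> nlinarith [sq_nonneg m]
    apply Units.ext
    apply RingOfIntegers.ext
    have hm' : (m : K) ^ 2 = 4 := by exact_mod_cast congrArg (Int.cast : ℤ → K) hm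
    have h2u : (2 * (u : K)) ^ 2 = 4 := by rw [hx]; simpa using hm'
    have : (u : K) ^ 2 = 1 := by linear_combination h2u / 4
    simpa using this
  change u ^ 3 = u
  rw [pow_succ, h1, one_mul]

end units

end CubicForm

namespace CubicForm

open NumberField Module nonZeroDivisors

section rep

set_option linter.unusedSimpArgs false

variable {K : Type*} [Field K] [NumberField K] {D : ℤ}

/-- The form `v` is attached to the fractional ideal `I = ℤα + ℤβ` and the generator `δ` of `I³`:
its coefficients are the `ω`-coordinates of the elements `2α³⁻ⁱβⁱ / δ`. -/
structure IsRep (q : QuadData K D) (v : Fin 4 → ℤ) (I : FractionalIdeal (𝓞 K)⁰ K) (δ α β : K)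
    (n : ℚ) (g : Fin 4 → ℚ) : Prop where
  mem : ∀ y, y ∈ I ↔ ∃ k l : ℤ, y = k * α + l * β
  e0 : 2 * α ^ 3 = δ * (g 0 + v 0 * q.ω)
  e1 : 2 * (α ^ 2 * β) = δ * (g 1 + v 1 * q.ω)
  e2 : 2 * (α * β ^ 2) = δ * (g 2 + v 2 * q.ω)
  e3 : 2 * β ^ 3 = δ * (g 3 + v 3 * q.ω)
  wr : α * q.σ β - q.σ α * β = -n * q.ω
  nm : (n : K) ^ 3 = δ * q.σ δ

variable {q : QuadData K D} {v w : Fin 4 → ℤ} {I J : FractionalIdeal (𝓞 K)⁰ K}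
  {δ α β δ' α' β' : K} {n n' : ℚ} {g g' : Fin 4 → ℚ}

lemma QuadData.coord_ext (q : QuadData K D) {a b c d : ℚ} (h : (a + b * q.ω : K) = c + d * q.ω) :
    a = c ∧ b = d := by
  have := q.indep (a - c) (b - d) (by push_cast; linear_combination h)
  exact ⟨sub_eq_zero.1 this.1, sub_eq_zero.1 this.2⟩

lemma QuadData.ω_ne (q : QuadData K D) : q.ω ≠ 0 := fun h => by
  have := q.indep 0 1 (by simp [h])
  simp at this

lemma QuadData.ne_sq (q : QuadData K D) (t : ℚ) : (D : ℚ) ≠ t ^ 2 := fun h => by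
  have h1 : (q.ω - t) * (q.ω + t) = 0 := by
    have := congrArg (Rat.cast : ℚ → K) h
    push_cast at this
    linear_combination q.sq + this
  rcases mul_eq_zero.1 h1 with h | h
  · have := q.indep (-t) 1 (by push_cast; linear_combination h)
    simp at this
  · have := q.indep t 1 (by push_cast; linear_combination h)
    simp at this

lemma QuadData.hessP_ne (q : QuadData K D) (hv : disc v = D) : hessP v ≠ 0 := fun h => by
  apply q.ne_sq ((hessQ v : ℤ) : ℚ)
  rw [← hv, disc, h]
  push_cast; ring

lemma QuadData.σσ (q : QuadData K D) (x : K) : q.σ (q.σ x) = x := by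
  obtain ⟨a, b, rfl⟩ := q.repr x
  simp [q.σω]

lemma hess_aux {K : Type*} [Field K] {α α' β β' δ δ' w n a b c d : K}
    (h0 : a * w * n ^ 3 = α ^ 3 * δ' - α' ^ 3 * δ)
    (h1 : b * w * n ^ 3 = α ^ 2 * β * δ' - α' ^ 2 * β' * δ)
    (h2 : c * w * n ^ 3 = α * β ^ 2 * δ' - α' * β' ^ 2 * δ)
    (h3 : d * w * n ^ 3 = β ^ 3 * δ' - β' ^ 3 * δ)
    (hw : α * β' - α' * β = - n * w) (hn : n ^ 3 = δ * δ') (hn0 : n ≠ 0) (hw0 : w ≠ 0) :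
    (b ^ 2 - a * c) * n = α * α' ∧ (b * c - a * d) * n = α * β' + α' * β ∧
      (c ^ 2 - b * d) * n = β * β' := by
  have key : ∀ X Y Z : K, w ^ 2 * n ^ 6 * X = n ^ 3 * Y * (α * β' - α' * β) ^ 2 →
      X * n = Y := fun X Y _ h => by
    rw [hw] at h
    have : (w ^ 2 * n ^ 5) * (X * n) = (w ^ 2 * n ^ 5) * Y := by linear_combination h
    exact mul_left_cancel₀ (mul_ne_zero (pow_ne_zero _ hw0) (pow_ne_zero _ hn0)) this
  refine ⟨key _ _ 0 ?_, key _ _ 0 ?_, key _ _ 0 ?_⟩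
  · rw [hn]
    calc w ^ 2 * n ^ 6 * (b ^ 2 - a * c)
        = (b * w * n ^ 3) ^ 2 - (a * w * n ^ 3) * (c * w * n ^ 3) := by ring
      _ = _ := by rw [h0, h1, h2]; ring
  · rw [hn]
    calc w ^ 2 * n ^ 6 * (b * c - a * d)
        = (b * w * n ^ 3) * (c * w * n ^ 3) - (a * w * n ^ 3) * (d * w * n ^ 3) := by ring
      _ = _ := by rw [h0, h1, h2, h3]; ring
  · rw [hn]
    calc w ^ 2 * n ^ 6 * (c ^ 2 - b * d)
        = (c * w * n ^ 3) ^ 2 - (b * w * n ^ 3) * (d * w * n ^ 3) := by ring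
      _ = _ := by rw [h1, h2, h3]; ring

namespace IsRep

lemma n_ne (h : IsRep q v I δ α β n g) (hδ : δ ≠ 0) : n ≠ 0 := fun h0 => by
  have := h.nm
  rw [h0] at this
  simp [hδ] at this

lemma conj_eq {u : K} {a : ℤ} {b : ℚ} (h : 2 * u = δ * (b + a * q.ω)) :
    2 * q.σ u = q.σ δ * (b - a * q.ω) := by
  have := congrArg q.σ h
  simp only [map_mul, map_add, map_ofNat, map_ratCast, map_intCast, q.σω] at this
  linear_combination this

lemma diff_eq (h : IsRep q v I δ α β n g) {u : K} {a : ℤ} {b : ℚ}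
    (hu : 2 * u = δ * (b + a * q.ω)) :
    (a : K) * q.ω * n ^ 3 = u * q.σ δ - q.σ u * δ := by
  have h2 : (2 : K) ≠ 0 := two_ne_zero
  apply mul_left_cancel₀ h2
  rw [h.nm]
  linear_combination - q.σ δ * hu + δ * conj_eq hu

lemma hess (h : IsRep q v I δ α β n g) (hδ : δ ≠ 0) :
    ((hessP v : ℤ) : K) * n = α * q.σ α ∧ ((hessQ v : ℤ) : K) * n = α * q.σ β + q.σ α * β ∧
      ((hessR v : ℤ) : K) * n = β * q.σ β := by
  have h0 := h.diff_eq h.e0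
  have h1 := h.diff_eq h.e1
  have h2 := h.diff_eq h.e2
  have h3 := h.diff_eq h.e3
  simp only [map_mul, map_pow] at h0 h1 h2 h3
  have := hess_aux h0 h1 h2 h3 h.wr h.nm (by exact_mod_cast h.n_ne hδ) q.ω_ne
  simpa [hessP, hessQ, hessR] using this

lemma disc_eq (h : IsRep q v I δ α β n g) (hδ : δ ≠ 0) : disc v = D := by
  obtain ⟨h1, h2, h3⟩ := h.hess hδ
  have hn : (n : K) ≠ 0 := by exact_mod_cast h.n_ne hδ
  have : ((disc v : ℤ) : K) = (D : ℤ) := by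
    apply mul_left_cancel₀ (pow_ne_zero 2 hn)
    rw [← q.sq, disc]
    push_cast
    calc (n : K) ^ 2 * (((hessQ v : ℤ) : K) ^ 2 - 4 * hessP v * hessR v)
        = (((hessQ v : ℤ) : K) * n) ^ 2 - 4 * (((hessP v : ℤ) : K) * n) * (((hessR v : ℤ) : K) * n) := by ring
      _ = (α * q.σ β - q.σ α * β) ^ 2 := by rw [h1, h2, h3]; ring
      _ = _ := by rw [h.wr]; ring
  exact_mod_cast this

lemma α_ne (h : IsRep q v I δ α β n g) (hδ : δ ≠ 0) : α ≠ 0 := fun h0 => by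
  have h1 := (h.hess hδ).1
  rw [h0, zero_mul] at h1
  have hn : (n : K) ≠ 0 := by exact_mod_cast h.n_ne hδ
  have hP : ((hessP v : ℤ) : K) ≠ 0 := by exact_mod_cast q.hessP_ne (h.disc_eq hδ)
  exact mul_ne_zero hP hn h1

lemma β_eq (h : IsRep q v I δ α β n g) (hδ : δ ≠ 0) :
    2 * ((hessP v : ℤ) : K) * β = α * ((hessQ v : ℤ) + q.ω) := by
  obtain ⟨h1, h2, h3⟩ := h.hess hδ
  have hn : (n : K) ≠ 0 := by exact_mod_cast h.n_ne hδ
  apply mul_left_cancel₀ hn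
  linear_combination 2 * β * h1 - α * h2 - α * h.wr

lemma g_eq (h : IsRep q v I δ α β n g) (hδ : δ ≠ 0) :
    g 0 = 2 * v 1 * (hessP v : ℤ) - v 0 * (hessQ v : ℤ) := by
  have h1 : ((g 0 * (hessQ v : ℤ) + v 0 * D : ℚ) + (g 0 + v 0 * (hessQ v : ℤ) : ℚ) * q.ω : K) =
      (2 * (hessP v : ℤ) * g 1 : ℚ) + (2 * (hessP v : ℤ) * v 1 : ℚ) * q.ω := by
    push_cast
    apply mul_left_cancel₀ hδ
    linear_combination δ * (-(v 0 : K)) * q.sq - ((hessQ v : ℤ) + q.ω) * h.e0 + 2 * ((hessP v : ℤ) : K) * h.e1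
      - 2 * α ^ 2 * h.β_eq hδ
  have := (q.coord_ext h1).2
  linear_combination this

/-- Two representations of the same form differ by a trivial pair. -/
lemma exists_scale (h : IsRep q v I δ α β n g) (h' : IsRep q v J δ' α' β' n' g')
    (hδ : δ ≠ 0) (hδ' : δ' ≠ 0) :
    ∃ κ : K, κ ≠ 0 ∧ δ' = κ ^ 3 * δ ∧ ∀ y, κ * y ∈ J ↔ y ∈ I := by
  have hα := h.α_ne hδ
  have hα' := h'.α_ne hδ'
  have hκ : α' / α ≠ 0 := div_ne_zero hα' hα
  have hP : ((hessP v : ℤ) : K) ≠ 0 := by exact_mod_cast q.hessP_ne (h.disc_eq hδ)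
  obtain ⟨κ, hκα⟩ : ∃ κ, κ = α' / α := ⟨_, rfl⟩
  have e1 : α' = κ * α := by rw [hκα]; field_simp
  rw [← hκα] at hκ
  have e2 : β' = κ * β := by
    apply mul_left_cancel₀ (mul_ne_zero two_ne_zero hP)
    rw [h'.β_eq hδ', e1]
    linear_combination -κ * h.β_eq hδ
  refine ⟨κ, hκ, ?_, fun y => ?_⟩
  · have h0 := h.e0
    have h0' := h'.e0
    rw [h.g_eq hδ] at h0
    rw [h'.g_eq hδ', e1] at h0'
    have : ((2 * v 1 * (hessP v : ℤ) - v 0 * (hessQ v : ℤ) : ℚ) + v 0 * q.ω : K) ≠ 0 := fun hz => by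
      rw [hz, mul_zero] at h0
      simp [hα] at h0
    apply mul_right_cancel₀ this
    linear_combination -h0' + κ ^ 3 * h0
  · rw [h.mem, h'.mem]
    refine exists_congr fun k => exists_congr fun l => ?_
    rw [e1, e2]
    constructor
    · intro h; apply mul_left_cancel₀ hκ; rw [h]; ring
    · rintro rfl; ring

lemma scale (h : IsRep q v I δ α β n g) {κ : K} (hκ : κ ≠ 0)
    (hJ : ∀ y, κ * y ∈ J ↔ y ∈ I) :
    ∃ m, IsRep q v J (κ ^ 3 * δ) (κ * α) (κ * β) m g := by
  refine ⟨Algebra.norm ℚ κ * n, ⟨fun y => ?_, ?_, ?_, ?_, ?_, ?_, ?_⟩⟩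
  · obtain ⟨z, rfl⟩ : ∃ z, y = κ * z := ⟨κ⁻¹ * y, by field_simp⟩
    rw [hJ, h.mem]
    refine exists_congr fun k => exists_congr fun l => ?_
    constructor
    · rintro rfl; ring
    · intro h; apply mul_left_cancel₀ hκ; rw [h]; ring
  · linear_combination κ ^ 3 * h.e0
  · linear_combination κ ^ 3 * h.e1
  · linear_combination κ ^ 3 * h.e2
  · linear_combination κ ^ 3 * h.e3
  · push_cast
    rw [q.nm, map_mul, map_mul]
    linear_combination κ * q.σ κ * h.wr
  · push_cast
    rw [q.nm, map_mul, map_pow]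
    linear_combination κ ^ 3 * q.σ κ ^ 3 * h.nm

lemma transform (h : IsRep q v I δ α β n g) (γ : Matrix.SpecialLinearGroup (Fin 2) ℤ) :
    ∃ α' β' g', IsRep q (act γ v) I δ α' β' n g' := by
  have hdet := det_eq γ
  have hdetK : (γ 0 0 * γ 1 1 - γ 0 1 * γ 1 0 : K) = 1 := by
    have := congrArg (Int.cast : ℤ → K) hdet
    push_cast at this
    exact this
  refine ⟨γ 1 1 * α - γ 1 0 * β, - γ 0 1 * α + γ 0 0 * β,
    subst (γ 1 1 : ℚ) (-γ 0 1) (-γ 1 0) (γ 0 0) g, ⟨fun y => ?_, ?_, ?_, ?_, ?_, ?_, h.nm⟩⟩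
  · rw [h.mem]
    constructor
    · rintro ⟨k, l, rfl⟩
      refine ⟨k * γ 0 0 + l * γ 0 1, k * γ 1 0 + l * γ 1 1, ?_⟩
      push_cast
      linear_combination (-k * α - l * β) * hdetK
    · rintro ⟨k, l, rfl⟩
      refine ⟨k * γ 1 1 - l * γ 0 1, - k * γ 1 0 + l * γ 0 0, ?_⟩
      push_cast
      ring
  · simp only [act, subst, Matrix.cons_val_zero, Matrix.cons_val_one, Matrix.cons_val]
    push_cast
    generalize (γ 1 1 : K) = p, (-γ 0 1 : K) = t, (γ 1 0 : K) = r, (γ 0 0 : K) = s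
    linear_combination p ^ 3 * h.e0 - 3 * p ^ 2 * r * h.e1 + 3 * p * r ^ 2 * h.e2 - r ^ 3 * h.e3
  · simp only [act, subst, Matrix.cons_val_zero, Matrix.cons_val_one, Matrix.cons_val]
    push_cast
    generalize (γ 1 1 : K) = p, (γ 0 1 : K) = t, (γ 1 0 : K) = r, (γ 0 0 : K) = s
    linear_combination - p ^ 2 * t * h.e0 + (p ^ 2 * s + 2 * p * t * r) * h.e1
      + (-2 * p * r * s - t * r ^ 2) * h.e2 + r ^ 2 * s * h.e3
  · simp only [act, subst, Matrix.cons_val_zero, Matrix.cons_val_one, Matrix.cons_val]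
    push_cast
    generalize (γ 1 1 : K) = p, (γ 0 1 : K) = t, (γ 1 0 : K) = r, (γ 0 0 : K) = s
    linear_combination p * t ^ 2 * h.e0 + (- 2 * p * t * s - t ^ 2 * r) * h.e1
      + (p * s ^ 2 + 2 * t * r * s) * h.e2 - r * s ^ 2 * h.e3
  · simp only [act, subst, Matrix.cons_val_zero, Matrix.cons_val_one, Matrix.cons_val]
    push_cast
    generalize (γ 1 1 : K) = p, (γ 0 1 : K) = t, (γ 1 0 : K) = r, (γ 0 0 : K) = s
    linear_combination - t ^ 3 * h.e0 + 3 * t ^ 2 * s * h.e1 - 3 * t * s ^ 2 * h.e2 + s ^ 3 * h.e3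
  · simp only [map_add, map_sub, map_mul, map_neg, map_intCast]
    linear_combination h.wr + (α * q.σ β - q.σ α * β) * hdetK

/-- Two forms attached to the same pair are equivalent. -/
lemma equiv (h : IsRep q v I δ α β n g) (h' : IsRep q w I δ α' β' n' g') (hδ : δ ≠ 0) :
    ∃ γ, act γ v = w := by
  obtain ⟨p, r, hp⟩ := (h.mem α').1 ((h'.mem α').2 ⟨1, 0, by simp⟩)
  obtain ⟨t, s, ht⟩ := (h.mem β').1 ((h'.mem β').2 ⟨0, 1, by simp⟩)
  have hn : (n : K) ≠ 0 := by exact_mod_cast h.n_ne hδ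
  have hnn : n = n' := by
    have h1 : n ^ 3 = n' ^ 3 := by
      have := h.nm.trans h'.nm.symm
      exact_mod_cast this
    exact (Odd.strictMono_pow (by decide : Odd 3)).injective h1
  have hdet : p * s - t * r = 1 := by
    have h1 := h'.wr
    rw [hp, ht, ← hnn] at h1
    simp only [map_add, map_mul, map_intCast] at h1
    have : ((p * s - t * r : ℤ) : K) = (1 : ℤ) := by
      push_cast
      apply mul_left_cancel₀ (mul_ne_zero (neg_ne_zero.2 hn) q.ω_ne)
      linear_combination h1 - (p * s - t * r) * h.wr
    exact_mod_cast this
  refine ⟨⟨!![s, -t; -r, p], by rw [Matrix.det_fin_two_of]; linarith⟩, ?_⟩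
  have e : act ⟨!![s, -t; -r, p], by rw [Matrix.det_fin_two_of]; linarith⟩ v =
      subst p t r s v := by simp [act]
  rw [e]
  have key : ∀ {x : K} {a b : ℤ} {c d : ℚ}, x = δ * (c + a * q.ω) → x = δ * (d + b * q.ω) →
      a = b := fun {x a b c d} h1 h2 => by
    have h3 := mul_left_cancel₀ hδ (h1.symm.trans h2)
    have := (q.coord_ext (a := c) (b := a) (c := d) (d := b) (by push_cast; exact h3)).2
    exact_mod_cast this
  ext i
  fin_cases i
  · refine key (c := subst (p : ℚ) t r s g 0) ?_ h'.e0
    simp only [subst, Fin.zero_eta, Fin.mk_one, Fin.reduceFinMk, Matrix.cons_val_zero,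
      Matrix.cons_val_one, Matrix.cons_val]
    push_cast
    rw [hp]
    linear_combination p ^ 3 * h.e0 + 3 * p ^ 2 * r * h.e1 + 3 * p * r ^ 2 * h.e2 + r ^ 3 * h.e3
  · refine key (c := subst (p : ℚ) t r s g 1) ?_ h'.e1
    simp only [subst, Fin.zero_eta, Fin.mk_one, Fin.reduceFinMk, Matrix.cons_val_zero,
      Matrix.cons_val_one, Matrix.cons_val]
    push_cast
    rw [hp, ht]
    linear_combination p ^ 2 * t * h.e0 + (p ^ 2 * s + 2 * p * t * r) * h.e1
      + (2 * p * r * s + t * r ^ 2) * h.e2 + r ^ 2 * s * h.e3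
  · refine key (c := subst (p : ℚ) t r s g 2) ?_ h'.e2
    simp only [subst, Fin.zero_eta, Fin.mk_one, Fin.reduceFinMk, Matrix.cons_val_zero,
      Matrix.cons_val_one, Matrix.cons_val]
    push_cast
    rw [hp, ht]
    linear_combination p * t ^ 2 * h.e0 + (2 * p * t * s + t ^ 2 * r) * h.e1
      + (p * s ^ 2 + 2 * t * r * s) * h.e2 + r * s ^ 2 * h.e3
  · refine key (c := subst (p : ℚ) t r s g 3) ?_ h'.e3
    simp only [subst, Fin.zero_eta, Fin.mk_one, Fin.reduceFinMk, Matrix.cons_val_zero,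
      Matrix.cons_val_one, Matrix.cons_val]
    push_cast
    rw [ht]
    linear_combination t ^ 3 * h.e0 + 3 * t ^ 2 * s * h.e1 + 3 * t * s ^ 2 * h.e2 + s ^ 3 * h.e3

end IsRep

end rep

end CubicForm

namespace CubicForm

open NumberField Module nonZeroDivisors

section rep

set_option linter.unusedSimpArgs false

variable {K : Type*} [Field K] [NumberField K] {D : ℤ}

lemma QuadData.not_dvd_hess (q : QuadData K D) {v : Fin 4 → ℤ} (hv : disc v = D) {p : ℤ}
    (hp : Prime p) (h1 : p ∣ hessP v) (h2 : p ∣ hessQ v) (h3 : p ∣ hessR v) : False := by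
  obtain ⟨P, hP⟩ := h1
  obtain ⟨Q, hQ⟩ := h2
  obtain ⟨R, hR⟩ := h3
  have hpK : (p : K) ≠ 0 := by exact_mod_cast hp.ne_zero
  have hD : D = p ^ 2 * (Q ^ 2 - 4 * P * R) := by rw [← hv, disc, hP, hQ, hR]; ring
  have hDK : (D : K) = p ^ 2 * (Q ^ 2 - 4 * P * R) := by rw [hD]; push_cast; ring
  have h_int : IsIntegral ℤ ((Q + q.ω / p) / 2 : K) := by
    refine ⟨Polynomial.X ^ 2 + (- Polynomial.C Q * Polynomial.X + Polynomial.C (P * R)),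
      ?_, ?_⟩
    · apply Polynomial.monic_X_pow_add
      compute_degree!
    · simp only [Polynomial.eval₂_add, Polynomial.eval₂_pow, Polynomial.eval₂_X,
        Polynomial.eval₂_mul, Polynomial.eval₂_neg, Polynomial.eval₂_C]
      simp only [eq_intCast, Int.cast_mul]
      field_simp
      linear_combination q.sq + hDK
  obtain ⟨m, n, -, h⟩ := (q.int _).1 h_int
  have := (q.coord_ext (a := Q) (b := 1 / p) (c := m) (d := n) (by
    push_cast; rw [← h]; ring)).2
  have hpQ : (p : ℚ) ≠ 0 := by exact_mod_cast hp.ne_zero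
  field_simp at this
  have h2 : 1 = p * n := by exact_mod_cast this
  exact hp.not_isUnit (IsUnit.of_mul_eq_one _ h2.symm)

lemma QuadData.bezout (q : QuadData K D) {v : Fin 4 → ℤ} (hv : disc v = D) :
    ∃ x y z, x * hessP v + y * hessQ v + z * hessR v = 1 := by
  have hc : IsCoprime ((Int.gcd (hessP v) (hessQ v) : ℕ) : ℤ) (hessR v) := by
    apply isCoprime_of_prime_dvd
    · rintro ⟨h1, -⟩
      exact q.hessP_ne hv (Int.gcd_eq_zero_iff.1 (by exact_mod_cast h1)).1
    · intro p hp h1 h2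
      exact q.not_dvd_hess hv hp (h1.trans (Int.gcd_dvd_left _ _)) (h1.trans (Int.gcd_dvd_right _ _)) h2
  obtain ⟨u, w, h⟩ := hc
  have := Int.gcd_eq_gcd_ab (hessP v) (hessQ v)
  exact ⟨u * Int.gcdA (hessP v) (hessQ v), u * Int.gcdB (hessP v) (hessQ v), w, by
    rw [← h, this]; ring⟩

lemma ideal_cube_le {R : Type*} [CommRing R] {x y d : R} (h0 : d ∣ x ^ 3) (h1 : d ∣ x ^ 2 * y)
    (h2 : d ∣ x * y ^ 2) (h3 : d ∣ y ^ 3) : Ideal.span {x, y} ^ 3 ≤ Ideal.span {d} := by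
  rw [pow_succ, pow_two, Ideal.span_pair_mul_span_pair, Ideal.span_mul_span', Ideal.span_le]
  rintro _ ⟨s, hs, t, ht, rfl⟩
  rw [SetLike.mem_coe, Ideal.mem_span_singleton]
  simp only [Set.mem_insert_iff, Set.mem_singleton_iff] at hs ht
  rcases hs with rfl | rfl | rfl | rfl <;> rcases ht with rfl | rfl <;> ring_nf at * <;>
    assumption

lemma eq_of_mul_eq {R : Type*} [CommRing R] [IsDedekindDomain R] {A B : Ideal R} {d e : R}
    (hA : A ≤ Ideal.span {d}) (hB : B ≤ Ideal.span {e}) (h : A * B = Ideal.span {d * e})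
    (hd : d ≠ 0) (he : e ≠ 0) : A = Ideal.span {d} := by
  obtain ⟨J, rfl⟩ := Ideal.dvd_iff_le.2 hA
  obtain ⟨J', rfl⟩ := Ideal.dvd_iff_le.2 hB
  rw [← Ideal.span_singleton_mul_span_singleton] at h
  have h1 : (Ideal.span {d} * Ideal.span {e}) * (J * J') =
      (Ideal.span {d} * Ideal.span {e}) * 1 := by
    rw [mul_one, ← mul_mul_mul_comm]
    exact h
  have h2 := mul_left_cancel₀ (by simp [hd, he]) h1
  have : J = 1 := by
    rw [Ideal.one_eq_top] at h2 ⊢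
    exact top_le_iff.1 (h2 ▸ Ideal.mul_le_left)
  rw [this, mul_one]

/-- Every form of discriminant `D` is attached to a pair. -/
theorem exists_pair (q : QuadData K D) {v : Fin 4 → ℤ} (hv : disc v = D) :
    ∃ x ∈ cubePairs (𝓞 K) K, ∃ α β n g, IsRep q v x.1 (x.2 : K) α β n g := by
  have hP0 := q.hessP_ne hv
  obtain ⟨x, y, z, hxyz⟩ := q.bezout hv
  have hDK : (D : K) = (hessQ v : ℤ) ^ 2 - 4 * (hessP v : ℤ) * (hessR v : ℤ) := by
    rw [← hv, disc]; push_cast; ring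
  have hDK' := q.sq.trans hDK
  have hQD : ∃ e, hessQ v - D = 2 * e := by
    have := (Int.even_mul_pred_self (hessQ v)).two_dvd
    obtain ⟨e, he⟩ := this
    exact ⟨2 * hessP v * hessR v - e, by rw [← hv, disc]; linear_combination -he⟩
  obtain ⟨e, he⟩ := hQD
  have mk : ∀ m n : ℤ, 2 ∣ m - D * n → ∃ t : 𝓞 K, 2 * (t : K) = m + n * q.ω ∧
      ∃ t' : 𝓞 K, (t' : K) = q.σ t := fun m n h => by
    have h2 : (2 : K) ≠ 0 := two_ne_zero
    have i1 : IsIntegral ℤ ((m + n * q.ω) / 2 : K) := (q.int _).2 ⟨m, n, h, by field_simp⟩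
    refine ⟨⟨_, i1⟩, ?_, ⟨q.σ ((m + n * q.ω) / 2), map_isIntegral_int q.σ i1⟩, rfl⟩
    change 2 * ((m + n * q.ω) / 2 : K) = _
    field_simp
  set P := hessP v with hP
  set Q := hessQ v with hQ
  set R := hessR v with hR
  have hP' : P = v 1 ^ 2 - v 0 * v 2 := rfl
  have hQ' : Q = v 1 * v 2 - v 0 * v 3 := rfl
  have hR' : R = v 2 ^ 2 - v 1 * v 3 := rfl
  obtain ⟨β, hβ, β', hβ'⟩ := mk Q 1 ⟨e, by linear_combination he⟩
  obtain ⟨δ, hδ, δ', hδ'⟩ := mk (2 * v 1 * P - v 0 * Q) (-v 0)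
    ⟨v 1 * P - v 0 * e, by linear_combination -v 0 * he⟩
  obtain ⟨t0, ht0, t0', ht0'⟩ := mk (2 * v 1 * P - v 0 * Q) (v 0)
    ⟨v 1 * P - v 0 * e - D * v 0, by linear_combination -v 0 * he⟩
  obtain ⟨t1, ht1, t1', ht1'⟩ := mk (v 1 * Q - 2 * v 0 * R) (v 1)
    ⟨v 1 * e - v 0 * R, by linear_combination v 1 * he⟩
  obtain ⟨t2, ht2, t2', ht2'⟩ := mk (2 * P * v 3 - v 2 * Q) (v 2)
    ⟨P * v 3 - v 2 * e - D * v 2, by linear_combination -v 2 * he⟩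
  obtain ⟨t3, ht3, t3', ht3'⟩ := mk (v 3 * Q - 2 * v 2 * R) (v 3)
    ⟨v 3 * e - v 2 * R, by linear_combination v 3 * he⟩
  push_cast at hβ hδ ht0 ht1 ht2 ht3
  rw [one_mul] at hβ
  have hσβ : 2 * q.σ (β : K) = Q - q.ω := by
    have := congrArg q.σ hβ
    rw [map_mul, map_ofNat] at this
    simpa [q.σω, sub_eq_add_neg] using this
  have hσδ : 2 * q.σ (δ : K) = (2 * v 1 * P - v 0 * Q) + v 0 * q.ω := by
    have := congrArg q.σ hδ
    simp only [map_mul, map_add, map_sub, map_neg, map_intCast, map_ofNat, q.σω] at this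
    linear_combination this
  have hPK : (P : K) = v 1 ^ 2 - v 0 * v 2 := by rw [hP']; push_cast; ring
  have hQK : (Q : K) = v 1 * v 2 - v 0 * v 3 := by rw [hQ']; push_cast; ring
  have hRK : (R : K) = v 2 ^ 2 - v 1 * v 3 := by rw [hR']; push_cast; ring
  have hω : q.ω = 2 * (β : K) - Q := by linear_combination -hβ
  have hβ2 : (β : K) ^ 2 = Q * β - P * R := by
    rw [hω] at hDK'; linear_combination hDK' / 4
  have hδ2 : (δ : K) = v 1 * P - v 0 * β := by
    rw [hω] at hδ; linear_combination hδ / 2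
  have ht02 : (t0 : K) = v 1 * P - v 0 * Q + v 0 * β := by
    rw [hω] at ht0; linear_combination ht0 / 2
  have ht12 : (t1 : K) = - v 0 * R + v 1 * β := by
    rw [hω] at ht1; linear_combination ht1 / 2
  have ht22 : (t2 : K) = P * v 3 - v 2 * Q + v 2 * β := by
    rw [hω] at ht2; linear_combination ht2 / 2
  have ht32 : (t3 : K) = - v 2 * R + v 3 * β := by
    rw [hω] at ht3; linear_combination ht3 / 2
  have e0 : (P : K) ^ 3 = δ * t0 := by
    rw [hδ2, ht02]; rw [hPK, hQK, hRK] at *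
    linear_combination v 0 ^ 2 * hβ2
  have e1 : (P : K) ^ 2 * β = δ * t1 := by
    rw [hδ2, ht12]; rw [hPK, hQK, hRK] at *
    linear_combination v 0 * v 1 * hβ2
  have e2 : (P : K) * β ^ 2 = δ * t2 := by
    rw [hδ2, ht22]; rw [hPK, hQK, hRK] at *
    linear_combination v 1 ^ 2 * hβ2
  have e3 : (β : K) ^ 3 = δ * t3 := by
    rw [hδ2, ht32]; rw [hPK, hQK, hRK] at *
    linear_combination (β + v 1 * v 2) * hβ2
  have hδδ : (P : K) ^ 3 = δ * q.σ δ := by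
    rw [e0]; congr 1; linear_combination ht0 / 2 - hσδ / 2
  have f0 := congrArg q.σ e0
  have f1 := congrArg q.σ e1
  have f2 := congrArg q.σ e2
  have f3 := congrArg q.σ e3
  simp only [map_mul, map_pow, map_intCast, ← hβ', ← hδ', ← ht0', ← ht1', ← ht2', ← ht3']
    at f0 f1 f2 f3
  have hσβ' : (β' : K) = Q - β := by rw [hβ']; linear_combination hσβ / 2 + hβ / 2
  set p : 𝓞 K := (P : 𝓞 K) with hp
  have hpK : (p : K) = (P : K) := by simp [hp]
  have hP0K : (P : K) ≠ 0 := by exact_mod_cast hP0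
  have hδ0 : δ ≠ 0 := fun h => by
    rw [h] at hδδ; simp [hP0] at hδδ
  have hδ'0 : δ' ≠ 0 := fun h => by
    rw [h] at hδ'; rw [← hδ'] at hδδ; simp [hP0] at hδδ
  have hc1 : Ideal.span {p, β} ^ 3 ≤ Ideal.span {δ} := ideal_cube_le
    ⟨t0, RingOfIntegers.ext (by simpa [hpK] using e0)⟩
    ⟨t1, RingOfIntegers.ext (by simpa [hpK] using e1)⟩
    ⟨t2, RingOfIntegers.ext (by simpa [hpK] using e2)⟩
    ⟨t3, RingOfIntegers.ext (by simpa [hpK] using e3)⟩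
  have hc2 : Ideal.span {p, β'} ^ 3 ≤ Ideal.span {δ'} := ideal_cube_le
    ⟨t0', RingOfIntegers.ext (by simpa [hpK] using f0)⟩
    ⟨t1', RingOfIntegers.ext (by simpa [hpK] using f1)⟩
    ⟨t2', RingOfIntegers.ext (by simpa [hpK] using f2)⟩
    ⟨t3', RingOfIntegers.ext (by simpa [hpK] using f3)⟩
  have hββ : β * β' = p * (R : 𝓞 K) := RingOfIntegers.ext (by
    change (β : K) * (β' : K) = (p : K) * ((R : 𝓞 K) : K)
    rw [hpK]; simp only [map_intCast]
    rw [hσβ']; linear_combination -hβ2)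
  have hβs : β + β' = (Q : 𝓞 K) := RingOfIntegers.ext (by
    change (β : K) + (β' : K) = ((Q : 𝓞 K) : K)
    simp only [map_intCast]
    rw [hσβ']; ring)
  have hbez : (x : 𝓞 K) * p + y * Q + z * R = 1 := by
    rw [hp]; exact_mod_cast hxyz
  have hprod : Ideal.span {p, β} * Ideal.span {p, β'} = Ideal.span {p} := by
    rw [Ideal.span_pair_mul_span_pair]
    apply le_antisymm
    · rw [Ideal.span_le]
      rintro t (rfl | rfl | rfl | rfl) <;> rw [SetLike.mem_coe, Ideal.mem_span_singleton]
      · exact dvd_mul_right _ _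
      · exact dvd_mul_right _ _
      · exact dvd_mul_left _ _
      · exact ⟨_, hββ⟩
    · rw [Ideal.span_singleton_le_iff_mem]
      have : x * (p * p) + y * (p * β') + y * (β * p) + z * (β * β') = p := by
        rw [hββ]; linear_combination p * hbez + y * p * hβs
      have hm : x * (p * p) + y * (p * β') + y * (β * p) + z * (β * β') ∈
          Ideal.span {p * p, p * β', β * p, β * β'} := by
        refine add_mem (add_mem (add_mem ?_ ?_) ?_) ?_ <;>
          exact Ideal.mul_mem_left _ _ (Ideal.subset_span (by simp))
      rwa [this] at hm
  have hcube : Ideal.span {p, β} ^ 3 = Ideal.span {δ} := by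
    refine eq_of_mul_eq hc1 hc2 ?_ hδ0 hδ'0
    rw [← mul_pow, hprod, Ideal.span_singleton_pow]
    congr 2
    exact RingOfIntegers.ext (by simpa [hpK, hδ'] using hδδ)
  have hI0 : ((Ideal.span {p, β} : Ideal (𝓞 K)) : FractionalIdeal (𝓞 K)⁰ K) ≠ 0 := by
    rw [FractionalIdeal.coeIdeal_ne_zero]
    intro h
    rw [h] at hcube
    have := hcube.symm
    simp [hδ0] at this
  have hδK : (δ : K) ≠ 0 := by simpa using hδ0
  have coord : ∀ u : 𝓞 K, ∃ k l : ℤ, (u : K) = k + l * β := fun u => by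
    obtain ⟨m, n, ⟨r, hr⟩, h⟩ := (q.int _).1 u.isIntegral_coe
    refine ⟨r - n * e, n, ?_⟩
    have hr' : (m : K) - D * n = 2 * r := by exact_mod_cast hr
    have he' : (Q : K) - D = 2 * e := by exact_mod_cast he
    push_cast
    rw [hω] at h
    linear_combination h / 2 + hr' / 2 - n * he' / 2
  refine ⟨(Units.mk0 _ hI0, Units.mk0 _ hδK), ?_, P, β, P,
    ![2 * v 1 * P - v 0 * Q, v 1 * Q - 2 * v 0 * R, 2 * P * v 3 - v 2 * Q,
      v 3 * Q - 2 * v 2 * R], ?_⟩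
  · rw [mem_cubePairs]
    apply Units.ext
    simp only [Units.val_pow_eq_pow_val, Units.val_mk0, coe_toPrincipalIdeal]
    rw [← FractionalIdeal.coeIdeal_pow, hcube, FractionalIdeal.coeIdeal_span_singleton]
  · refine ⟨fun t => ?_, ?_, ?_, ?_, ?_, ?_, ?_⟩
    · simp only [Units.val_mk0, FractionalIdeal.mem_coeIdeal, Ideal.mem_span_pair]
      constructor
      · rintro ⟨_, ⟨u, w, rfl⟩, rfl⟩
        obtain ⟨k, l, h⟩ := coord u
        obtain ⟨k', l', h'⟩ := coord w
        refine ⟨k - l' * R, l * P + k' + l' * Q, ?_⟩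
        rw [map_add, map_mul, map_mul]
        change (u : K) * (p : K) + (w : K) * (β : K) = _
        rw [h, h', hpK]
        push_cast
        linear_combination l' * hβ2
      · rintro ⟨k, l, rfl⟩
        exact ⟨_, ⟨k, l, rfl⟩, by simp [hpK]⟩
    · simp [e0]; linear_combination δ * ht0
    · simp [e1]; linear_combination δ * ht1
    · simp [e2]; linear_combination δ * ht2
    · simp [e3]; linear_combination δ * ht3
    · simp; linear_combination P * hσβ / 2 - P * hβ / 2
    · simpa using hδδ

end rep

end CubicForm

namespace CubicForm

open NumberField Module nonZeroDivisors Matrix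

section count

variable {K : Type*} [Field K] [NumberField K]

lemma exists_ideal_basis (h2 : finrank ℚ K = 2) (I : (FractionalIdeal (𝓞 K)⁰ K)ˣ) :
    ∃ α β : K, (∀ y, y ∈ (I : FractionalIdeal (𝓞 K)⁰ K) ↔ ∃ k l : ℤ, y = k * α + l * β) ∧
      Algebra.discr ℚ ![α, β] = FractionalIdeal.absNorm (I : FractionalIdeal (𝓞 K)⁰ K) ^ 2 *
        discr K := by
  classical
  let b := basisOfFractionalIdeal K I
  let e : Free.ChooseBasisIndex ℤ (𝓞 K) ≃ Free.ChooseBasisIndex ℤ I :=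
    Fintype.equivOfCardEq (by
      rw [← finrank_eq_card_chooseBasisIndex, ← finrank_eq_card_chooseBasisIndex,
        fractionalIdeal_rank])
  have hc : Fintype.card (Free.ChooseBasisIndex ℤ (𝓞 K)) = 2 := by
    rw [← finrank_eq_card_chooseBasisIndex, RingOfIntegers.rank, h2]
  let f : Free.ChooseBasisIndex ℤ (𝓞 K) ≃ Fin 2 := Fintype.equivFinOfCardEq hc
  let b' := b.reindex e.symm
  let b'' := b'.reindex f
  have hb'' : ![b'' 0, b'' 1] = (b' : _ → K) ∘ f.symm := by
    ext i
    fin_cases i <;> simp [b'']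
  refine ⟨b'' 0, b'' 1, fun y => ?_, ?_⟩
  · have : Set.range b'' = Set.range b := by simp [b'', b']
    have h := mem_span_basisOfFractionalIdeal K (I := I) (x := y)
    rw [SetLike.mem_coe] at h
    rw [← h]
    change y ∈ Submodule.span ℤ (Set.range b) ↔ _
    rw [← this, Submodule.mem_span_range_iff_exists_fun]
    constructor
    · rintro ⟨c, rfl⟩
      exact ⟨c 0, c 1, by simp [Fin.sum_univ_two]⟩
    · rintro ⟨k, l, rfl⟩
      exact ⟨![k, l], by simp [Fin.sum_univ_two]⟩
  · have h1 := det_basisOfFractionalIdeal_eq_absNorm K I e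
    rw [hb'', Algebra.discr_reindex, ← h1, sq_abs, coe_discr, Basis.det_apply,
      ← Algebra.discr_of_matrix_vecMul, Basis.toMatrix_map_vecMul]

variable {D : ℤ}

lemma QuadData.discr_pair (q : QuadData K D) (α β : K) :
    (Algebra.discr ℚ ![α, β] : K) = (α * q.σ β - q.σ α * β) ^ 2 := by
  rw [Algebra.discr_def, det_fin_two]
  simp only [Algebra.traceMatrix_apply, Algebra.traceForm_apply, cons_val_zero, cons_val_one]
  push_cast
  rw [q.tr, q.tr, q.tr, q.tr]
  simp only [map_mul]
  ring

lemma QuadData.exists_rep_of_basis (q : QuadData K D) {I : FractionalIdeal (𝓞 K)⁰ K}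
    {α β δ : K} {n : ℚ}
    (hI : I ^ 3 = FractionalIdeal.spanSingleton _ δ)
    (mem : ∀ y, y ∈ I ↔ ∃ k l : ℤ, y = k * α + l * β)
    (wr : α * q.σ β - q.σ α * β = -n * q.ω) (nm : (n : K) ^ 3 = δ * q.σ δ) :
    ∃ v g, IsRep q v I δ α β n g := by
  have hα : α ∈ I := (mem _).2 ⟨1, 0, by simp⟩
  have hβ : β ∈ I := (mem _).2 ⟨0, 1, by simp⟩
  have key : ∀ x y z, x ∈ I → y ∈ I → z ∈ I → ∃ a b : ℤ, 2 * (x * y * z) = δ * (b + a * q.ω) := by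
    intro x y z hx hy hz
    have : x * y * z ∈ I ^ 3 := by
      rw [pow_succ, pow_two]
      exact FractionalIdeal.mul_mem_mul (FractionalIdeal.mul_mem_mul hx hy) hz
    rw [hI, FractionalIdeal.mem_spanSingleton] at this
    obtain ⟨t, ht⟩ := this
    obtain ⟨m, n, -, h⟩ := (q.int _).1 t.isIntegral_coe
    refine ⟨n, m, ?_⟩
    rw [← ht, ← h, Algebra.smul_def]
    change 2 * ((t : K) * δ) = _
    ring
  obtain ⟨a0, b0, h0⟩ := key _ _ _ hα hα hα
  obtain ⟨a1, b1, h1⟩ := key _ _ _ hα hα hβ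
  obtain ⟨a2, b2, h2⟩ := key _ _ _ hα hβ hβ
  obtain ⟨a3, b3, h3⟩ := key _ _ _ hβ hβ hβ
  refine ⟨![a0, a1, a2, a3], ![b0, b1, b2, b3], mem, ?_, ?_, ?_, ?_, wr, nm⟩
  · simp; rw [← h0]; ring
  · simp; rw [← h1]; ring
  · simp; rw [← h2]; ring
  · simp; rw [← h3]; ring

theorem exists_rep (h2 : finrank ℚ K = 2) (q : QuadData K (discr K))
    {x : (FractionalIdeal (𝓞 K)⁰ K)ˣ × Kˣ} (hx : x ∈ cubePairs (𝓞 K) K) :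
    ∃ v α β n g, IsRep q v x.1 (x.2 : K) α β n g := by
  obtain ⟨I, δ⟩ := x
  obtain ⟨α, β, mem, hd⟩ := exists_ideal_basis h2 I
  have hI : (I : FractionalIdeal (𝓞 K)⁰ K) ^ 3 = FractionalIdeal.spanSingleton _ (δ : K) := by
    have := congrArg Units.val (mem_cubePairs.1 hx)
    simpa using this
  obtain ⟨p, m, hw⟩ := q.repr (α * q.σ β - q.σ α * β)
  have hp : p = 0 := by
    have h := congrArg q.σ hw
    simp only [map_sub, map_mul, map_add, q.σσ, q.σω, map_ratCast] at h
    have := q.indep (2 * p) 0 (by push_cast; linear_combination -h - hw)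
    linarith [this.1]
  rw [hp, Rat.cast_zero, zero_add] at hw
  have hm : m ^ 2 = FractionalIdeal.absNorm (I : FractionalIdeal (𝓞 K)⁰ K) ^ 2 := by
    have h := q.discr_pair α β
    rw [hd, hw, mul_pow, q.sq] at h
    have h' : (m ^ 2 * discr K : ℚ) =
        FractionalIdeal.absNorm (I : FractionalIdeal (𝓞 K)⁰ K) ^ 2 * discr K := by
      exact_mod_cast h.symm
    exact mul_right_cancel₀ (by exact_mod_cast discr_ne_zero K) h'
  have hN : FractionalIdeal.absNorm (I : FractionalIdeal (𝓞 K)⁰ K) ^ 3 =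
      |Algebra.norm ℚ (δ : K)| := by
    rw [← map_pow, hI, FractionalIdeal.absNorm_span_singleton]
  have hm3 : (m ^ 3) ^ 2 = (Algebra.norm ℚ (δ : K)) ^ 2 := by
    rw [← sq_abs (Algebra.norm ℚ _), ← hN, ← pow_mul, ← pow_mul, mul_comm, pow_mul, hm, ← pow_mul]
  rcases sq_eq_sq_iff_eq_or_eq_neg.1 hm3 with h | h
  · obtain ⟨v, g, hr⟩ := q.exists_rep_of_basis (α := β) (β := α) (n := m) hI
      (fun y => by rw [mem, exists_comm]; simp only [add_comm]) (by linear_combination -hw)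
      (by rw [← q.nm]; exact_mod_cast h)
    exact ⟨v, _, _, _, _, hr⟩
  · obtain ⟨v, g, hr⟩ := q.exists_rep_of_basis (n := -m) hI mem
      (by push_cast; linear_combination hw)
      (by rw [← q.nm, ← neg_eq_iff_eq_neg.2 h]; push_cast; ring)
    exact ⟨v, _, _, _, _, hr⟩

lemma eq_mul_trivialPair_iff {x y : cubePairs (𝓞 K) K} {κ : Kˣ} :
    x * trivialPair (𝓞 K) K κ = y ↔ ((y.1.2 : K) = κ ^ 3 * x.1.2 ∧
      ∀ t, (κ : K) * t ∈ (y.1.1 : FractionalIdeal (𝓞 K)⁰ K) ↔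
        t ∈ (x.1.1 : FractionalIdeal (𝓞 K)⁰ K)) := by
  have h1 : x * trivialPair (𝓞 K) K κ = y ↔
      (FractionalIdeal.spanSingleton _ (κ : K) * (x.1.1 : FractionalIdeal (𝓞 K)⁰ K) =
        (y.1.1 : FractionalIdeal (𝓞 K)⁰ K) ∧ (κ ^ 3 * x.1.2 : K) = y.1.2) := by
    rw [Subtype.ext_iff, Prod.ext_iff, Units.ext_iff, Units.ext_iff, mul_comm x]
    simp [trivialPair]
  rw [h1, and_comm, eq_comm (a := (κ ^ 3 * x.1.2 : K))]
  refine and_congr_right fun _ => ?_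
  have hκ : (κ : K) ≠ 0 := κ.ne_zero
  constructor
  · rintro h t
    rw [← h, FractionalIdeal.mem_singleton_mul]
    constructor
    · rintro ⟨t', ht', h⟩
      rwa [mul_left_cancel₀ hκ h]
    · exact fun h => ⟨t, h, rfl⟩
  · intro h
    ext t
    rw [FractionalIdeal.mem_singleton_mul]
    constructor
    · rintro ⟨t', ht', rfl⟩
      exact (h t').2 ht'
    · intro ht
      refine ⟨(κ : K)⁻¹ * t, (h _).1 ?_, ?_⟩ <;> rw [mul_inv_cancel_left₀ hκ]
      exact ht

theorem card_orbit_eq_index (h2 : finrank ℚ K = 2) (q : QuadData K (discr K)) :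
    Nat.card {o : Orbit // o.disc = discr K} = (trivialPair (𝓞 K) K).range.index := by
  choose! v α β n g hr using fun (x : cubePairs (𝓞 K) K) => exists_rep h2 q x.2
  let F : cubePairs (𝓞 K) K → {o : Orbit // o.disc = discr K} := fun x =>
    ⟨Quotient.mk orbitSetoid (v x), (hr x).disc_eq x.1.2.ne_zero⟩
  have hF : ∀ x y, F x = F y ↔ x⁻¹ * y ∈ (trivialPair (𝓞 K) K).range := fun x y => by
    rw [Subtype.ext_iff]
    change Quotient.mk orbitSetoid (v x) = Quotient.mk orbitSetoid (v y) ↔ _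
    rw [orbit_eq_iff, MonoidHom.mem_range]
    simp only [eq_inv_mul_iff_mul_eq]
    constructor
    · rintro ⟨γ, hγ⟩
      obtain ⟨α', β', g', h⟩ := (hr x).transform γ
      rw [hγ] at h
      obtain ⟨κ, hκ, h3⟩ := h.exists_scale (hr y) x.1.2.ne_zero y.1.2.ne_zero
      exact ⟨Units.mk0 κ hκ, eq_mul_trivialPair_iff.2 h3⟩
    · rintro ⟨κ, hκ⟩
      obtain ⟨h4, h3⟩ := eq_mul_trivialPair_iff.1 hκ
      obtain ⟨m, h⟩ := (hr x).scale κ.ne_zero h3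
      rw [← h4] at h
      exact h.equiv (hr y) y.1.2.ne_zero
  have hsurj : Function.Surjective F := by
    rintro ⟨o, ho⟩
    induction o using Quotient.inductionOn with
    | _ w =>
      obtain ⟨x, hx, _, _, _, _, h⟩ := exists_pair q (show disc w = discr K from ho)
      have h' := hr ⟨x, hx⟩
      refine ⟨⟨x, hx⟩, Subtype.ext (orbit_eq_iff.2 (h'.equiv h x.2.ne_zero))⟩
  rw [Subgroup.index]
  symm
  refine Nat.card_congr (Equiv.ofBijective
    (Quotient.lift F fun x y h => (hF x y).2 (QuotientGroup.leftRel_apply.1 h)) ⟨?_, ?_⟩)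
  · intro x y
    induction x using Quotient.inductionOn with
    | _ x =>
      induction y using Quotient.inductionOn with
      | _ y => exact fun h => Quotient.sound (QuotientGroup.leftRel_apply.2 ((hF x y).1 h))
  · intro o
    obtain ⟨x, hx⟩ := hsurj o
    exact ⟨Quotient.mk _ x, hx⟩

theorem card_orbit_of_pos (h2 : finrank ℚ K = 2) (hD : 0 < discr K) :
    Nat.card {o : Orbit // o.disc = discr K} =
      3 * Nat.card {g : ClassGroup (𝓞 K) // g ^ 3 = 1} := by
  obtain ⟨q⟩ := exists_quadData h2
  rw [card_orbit_eq_index h2 q, index_trivialPair, index_cubes_of_pos q hD]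

theorem card_orbit_of_neg (h2 : finrank ℚ K = 2) (hD : discr K < -4) :
    Nat.card {o : Orbit // o.disc = discr K} =
      Nat.card {g : ClassGroup (𝓞 K) // g ^ 3 = 1} := by
  obtain ⟨q⟩ := exists_quadData h2
  rw [card_orbit_eq_index h2 q, index_trivialPair, index_cubes_of_neg q hD, one_mul]

end count

end CubicForm

namespace CubicForm

open NumberField Module Matrix

/-- `D` is congruent to `0` or `1` modulo `4`. -/
def IsDiscMod (D : ℤ) : Prop := D % 4 = 0 ∨ D % 4 = 1

/-- `D` is a fundamental discriminant (possibly `1`). -/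
def Fund (D : ℤ) : Prop :=
  IsDiscMod D ∧ ∀ p : ℕ, p.Prime → ∀ E, D = p ^ 2 * E → ¬ IsDiscMod E

lemma sq_mod_four (m : ℤ) : m ^ 2 % 4 = m % 2 := by
  rcases Int.even_or_odd' m with ⟨k, rfl | rfl⟩ <;> ring_nf <;> omega

lemma IsDiscMod.sq_mul {E : ℤ} (h : IsDiscMod E) (m : ℤ) : IsDiscMod (m ^ 2 * E) := by
  have h1 := sq_mod_four m
  have h2 := Int.emod_two_eq_zero_or_one m
  unfold IsDiscMod at *
  rw [Int.mul_emod, h1]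
  rcases h2 with h2 | h2 <;> rw [h2] <;> omega

lemma IsDiscMod.of_sq_mul {E m : ℤ} (hm : m % 2 = 1) (h : IsDiscMod (m ^ 2 * E)) :
    IsDiscMod E := by
  have h1 := sq_mod_four m
  unfold IsDiscMod at *
  rw [Int.mul_emod, h1, hm] at h
  omega

lemma isDiscMod_disc (v : Fin 4 → ℤ) : IsDiscMod (disc v) := by
  have h1 := sq_mod_four (hessQ v)
  unfold IsDiscMod disc
  rw [mul_assoc]
  have := Int.emod_two_eq_zero_or_one (hessQ v)
  omega

lemma Fund.not_dvd_sq {D : ℤ} (h : Fund D) {p : ℕ} (hp : p.Prime) (hp2 : p ≠ 2) :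
    ¬ (p : ℤ) ^ 2 ∣ D := by
  rintro ⟨E, hE⟩
  refine h.2 p hp E hE (IsDiscMod.of_sq_mul (m := p) ?_ (hE ▸ h.1))
  have := hp.eq_two_or_odd
  omega

lemma Fund.eq_one {D F m : ℤ} (h : Fund D) (hF : IsDiscMod F) (hD : D = m ^ 2 * F) : m.natAbs = 1 := by
  by_contra h1
  obtain ⟨p, hp, k, hk⟩ := Nat.exists_prime_and_dvd h1
  apply h.2 p hp (k ^ 2 * F) _ (hF.sq_mul k)
  have : m ^ 2 = (p * k : ℤ) ^ 2 := by
    rw [← Int.natAbs_sq, hk]; push_cast; ring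
  rw [hD, this]; ring

lemma Fund.ne_sq {D : ℤ} (h : Fund D) (h1 : D ≠ 1) (t : ℤ) : D ≠ t ^ 2 := fun hD => by
  have := h.eq_one (F := 1) (by unfold IsDiscMod; norm_num) (m := t) (by linarith)
  apply h1
  rw [hD, ← Int.natAbs_sq, this]; norm_num

section

variable {K : Type*} [Field K] [NumberField K] {D : ℤ}

lemma QuadData.not_two_dvd (q : QuadData K D) {x : K} {b c : ℤ} {p : ℕ}
    (h : p * (2 * x) = c + b * q.ω) (hb : b % p ≠ 0) (hx : ∃ s t : ℤ, x ^ 2 = s * x + t) : False := by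
  obtain ⟨s, t, hst⟩ := hx
  have h_int : IsIntegral ℤ x := by
    refine ⟨Polynomial.X ^ 2 + (- Polynomial.C s * Polynomial.X + Polynomial.C (-t)), ?_, ?_⟩
    · apply Polynomial.monic_X_pow_add
      compute_degree!
    · simp only [Polynomial.eval₂_add, Polynomial.eval₂_pow, Polynomial.eval₂_X,
        Polynomial.eval₂_mul, Polynomial.eval₂_neg, Polynomial.eval₂_C]
      simp only [eq_intCast, Int.cast_neg]
      linear_combination hst
  obtain ⟨m, n, -, h'⟩ := (q.int _).1 h_int
  rw [h'] at h
  have := (q.coord_ext (a := p * m) (b := p * n) (c := c) (d := b) (by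
    push_cast; rw [← h]; ring)).2
  have h2 : p * n = b := by exact_mod_cast this
  apply hb
  rw [← h2]; simp

lemma QuadData.isDiscMod (q : QuadData K D) : IsDiscMod D := by
  have h_int : IsIntegral ℤ ((D + q.ω) / 2 : K) :=
    (q.int _).2 ⟨D, 1, ⟨0, by ring⟩, by push_cast; ring⟩
  have h2 : IsIntegral ℤ (q.σ ((D + q.ω) / 2 : K)) := map_isIntegral_int q.σ h_int
  have h3 := h_int.mul h2
  have h4 : ((D + q.ω) / 2 : K) * q.σ ((D + q.ω) / 2 : K) =
      algebraMap ℚ K ((D ^ 2 - D : ℤ) / 4) := by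
    simp only [map_div₀, map_add, map_intCast, map_ofNat, q.σω]
    push_cast
    linear_combination - q.sq / 4
  rw [h4, isIntegral_algebraMap_iff (algebraMap ℚ K).injective,
    IsIntegrallyClosed.isIntegral_iff] at h3
  obtain ⟨k, hk⟩ := h3
  have h5 : D ^ 2 - D = 4 * k := by
    have : ((D ^ 2 - D : ℤ) : ℚ) = 4 * k := by
      rw [eq_intCast] at hk; rw [hk]; ring
    exact_mod_cast this
  have h1 := sq_mod_four D
  unfold IsDiscMod
  omega

lemma QuadData.fund (q : QuadData K D) : Fund D := by
  refine ⟨q.isDiscMod, fun p hp E hE hmod => ?_⟩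
  have hpK : (p : K) ≠ 0 := by exact_mod_cast hp.ne_zero
  have hDK : (D : K) = p ^ 2 * E := by rw [hE]; push_cast; ring
  obtain ⟨k, hk⟩ : ∃ k, E - E ^ 2 = 4 * k := by
    have h1 := sq_mod_four E
    unfold IsDiscMod at hmod
    exact ⟨(E - E ^ 2) / 4, by omega⟩
  have hk' : (E : K) - E ^ 2 = 4 * k := by exact_mod_cast hk
  have h0 := q.sq
  rw [hDK] at h0
  refine q.not_two_dvd (p := p) (x := (E + q.ω / p) / 2) (b := 1) (c := p * E) ?_ ?_
    ⟨E, k, ?_⟩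
  · push_cast; field_simp
  · have := hp.two_le
    rw [Int.emod_eq_of_lt] <;> omega
  · field_simp
    linear_combination h0 + p ^ 2 * hk'

end

lemma fund_of_isQuadraticDisc {D : ℤ} (h : IsQuadraticDisc D) : Fund D ∧ D ≠ 1 := by
  obtain ⟨K, hK, hD⟩ := h
  have : FiniteDimensional ℚ K := FiniteDimensional.of_finrank_pos (by omega)
  have : NumberField K := ⟨⟩
  have hd : discr K = D := by rw [← hD, fieldDisc, dif_pos ‹_›]
  obtain ⟨q⟩ := exists_quadData hK
  rw [hd] at q
  exact ⟨q.fund, fun h => q.ne_sq 1 (by rw [h]; norm_num)⟩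

lemma isQuadraticDisc_of_fund {D : ℤ} (h : Fund D) (h1 : D ≠ 1) : IsQuadraticDisc D := by
  obtain ⟨s, hs⟩ : ∃ s : ℂ, s ^ 2 = D := IsAlgClosed.exists_pow_nat_eq _ two_pos
  have hsq : ∀ t : ℚ, (D : ℚ) ≠ t ^ 2 := fun t ht => by
    have : IsIntegral ℤ t := by
      refine IsIntegral.of_pow two_pos ?_
      rw [← ht]; exact isIntegral_algebraMap (R := ℤ) (x := D)
    rw [IsIntegrallyClosed.isIntegral_iff] at this
    obtain ⟨k, rfl⟩ := this
    rw [eq_intCast] at ht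
    exact h.ne_sq h1 k (by exact_mod_cast ht)
  have hirr : Irreducible (Polynomial.X ^ 2 - Polynomial.C (D : ℚ)) :=
    X_pow_sub_C_irreducible_of_prime Nat.prime_two fun t ht => hsq t ht.symm
  have hmin : minpoly ℚ s = Polynomial.X ^ 2 - Polynomial.C (D : ℚ) :=
    (minpoly.eq_of_irreducible_of_monic hirr (by simp [hs])
      (Polynomial.monic_X_pow_sub_C _ two_ne_zero)).symm
  have h_int : IsIntegral ℚ s := ⟨_, Polynomial.monic_X_pow_sub_C (D : ℚ) two_ne_zero, by
    rw [Polynomial.eval₂_sub, Polynomial.eval₂_X_pow, Polynomial.eval₂_C, hs]; simp⟩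
  have hK : finrank ℚ (IntermediateField.adjoin ℚ {s}) = 2 := by
    rw [IntermediateField.adjoin.finrank h_int, hmin, Polynomial.natDegree_X_pow_sub_C]
  refine ⟨IntermediateField.adjoin ℚ {s}, hK, ?_⟩
  generalize hKK : IntermediateField.adjoin ℚ {s} = K at hK
  have hsK : s ∈ K := hKK ▸ IntermediateField.mem_adjoin_simple_self ℚ s
  have : FiniteDimensional ℚ K := FiniteDimensional.of_finrank_pos (by omega)
  have : NumberField K := ⟨⟩
  rw [fieldDisc, dif_pos ‹_›]
  obtain ⟨q⟩ := exists_quadData hK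
  change discr K = D
  generalize discr K = D' at q
  obtain ⟨a, b, hab⟩ := q.repr ⟨s, hsK⟩
  have hs' : (a + b * q.ω) ^ 2 = (D : K) := by
    rw [← hab]; apply Subtype.ext; simpa using hs
  have h3 := q.coord_ext (a := a ^ 2 + b ^ 2 * D') (b := 2 * a * b) (c := D) (d := 0) (by
    push_cast; rw [← hs']; linear_combination -b ^ 2 * q.sq)
  have ha : a = 0 := by
    rcases mul_eq_zero.1 h3.2 with h | h
    · linarith
    · rw [h] at h3; exact absurd (by linarith [h3.1]) (hsq a)
  have h4 : (D : ℚ) = b ^ 2 * D' := by rw [← h3.1, ha]; ring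
  have hb : (b.den : ℤ) ^ 2 * D = b.num ^ 2 * D' := by
    have hb := Rat.num_div_den b
    have hden : (b.den : ℚ) ≠ 0 := by exact_mod_cast b.den_nz
    rw [← hb] at h4
    field_simp at h4
    rw [mul_comm]
    exact_mod_cast h4
  have hcop : IsCoprime ((b.den : ℤ) ^ 2) (b.num ^ 2) := by
    apply IsCoprime.pow
    rw [Int.isCoprime_iff_gcd_eq_one, Int.gcd_comm]
    exact b.reduced
  obtain ⟨F, hF⟩ : (b.den : ℤ) ^ 2 ∣ D' := hcop.dvd_of_dvd_mul_left ⟨D, hb.symm⟩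
  have hden : (b.den : ℤ) ^ 2 ≠ 0 := by
    have := b.den_nz
    positivity
  have hF' : D = b.num ^ 2 * F := by
    apply mul_left_cancel₀ hden
    rw [hb, hF]; ring
  have hmod : IsDiscMod F := by
    rcases Int.emod_two_eq_zero_or_one b.num with h5 | h5
    · rcases Int.emod_two_eq_zero_or_one b.den with h6 | h6
      · exfalso
        have h7 : IsCoprime (b.den : ℤ) b.num :=
          (IsCoprime.pow_iff two_pos two_pos).1 hcop
        · have := Int.isUnit_iff.1 (h7.isUnit_of_dvd' (x := 2) (by omega) (by omega))
          omega
      · exact IsDiscMod.of_sq_mul h6 (hF ▸ q.isDiscMod)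
    · exact IsDiscMod.of_sq_mul h5 (hF' ▸ h.1)
  have e1 := h.eq_one hmod hF'
  have e2 := q.fund.eq_one hmod hF
  rw [hF, hF', ← Int.natAbs_sq, ← Int.natAbs_sq b.num, e1, e2]

theorem isQuadraticDisc_iff {D : ℤ} : IsQuadraticDisc D ↔ Fund D ∧ D ≠ 1 :=
  ⟨fund_of_isQuadraticDisc, fun h => isQuadraticDisc_of_fund h.1 h.2⟩

/-- The number of orbits of discriminant `D` in terms of class groups. -/
lemma card_orbit_eq_h3 {D : ℤ} (h : IsQuadraticDisc D) :
    (0 < D → Nat.card {o : Orbit // o.disc = D} = 3 * h3 D) ∧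
      (D < -4 → Nat.card {o : Orbit // o.disc = D} = h3 D) := by
  have hK := h.choose_spec
  have e : h3 D = Nat.card {g : ClassGroup (𝓞 h.choose) // g ^ 3 = 1} := by
    rw [h3]; exact dif_pos h
  have : FiniteDimensional ℚ h.choose := FiniteDimensional.of_finrank_pos (by omega)
  have : NumberField h.choose := ⟨⟩
  have hd : discr h.choose = D := by
    refine Eq.trans ?_ hK.2
    rw [fieldDisc, dif_pos ‹_›]
  rw [e]
  generalize h.choose = K at *
  subst hd
  exact ⟨card_orbit_of_pos hK.1, card_orbit_of_neg hK.1⟩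

end CubicForm

namespace CubicForm

open Matrix

/-- The Hessian of `v` vanishes modulo `p`. -/
def Bad1 (p : ℤ) (v : Fin 4 → ℤ) : Prop := p ∣ hessP v ∧ p ∣ hessQ v ∧ p ∣ hessR v

/-- `v` is equivalent to a form whose first two coefficients are divisible by `p²` and `p`. -/
def Bad2 (p : ℤ) (v : Fin 4 → ℤ) : Prop := ∃ γ, p ^ 2 ∣ act γ v 0 ∧ p ∣ act γ v 1

lemma bad2_act {p : ℤ} {v : Fin 4 → ℤ} (γ) : Bad2 p (act γ v) ↔ Bad2 p v := by
  constructor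
  · rintro ⟨g, h⟩
    exact ⟨g * γ, by rwa [act_mul]⟩
  · rintro ⟨g, h⟩
    exact ⟨g * γ⁻¹, by rwa [act_mul, act_inv_act]⟩

lemma Bad1.act {p : ℤ} {v : Fin 4 → ℤ} (h : Bad1 p v) (γ) : Bad1 p (act γ v) := by
  obtain ⟨h1, h2, h3⟩ := h
  simp only [Bad1, CubicForm.act, hessP_subst, hessQ_subst, hessR_subst]
  refine ⟨?_, ?_, ?_⟩ <;> apply Dvd.dvd.mul_left
  · exact dvd_add (dvd_add (h1.mul_right _) ((h2.mul_right _).mul_right _)) (h3.mul_right _)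
  · exact dvd_add (dvd_add (((h1.mul_left _).mul_right _).mul_right _) (h2.mul_right _))
      (((h3.mul_left _).mul_right _).mul_right _)
  · exact dvd_add (dvd_add (h1.mul_right _) ((h2.mul_right _).mul_right _)) (h3.mul_right _)

lemma bad1_act {p : ℤ} {v : Fin 4 → ℤ} (γ) : Bad1 p (act γ v) ↔ Bad1 p v :=
  ⟨fun h => act_inv_act γ v ▸ h.act γ⁻¹, fun h => h.act γ⟩

lemma Bad1.exists_disc {p : ℤ} {v : Fin 4 → ℤ} (h : Bad1 p v) :
    ∃ E, disc v = p ^ 2 * E ∧ IsDiscMod E := by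
  obtain ⟨⟨P, hP⟩, ⟨Q, hQ⟩, ⟨R, hR⟩⟩ := h
  refine ⟨Q ^ 2 - 4 * P * R, by rw [disc, hP, hQ, hR]; ring, ?_⟩
  have h1 := sq_mod_four Q
  have := Int.emod_two_eq_zero_or_one Q
  unfold IsDiscMod
  rw [mul_assoc]
  omega

lemma disc_rescale (p a b c d : ℤ) :
    disc ![p ^ 2 * a, p * b, c, d] = p ^ 2 * disc ![a, b, c, p * d] := by
  simp [disc, hessP, hessQ, hessR]; ring

lemma Bad2.exists_disc {p : ℤ} {v : Fin 4 → ℤ} (h : Bad2 p v) :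
    ∃ E, disc v = p ^ 2 * E ∧ IsDiscMod E := by
  obtain ⟨γ, ⟨a, ha⟩, b, hb⟩ := h
  refine ⟨_, ?_, isDiscMod_disc ![a, b, act γ v 2, p * act γ v 3]⟩
  rw [← disc_rescale, ← disc_act γ, ← ha, ← hb]
  congr 1

lemma exists_root_hess {p : ℕ} (hp : p.Prime) {v : Fin 4 → ℤ} {E : ℤ}
    (h : disc v = p ^ 2 * E) : ∃ γ, (p : ℤ) ∣ hessP (act γ v) := by
  by_cases h0 : (p : ℤ) ∣ hessP v
  · exact ⟨1, by rwa [act_one]⟩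
  suffices ∃ t, (p : ℤ) ∣ hessP v * t ^ 2 + hessQ v * t + hessR v by
    obtain ⟨t, ht⟩ := this
    refine ⟨⟨!![0, 1; -1, t], by simp [det_fin_two]⟩, ?_⟩
    change (p : ℤ) ∣ hessP (subst _ _ _ _ v)
    rw [hessP_subst]
    simpa using ht
  have hpi := Nat.prime_iff_prime_int.1 hp
  rw [disc] at h
  rcases hp.eq_two_or_odd with rfl | hodd
  · refine ⟨hessR v, ?_⟩
    have h1 := sq_mod_four (hessQ v)
    push_cast at *
    have hQ : hessQ v % 2 = 0 := by
      rw [mul_assoc] at h; omega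
    obtain ⟨k, hk⟩ := Int.dvd_of_emod_eq_zero hQ
    rcases Int.even_or_odd' (hessR v) with ⟨r, hr | hr⟩ <;>
    rcases Int.even_or_odd' (hessP v) with ⟨s, hs | hs⟩
    · exact ⟨hessP v * r * hessR v + hessQ v * r + r, by rw [hr]; ring⟩
    · exact ⟨hessP v * r * hessR v + hessQ v * r + r, by rw [hr]; ring⟩
    · exact absurd ⟨s, hs⟩ h0
    · rw [hr, hs, hk]
      exact ⟨(2 * s + 1) * (2 * r ^ 2 + 2 * r) + s + 1 + k * (2 * r + 1) + r, by ring⟩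
  · have hcop : IsCoprime (2 * hessP v) (p : ℤ) := by
      rw [isCoprime_comm, hpi.coprime_iff_not_dvd]
      intro h'
      rcases hpi.dvd_or_dvd h' with h' | h'
      · have h2 := (Nat.prime_dvd_prime_iff_eq hp Nat.prime_two).1 (by exact_mod_cast h')
        omega
      · exact h0 h'
    obtain ⟨u, w, huw⟩ := hcop
    refine ⟨-hessQ v * u, ?_⟩
    have h4 : (p : ℤ) ∣ (2 * (2 * hessP v)) * (hessP v * (-hessQ v * u) ^ 2 +
        hessQ v * (-hessQ v * u) + hessR v) := by
      refine ⟨p * w ^ 2 * hessQ v ^ 2 - p * E, ?_⟩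
      linear_combination (-1) * h + hessQ v ^ 2 * (2 * hessP v * u - 1 - w * p) * huw
    have hc2 : IsCoprime (p : ℤ) (2 * (2 * hessP v)) := by
      apply IsCoprime.mul_right _ ⟨w, u, by linarith⟩
      exact ⟨w, u * hessP v, by linarith⟩
    exact hc2.dvd_of_dvd_mul_left h4

lemma bad_of_disc {p : ℕ} (hp : p.Prime) {v : Fin 4 → ℤ} {E : ℤ}
    (h : disc v = p ^ 2 * E) (hE : IsDiscMod E) : Bad1 p v ∨ Bad2 p v := by
  obtain ⟨γ, hγ⟩ := exists_root_hess hp h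
  rw [← bad1_act γ, ← bad2_act γ]
  rw [← disc_act γ] at h
  generalize act γ v = w at *
  have hpi := Nat.prime_iff_prime_int.1 hp
  have hQ : (p : ℤ) ∣ hessQ w := by
    apply hpi.dvd_of_dvd_pow (n := 2)
    have : hessQ w ^ 2 = p * (p * E) + hessP w * (4 * hessR w) := by
      rw [disc] at h; linear_combination h
    rw [this]
    exact dvd_add (dvd_mul_right _ _) (hγ.mul_right _)
  by_cases hR : (p : ℤ) ∣ hessR w
  · exact Or.inl ⟨hγ, hQ, hR⟩
  right
  have hP2 : (p : ℤ) ^ 2 ∣ hessP w := by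
    rw [disc] at h
    obtain ⟨Q, hQ⟩ := hQ
    rw [hQ] at h
    have hcop : IsCoprime ((p : ℤ) ^ 2) (hessR w) :=
      ((Nat.prime_iff_prime_int.1 hp).coprime_iff_not_dvd.2 hR).pow_left
    apply hcop.dvd_of_dvd_mul_right
    rcases hp.eq_two_or_odd with rfl | hodd
    · push_cast at *
      obtain ⟨P, hP⟩ := hγ
      have h1 : P * hessR w * 2 = Q ^ 2 - E := by rw [hP] at h; linarith
      have h2 := sq_mod_four Q
      unfold IsDiscMod at hE
      rw [hP]
      have h3 := Int.emod_two_eq_zero_or_one Q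
      exact ⟨P * hessR w / 2, by
        have : 2 * P * hessR w = 2 * (P * hessR w) := by ring
        rw [this]; omega⟩
    · have h4 : (p : ℤ) ^ 2 ∣ 4 * (hessP w * hessR w) := ⟨Q ^ 2 - E, by linarith⟩
      have hc : IsCoprime ((p : ℤ) ^ 2) 4 := by
        have : IsCoprime (p : ℤ) 2 := by
          rw [hpi.coprime_iff_not_dvd]
          intro h'
          have h2 := (Nat.prime_dvd_prime_iff_eq hp Nat.prime_two).1 (by exact_mod_cast h')
          omega
        exact this.pow (m := 2) (n := 2)
      exact hc.dvd_of_dvd_mul_left h4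
  have hcop : IsCoprime (p : ℤ) (hessR w) := (Nat.prime_iff_prime_int.1 hp).coprime_iff_not_dvd.2 hR
  have h1 : (p : ℤ) ∣ w 1 := by
    apply hcop.dvd_of_dvd_mul_right
    have : w 1 * hessR w = hessQ w * w 2 - hessP w * w 3 := by
      simp only [hessP, hessQ, hessR]; ring
    rw [this]
    exact dvd_sub (hQ.mul_right _) (hγ.mul_right _)
  refine ⟨1, ?_, ?_⟩ <;> rw [act_one]
  · apply (hcop.pow_left (m := 2)).dvd_of_dvd_mul_right
    have : w 0 * hessR w = w 1 * hessQ w - hessP w * w 2 := by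
      simp only [hessP, hessQ, hessR]; ring
    rw [this, sq]
    exact dvd_sub (mul_dvd_mul h1 hQ) ((sq (p : ℤ) ▸ hP2).mul_right _)
  · exact h1

theorem fund_disc_iff {v : Fin 4 → ℤ} :
    Fund (disc v) ↔ ∀ p : ℕ, p.Prime → ¬ Bad1 p v ∧ ¬ Bad2 p v := by
  constructor
  · refine fun h p hp => ⟨fun h' => ?_, fun h' => ?_⟩ <;> obtain ⟨E, hE, hm⟩ := h'.exists_disc
    · exact h.2 p hp E hE hm
    · exact h.2 p hp E hE hm
  · refine fun h => ⟨isDiscMod_disc v, fun p hp E hE hm => ?_⟩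
    rcases bad_of_disc hp hE hm with h' | h'
    · exact (h p hp).1 h'
    · exact (h p hp).2 h'

end CubicForm

namespace CubicForm

open MeasureTheory Filter Topology

section riemann

variable {ι : Type*}

lemma cells_eq (F : Finset (ι → ℤ)) {t : ℝ} (ht : 0 < t) :
    {x : ι → ℝ | (fun i => ⌊t * x i⌋) ∈ F} =
      ⋃ u ∈ F, Set.univ.pi fun i => Set.Ico ((u i : ℝ) / t) (((u i : ℝ) + 1) / t) := by
  ext x
  simp only [Set.mem_ofPred_eq, Set.mem_iUnion, Set.mem_pi, Set.mem_univ, true_implies,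
    Set.mem_Ico, div_le_iff₀' ht, lt_div_iff₀' ht, ← Int.floor_eq_iff, exists_prop]
  constructor
  · exact fun h => ⟨_, h, fun i => rfl⟩
  · rintro ⟨u, hu, h⟩
    rwa [funext h]

variable [Fintype ι]

lemma measurableSet_cells (F : Finset (ι → ℤ)) {t : ℝ} (ht : 0 < t) :
    MeasurableSet {x : ι → ℝ | (fun i => ⌊t * x i⌋) ∈ F} := by
  rw [cells_eq F ht]
  exact F.measurableSet_biUnion fun u _ => MeasurableSet.univ_pi fun i => measurableSet_Ico

lemma volume_cells (F : Finset (ι → ℤ)) {t : ℝ} (ht : 0 < t) :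
    volume.real {x : ι → ℝ | (fun i => ⌊t * x i⌋) ∈ F} = F.card * (1 / t) ^ Fintype.card ι := by
  rw [cells_eq F ht, Measure.real, measure_biUnion_finset]
  · have : ∀ u : ι → ℤ, volume (Set.univ.pi fun i =>
        Set.Ico ((u i : ℝ) / t) (((u i : ℝ) + 1) / t)) =
        ENNReal.ofReal ((1 / t) ^ Fintype.card ι) := fun u => by
      rw [Real.volume_pi_Ico, ENNReal.ofReal_pow (by positivity), Finset.prod_congr rfl
        (g := fun _ => ENNReal.ofReal (1 / t))]
      · simp
      · intro i _
        congr 1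
        ring
    simp only [this, Finset.sum_const, nsmul_eq_mul]
    rw [ENNReal.toReal_mul, ENNReal.toReal_natCast, ENNReal.toReal_ofReal (by positivity)]
  · intro u _ w _ huw
    refine Set.disjoint_left.2 fun x hx hy => huw (funext fun i => ?_)
    have h1 := hx i trivial
    have h2 := hy i trivial
    simp only [Set.mem_Ico, div_le_iff₀' ht, lt_div_iff₀' ht, ← Int.floor_eq_iff] at h1 h2
    exact h1.symm.trans h2
  · exact fun u _ => MeasurableSet.univ_pi fun i => measurableSet_Ico

lemma finite_coset {R : Set (ι → ℝ)} (hb : Bornology.IsBounded R) {m : ℕ} (hm : 0 < m)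
    (v₀ : ι → ℤ) {l : ℝ} (hl : 0 < l) :
    {u : ι → ℤ | (fun i => ((v₀ i + m * u i : ℤ) : ℝ) / l) ∈ R}.Finite := by
  obtain ⟨C, hC⟩ := hb.subset_closedBall 0
  have hm' : (0 : ℝ) < m := by exact_mod_cast hm
  refine (Set.Finite.pi' fun i => Set.finite_Icc (⌊(-(C * l) - v₀ i) / m⌋) ⌈(C * l - v₀ i) / m⌉).subset
    fun u hu i => ?_
  have h1 := mem_closedBall_zero_iff.1 (hC hu)
  have h2 := (norm_le_pi_norm _ i).trans h1
  rw [Real.norm_eq_abs, abs_le, le_div_iff₀ hl, div_le_iff₀ hl] at h2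
  push_cast at h2
  constructor
  · have : (-(C * l) - v₀ i) / m ≤ u i := by rw [div_le_iff₀ hm']; linarith
    exact_mod_cast (Int.floor_le _).trans this
  · have : (u i : ℝ) ≤ (C * l - v₀ i) / m := by rw [le_div_iff₀ hm']; linarith
    exact_mod_cast this.trans (Int.le_ceil _)

/-- The number of points of a coset of `mℤ^ι` in a dilated region. -/
theorem tendsto_count_coset {R : Set (ι → ℝ)} (hb : Bornology.IsBounded R) (hR : MeasurableSet R)
    (hf : volume (frontier R) = 0) {m : ℕ} (hm : 0 < m) (v₀ : ι → ℤ) :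
    Tendsto (fun l : ℝ => (Set.ncard {u : ι → ℤ | (fun i => ((v₀ i + m * u i : ℤ) : ℝ) / l) ∈ R} : ℝ)
      / l ^ Fintype.card ι) atTop (𝓝 (volume.real R / m ^ Fintype.card ι)) := by
  have hm' : (0 : ℝ) < m := by exact_mod_cast hm
  set pt : ℝ → (ι → ℝ) → (ι → ℝ) := fun l x i => ((v₀ i + m * ⌊(l / m) * x i⌋ : ℤ) : ℝ) / l with hpt
  set A : ℝ → Set (ι → ℝ) := fun l => if 0 < l then {x | pt l x ∈ R} else ∅ with hA
  have hfin := fun l hl => finite_coset hb hm v₀ (l := l) hl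
  have hAF : ∀ l (hl : 0 < l), A l = {x | (fun i => ⌊(l / m) * x i⌋) ∈ (hfin l hl).toFinset} := by
    intro l hl
    simp only [hA, hl, if_true, Set.Finite.mem_toFinset]
    rfl
  have hvol : ∀ l (hl : 0 < l), volume.real (A l) / m ^ Fintype.card ι =
      (Set.ncard {u : ι → ℤ | (fun i => ((v₀ i + m * u i : ℤ) : ℝ) / l) ∈ R} : ℝ)
      / l ^ Fintype.card ι := by
    intro l hl
    rw [hAF l hl, volume_cells _ (by positivity), ← Set.ncard_eq_toFinset_card _ (hfin l hl),
      one_div_div, div_pow]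
    field_simp
  have hmeas : ∀ l, MeasurableSet (A l) := by
    intro l
    by_cases hl : 0 < l
    · rw [hAF l hl]; exact measurableSet_cells _ (by positivity)
    · simp [hA, hl]
  -- distance estimate
  have hdist : ∀ l, 0 < l → ∀ x, dist (pt l x) x ≤ (‖(fun i => (v₀ i : ℝ))‖ + m) / l := by
    intro l hl x
    rw [dist_pi_le_iff (by positivity)]
    intro i
    have h0 := norm_le_pi_norm (fun i => (v₀ i : ℝ)) i
    have h1 := Int.floor_le (l / m * x i)
    have h2 := Int.lt_floor_add_one (l / m * x i)
    rw [Real.norm_eq_abs, abs_le] at h0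
    have h3 : l * x i = m * (l / m * x i) := by field_simp
    have h4 : pt l x i - x i = (v₀ i + m * ⌊(l / m) * x i⌋ - l * x i) / l := by
      simp only [hpt]; push_cast; field_simp
    rw [Real.dist_eq, h4, abs_div, abs_of_pos hl, div_le_div_iff_of_pos_right hl, abs_le, h3]
    constructor <;> nlinarith
  obtain ⟨C, hC⟩ := hb.subset_closedBall 0
  have hlim : Tendsto (fun l : ℝ => (‖(fun i => (v₀ i : ℝ))‖ + m) / l) atTop (𝓝 0) :=
    tendsto_const_nhds.div_atTop tendsto_id
  have hmain : Tendsto (fun l => volume (A l)) atTop (𝓝 (volume R)) := by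
    refine tendsto_measure_of_ae_tendsto_indicator atTop hR hmeas
      (B := Metric.closedBall 0 (C + 1)) measurableSet_closedBall
      (isCompact_closedBall _ _).measure_lt_top.ne ?_ ?_
    · filter_upwards [hlim.eventually_lt_const zero_lt_one, eventually_gt_atTop 0] with l h1 hl x hx
      simp only [hA, hl, if_true] at hx
      have := mem_closedBall_zero_iff.1 (hC hx)
      have h2 := hdist l hl x
      rw [mem_closedBall_zero_iff]
      rw [dist_eq_norm] at h2
      have h3 := norm_sub_norm_le x (pt l x)
      rw [norm_sub_rev] at h3
      linarith
    · have : ∀ᵐ x, x ∉ frontier R := measure_eq_zero_iff_ae_notMem.1 hf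
      filter_upwards [this] with x hx
      have hpx : Tendsto (fun l => pt l x) atTop (𝓝 x) := by
        rw [tendsto_iff_dist_tendsto_zero]
        refine squeeze_zero' (.of_forall fun _ => dist_nonneg) ?_ hlim
        filter_upwards [eventually_gt_atTop 0] with l hl using hdist l hl x
      by_cases hxi : x ∈ interior R
      · filter_upwards [eventually_gt_atTop 0, hpx.eventually_mem (isOpen_interior.mem_nhds hxi)]
          with l hl h
        simp only [hA, hl, if_true]
        exact iff_of_true (show pt l x ∈ R from interior_subset h) (interior_subset hxi)
      · have hxc : x ∈ (closure R)ᶜ := fun h => hx ⟨h, hxi⟩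
        filter_upwards [eventually_gt_atTop 0,
          hpx.eventually_mem (isClosed_closure.isOpen_compl.mem_nhds hxc)] with l hl h
        simp only [hA, hl, if_true]
        exact iff_of_false (fun h' => h (subset_closure h')) (fun h' => hxc (subset_closure h'))
  have hfinR : volume R ≠ ⊤ := hb.measure_lt_top.ne
  have := ((ENNReal.tendsto_toReal hfinR).comp hmain).div_const ((m : ℝ) ^ Fintype.card ι)
  refine this.congr' ?_
  filter_upwards [eventually_gt_atTop 0] with l hl using hvol l hl

/-- The number of points of a periodic set in a dilated region. -/
theorem tendsto_count_periodic {R : Set (ι → ℝ)} (hb : Bornology.IsBounded R)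
    (hR : MeasurableSet R) (hf : volume (frontier R) = 0) {m : ℕ} [NeZero m]
    (S : Set (ι → ZMod m)) :
    Tendsto (fun l : ℝ => (Set.ncard {v : ι → ℤ | (fun i => (v i : ZMod m)) ∈ S ∧
        (fun i => (v i : ℝ) / l) ∈ R} : ℝ) / l ^ Fintype.card ι) atTop
      (𝓝 (S.ncard / m ^ Fintype.card ι * volume.real R)) := by
  classical
  have hm : 0 < m := NeZero.pos m
  have hfin : S.Finite := Set.toFinite S
  have h1 := tendsto_finsetSum hfin.toFinset fun (s : ι → ZMod m) _ =>
    tendsto_count_coset hb hR hf hm (fun i => (s i).val)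
  rw [Finset.sum_const, nsmul_eq_mul, ← Set.ncard_eq_toFinset_card] at h1
  rw [div_mul_eq_mul_div, mul_div_assoc]
  refine h1.congr' ?_
  filter_upwards [eventually_gt_atTop 0] with l hl
  rw [← Finset.sum_div, ← Nat.cast_sum]
  congr 2
  set T := fun s : ι → ZMod m =>
    {u : ι → ℤ | (fun i => ((((s i).val : ℤ) + m * u i : ℤ) : ℝ) / l) ∈ R}
  have hT : ∀ s, (T s).Finite := fun s => finite_coset hb hm _ hl
  let φ : (ι → ZMod m) → (ι → ℤ) → (ι → ℤ) := fun s u i => ((s i).val : ℤ) + m * u i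
  have hφi : ∀ s, Function.Injective (φ s) := by
    intro s u w h
    funext i
    have := congrFun h i
    simp only [φ] at this
    have : (m : ℤ) * u i = m * w i := by linarith
    exact mul_left_cancel₀ (by exact_mod_cast hm.ne') this
  have hφm : ∀ s u, (fun i => ((φ s u i : ℤ) : ZMod m)) = s := by
    intro s u
    funext i
    simp [φ]
  have hU : {v : ι → ℤ | (fun i => (v i : ZMod m)) ∈ S ∧ (fun i => (v i : ℝ) / l) ∈ R} =
      ((hfin.toFinset.biUnion fun s => (hT s).toFinset.image (φ s) : Finset (ι → ℤ)) : Set (ι → ℤ)) := by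
    ext v
    simp only [Set.mem_ofPred_eq, Finset.coe_biUnion, Set.Finite.coe_toFinset,
      Finset.coe_image, Set.mem_iUnion, Set.mem_image, exists_prop]
    constructor
    · rintro ⟨h, h'⟩
      have hv : φ (fun i => (v i : ZMod m)) (fun i => v i / m) = v := by
        funext i
        simp only [φ, ZMod.val_intCast]
        exact Int.emod_add_mul_ediv _ _
      refine ⟨_, h, fun i => v i / m, ?_, hv⟩
      show (fun i => ((φ (fun i => (v i : ZMod m)) (fun i => v i / m) i : ℤ) : ℝ) / l) ∈ R
      rwa [hv]
    · rintro ⟨s, hs, u, hu, rfl⟩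
      rw [hφm]
      exact ⟨hs, hu⟩
  rw [hU, Set.ncard_coe_finset, Finset.card_biUnion]
  · refine Finset.sum_congr rfl fun s _ => ?_
    rw [Finset.card_image_of_injective _ (hφi s), ← Set.ncard_eq_toFinset_card _ (hT s)]
  · intro s _ s' _ hss
    refine Finset.disjoint_left.2 fun v hv hv' => hss ?_
    obtain ⟨u, _, rfl⟩ := Finset.mem_image.1 hv
    obtain ⟨u', _, h⟩ := Finset.mem_image.1 hv'
    rw [← hφm s u, ← h, hφm]

end riemann

end CubicForm

namespace CubicForm

open Matrix UpperHalfPlane ComplexConjugate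

/-- The form with point `w 0 + i w 1` of the upper half plane and parameters `w 2`, `w 3`. For
`e = -1` the point is the root of the Hessian, for `e = 1/3` it is the root of the form. -/
def Phi (e : ℝ) (w : Fin 4 → ℝ) : Fin 4 → ℝ :=
  ![w 2,
    e * w 3 * w 1 - w 0 * w 2,
    e * w 2 * w 1 ^ 2 - 2 * w 0 * (e * w 3 * w 1) + w 0 ^ 2 * w 2,
    w 3 * w 1 ^ 3 - 3 * w 0 * (e * w 2 * w 1 ^ 2) + 3 * w 0 ^ 2 * (e * w 3 * w 1)
      - w 0 ^ 3 * w 2]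

/-- The point `z` belongs to the real form `v`. -/
def Rel (e : ℝ) (v : Fin 4 → ℝ) (z : ℍ) : Prop := ∃ r s, v = Phi e ![z.re, z.im, r, s]

/-- The real form underlying an integral one. -/
def toReal (v : Fin 4 → ℤ) : Fin 4 → ℝ := fun i => (v i : ℝ)

variable {e : ℝ}

lemma disc_Phi (he : e = -1 ∨ e = 1 / 3) (w : Fin 4 → ℝ) :
    disc (Phi e w) = 4 * e ^ 3 * (w 1 ^ 6 * (w 2 ^ 2 + w 3 ^ 2) ^ 2) := by
  rcases he with rfl | rfl <;> simp [disc, hessP, hessQ, hessR, Phi] <;> ring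

lemma disc_toReal (v : Fin 4 → ℤ) : disc (toReal v) = disc v :=
  disc_map (Int.castRingHom ℝ) v

lemma rel_iff (he : e ≠ 0) {v : Fin 4 → ℝ} {z : ℍ} :
    Rel e v z ↔ v 2 + 2 * v 1 * z.re + v 0 * z.re ^ 2 = e * v 0 * z.im ^ 2 ∧
      e * (v 3 + 3 * v 2 * z.re + 3 * v 1 * z.re ^ 2 + v 0 * z.re ^ 3) =
        z.im ^ 2 * (v 1 + v 0 * z.re) := by
  have hz := z.im_pos.ne'
  constructor
  · rintro ⟨r, s, rfl⟩
    simp only [Phi, cons_val]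
    constructor <;> ring
  · rintro ⟨h1, h2⟩
    have h3 : e * ((v 1 + v 0 * z.re) / (e * z.im)) * z.im = v 1 + v 0 * z.re := by field_simp
    have h4 : (v 1 + v 0 * z.re) / (e * z.im) * z.im ^ 3 =
        v 3 + 3 * v 2 * z.re + 3 * v 1 * z.re ^ 2 + v 0 * z.re ^ 3 := by
      field_simp
      linear_combination -h2
    refine ⟨v 0, (v 1 + v 0 * z.re) / (e * z.im), ?_⟩
    ext i
    fin_cases i
    · simp [Phi]
    · simp [Phi, h3]; ring
    · simp [Phi, h3]; linear_combination h1
    · simp [Phi, h3, h4]; linear_combination (-3 * z.re) * h1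

/-- The symmetric trilinear form attached to a binary cubic form. -/
def tri (v : Fin 4 → ℂ) (X₁ Y₁ X₂ Y₂ X₃ Y₃ : ℂ) : ℂ :=
  v 0 * (X₁ * X₂ * X₃) + v 1 * (X₁ * X₂ * Y₃ + X₁ * Y₂ * X₃ + Y₁ * X₂ * X₃)
    + v 2 * (X₁ * Y₂ * Y₃ + Y₁ * X₂ * Y₃ + Y₁ * Y₂ * X₃) + v 3 * (Y₁ * Y₂ * Y₃)

lemma tri_subst (p q r s : ℂ) (v : Fin 4 → ℂ) (X₁ Y₁ X₂ Y₂ X₃ Y₃ : ℂ) :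
    tri (subst p q r s v) X₁ Y₁ X₂ Y₂ X₃ Y₃ =
      tri v (p * X₁ + q * Y₁) (r * X₁ + s * Y₁) (p * X₂ + q * Y₂) (r * X₂ + s * Y₂)
        (p * X₃ + q * Y₃) (r * X₃ + s * Y₃) := by
  simp [tri, subst]; ring

lemma tri_div (v : Fin 4 → ℂ) (z w k l : ℂ) :
    tri v (z / k) (1 / k) (z / k) (1 / k) (w / l) (1 / l) = tri v z 1 z 1 w 1 / (k ^ 2 * l) := by
  simp [tri]; ring

/-- The conjugation used in the equation of the point of a form. -/
def conjOf (neg : Prop) [Decidable neg] : ℂ →+* ℂ := if neg then starRingEnd ℂ else RingHom.id ℂ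

open scoped Classical in
lemma rel_iff_tri (he : e = -1 ∨ e = 1 / 3) {v : Fin 4 → ℝ} {z : ℍ} :
    Rel e v z ↔ tri (fun i => v i) z 1 z 1 (conjOf (e = -1) z) 1 = 0 := by
  have hz := z.im_pos.ne'
  have hre : (z : ℂ).re = z.re := rfl
  have him : (z : ℂ).im = z.im := rfl
  rw [rel_iff (by rcases he with rfl | rfl <;> norm_num), Complex.ext_iff]
  rcases he with rfl | rfl
  · simp only [conjOf, if_true, tri]
    simp [pow_succ]
    constructor
    · rintro ⟨h1, h2⟩
      constructor
      · linear_combination -h2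
      · linear_combination z.im * h1
    · rintro ⟨h1, h2⟩
      have h3 : v 2 + 2 * v 1 * z.re + v 0 * z.re ^ 2 + v 0 * z.im ^ 2 = 0 := by
        apply mul_left_cancel₀ hz
        linear_combination h2
      constructor
      · linear_combination h3
      · linear_combination -h1
  · have : ¬ (1 / 3 : ℝ) = -1 := by norm_num
    simp only [conjOf, this, if_false, tri]
    simp [pow_succ]
    constructor
    · rintro ⟨h1, h2⟩
      constructor
      · linear_combination 3 * h2
      · linear_combination 3 * z.im * h1
    · rintro ⟨h1, h2⟩
      have h3 : 3 * (v 2 + 2 * v 1 * z.re + v 0 * z.re ^ 2) - v 0 * z.im ^ 2 = 0 := by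
        apply mul_left_cancel₀ hz
        linear_combination h2
      constructor
      · linear_combination h3 / 3
      · linear_combination h1 / 3

lemma Rel.act (he : e = -1 ∨ e = 1 / 3) {v : Fin 4 → ℤ} {z : ℍ} (h : Rel e (toReal v) z)
    (γ : SpecialLinearGroup (Fin 2) ℤ) : Rel e (toReal (act γ v)) (γ • z) := by
  classical
  rw [rel_iff_tri he] at h ⊢
  set σ := conjOf (e = -1)
  have hσ : ∀ n : ℤ, σ (n : ℂ) = n := fun n => map_intCast σ n
  have hσi : Function.Injective σ := σ.injective
  have hden : (γ 1 0 : ℂ) * z + γ 1 1 ≠ 0 := by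
    have := UpperHalfPlane.denom_ne_zero (γ : GL (Fin 2) ℝ) z
    simpa [UpperHalfPlane.denom] using this
  have hden' : (γ 1 0 : ℂ) * σ z + γ 1 1 ≠ 0 := by
    rw [← hσ, ← hσ (γ 1 1), ← map_mul, ← map_add]
    exact (map_ne_zero σ).2 hden
  have hz : ((γ • z : ℍ) : ℂ) = ((γ 0 0 : ℂ) * z + γ 0 1) / ((γ 1 0 : ℂ) * z + γ 1 1) := by
    rw [UpperHalfPlane.coe_specialLinearGroup_apply]
    simp
  have hd : (γ 0 0 : ℂ) * γ 1 1 - γ 0 1 * γ 1 0 = 1 := by exact_mod_cast det_eq γ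
  have h1 : (fun i => ((toReal (CubicForm.act γ v) i : ℝ) : ℂ)) =
      subst (γ 1 1 : ℂ) (-γ 0 1) (-γ 1 0) (γ 0 0) fun i => ((toReal v i : ℝ) : ℂ) := by
    have := subst_map (Int.castRingHom ℂ) (γ 1 1) (-γ 0 1) (-γ 1 0) (γ 0 0) v
    simp only [eq_intCast, Int.cast_neg] at this
    simpa [toReal, CubicForm.act] using this
  rw [h1, hz, map_div₀, map_add, map_add, map_mul, map_mul, hσ, hσ, hσ, hσ, tri_subst]
  have e1 : ∀ t : ℂ, (γ 1 0 : ℂ) * t + γ 1 1 ≠ 0 →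
      (γ 1 1 : ℂ) * (((γ 0 0 : ℂ) * t + γ 0 1) / ((γ 1 0 : ℂ) * t + γ 1 1)) + -γ 0 1 * 1 =
        t / ((γ 1 0 : ℂ) * t + γ 1 1) := fun t ht => by
    rw [eq_div_iff ht]
    linear_combination (γ 1 1 : ℂ) * div_mul_cancel₀ ((γ 0 0 : ℂ) * t + γ 0 1) ht + t * hd
  have e2 : ∀ t : ℂ, (γ 1 0 : ℂ) * t + γ 1 1 ≠ 0 →
      (-γ 1 0 : ℂ) * (((γ 0 0 : ℂ) * t + γ 0 1) / ((γ 1 0 : ℂ) * t + γ 1 1)) + γ 0 0 * 1 =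
        1 / ((γ 1 0 : ℂ) * t + γ 1 1) := fun t ht => by
    rw [eq_div_iff ht]
    linear_combination (-γ 1 0 : ℂ) * div_mul_cancel₀ ((γ 0 0 : ℂ) * t + γ 0 1) ht + hd
  rw [e1 _ hden, e2 _ hden, e1 _ hden', e2 _ hden']
  rw [tri_div, h, zero_div]

lemma Rel.unique (he : e = -1 ∨ e = 1 / 3) {v : Fin 4 → ℝ} {z z' : ℍ} (hv : disc v ≠ 0)
    (h : Rel e v z) (h' : Rel e v z') : z = z' := by
  obtain ⟨r, s, rfl⟩ := h
  have hz := z.im_pos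
  have hz' := z'.im_pos
  have hrs : r ^ 2 + s ^ 2 ≠ 0 := by
    intro h0
    rw [disc_Phi he] at hv
    simp [h0] at hv
  have key : (z'.re - z.re) * z'.im = 0 ∧ (z'.re - z.re) ^ 2 - z'.im ^ 2 + z.im ^ 2 = 0 := by
    rcases he with rfl | rfl
    · rw [rel_iff (by norm_num)] at h'
      obtain ⟨h1, h2⟩ := h'
      simp [Phi] at h1 h2
      set t := z'.re - z.re with ht
      set N := t ^ 2 + z'.im ^ 2 - z.im ^ 2 with hN
      have e1 : r * N = 2 * s * z.im * t := by rw [hN, ht]; linear_combination h1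
      have e2 : z.im * (s * N + 2 * r * t * z.im) = 0 := by
        rw [hN, ht]; linear_combination (z'.re - z.re) * h1 + h2
      have e3 : s * N + 2 * r * t * z.im = 0 := (mul_eq_zero.1 e2).resolve_left hz.ne'
      have e4 : N = 0 := by
        apply (mul_eq_zero.1 (_ : (r ^ 2 + s ^ 2) * N = 0)).resolve_left hrs
        linear_combination r * e1 + s * e3
      have e5 : t = 0 := by
        apply (mul_eq_zero.1 (_ : (r ^ 2 + s ^ 2) * z.im * t = 0)).resolve_left
          (mul_ne_zero hrs hz.ne')
        rw [e4] at e1 e3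
        linear_combination (r / 2) * e3 - (s / 2) * e1
      rw [hN, e5] at e4
      rw [e5]
      constructor <;> linarith
    · classical
      rw [rel_iff_tri (Or.inr rfl)] at h'
      have : ¬ (1 / 3 : ℝ) = -1 := by norm_num
      simp only [conjOf, this, if_false, tri] at h'
      have h2 : ((r : ℂ) * (z' - z.re) + s * z.im) * ((z' - z.re) ^ 2 + (z.im : ℂ) ^ 2) = 0 := by
        rw [← h']
        simp [Phi]
        ring
      rcases mul_eq_zero.1 h2 with h3 | h3
      · rw [Complex.ext_iff] at h3
        simp [hz'.ne'] at h3
        obtain ⟨h3, rfl⟩ := h3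
        simp [hz.ne'] at h3
        exact absurd (by rw [h3]; ring) hrs
      · rw [Complex.ext_iff] at h3
        simp [pow_two] at h3
        constructor <;> nlinarith [h3.1, h3.2]
  obtain ⟨h1, h2⟩ := key
  have hre : z'.re = z.re := by
    rcases mul_eq_zero.1 h1 with h | h
    · linarith
    · exact absurd h hz'.ne'
  have him : z.im = z'.im := by
    rw [hre] at h2
    have : z.im ^ 2 = z'.im ^ 2 := by linarith
    exact (pow_left_inj₀ hz.le hz'.le two_ne_zero).1 this
  exact UpperHalfPlane.ext (Complex.ext hre.symm him)

lemma rel_of_sq (he : e ≠ 0) {v : Fin 4 → ℝ} {x Y : ℝ} (hY : 0 < Y)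
    (h1 : v 2 + 2 * v 1 * x + v 0 * x ^ 2 = e * v 0 * Y)
    (h2 : e * (v 3 + 3 * v 2 * x + 3 * v 1 * x ^ 2 + v 0 * x ^ 3) = Y * (v 1 + v 0 * x)) :
    ∃ z : ℍ, z.re = x ∧ z.im ^ 2 = Y ∧ Rel e v z := by
  have h3 : √Y ^ 2 = Y := Real.sq_sqrt hY.le
  refine ⟨⟨⟨x, √Y⟩, Real.sqrt_pos.2 hY⟩, rfl, h3, (rel_iff he).2 ?_⟩
  change _ = e * v 0 * √Y ^ 2 ∧ _ = √Y ^ 2 * _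
  rw [h3]
  exact ⟨h1, h2⟩

lemma exists_rel_neg {v : Fin 4 → ℝ} (hv : disc v < 0) : ∃ z, Rel (-1) v z := by
  have hP : hessP v ≠ 0 := by
    intro h
    rw [disc, h] at hv
    nlinarith [sq_nonneg (hessQ v)]
  have hY : 0 < -disc v / (4 * hessP v ^ 2) := div_pos (by linarith) (by positivity)
  obtain ⟨z, -, -, h⟩ := rel_of_sq (e := -1) (by norm_num) (v := v)
    (x := -hessQ v / (2 * hessP v)) hY
    (by field_simp; simp only [disc, hessP, hessQ, hessR]; ring)
    (by field_simp; simp only [disc, hessP, hessQ, hessR]; ring)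
  exact ⟨z, h⟩

lemma exists_real_or_rel {v : Fin 4 → ℝ} (ha : v 0 ≠ 0) :
    (∃ t : ℝ, v 0 * t ^ 3 + 3 * v 1 * t ^ 2 + 3 * v 2 * t + v 3 = 0) ∨
      ∃ z, Rel (1 / 3) v z := by
  obtain ⟨w, hw⟩ := IsAlgClosed.exists_root
    (Cubic.toPoly ⟨(v 0 : ℂ), 3 * v 1, 3 * v 2, v 3⟩) (by
      rw [Cubic.degree_of_a_ne_zero' (by exact_mod_cast ha)]
      norm_num)
  rw [Polynomial.IsRoot, Cubic.toPoly] at hw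
  simp only [Polynomial.eval_add, Polynomial.eval_mul, Polynomial.eval_C, Polynomial.eval_pow,
    Polynomial.eval_X] at hw
  rw [Complex.ext_iff] at hw
  simp [pow_succ] at hw
  obtain ⟨h1, h2⟩ := hw
  by_cases h0 : w.im = 0
  · left
    refine ⟨w.re, ?_⟩
    rw [h0] at h1
    linear_combination h1
  · right
    have h3 : 3 * (v 2 + 2 * v 1 * w.re + v 0 * w.re ^ 2) - v 0 * w.im ^ 2 = 0 := by
      apply mul_left_cancel₀ h0
      linear_combination h2
    obtain ⟨z, -, -, h⟩ := rel_of_sq (e := 1 / 3) (by norm_num) (v := v) (x := w.re)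
      (Y := w.im ^ 2) (by positivity) (by linear_combination h3 / 3)
      (by linear_combination h1 / 3)
    exact ⟨z, h⟩

lemma exists_rel_pos {v : Fin 4 → ℝ} (hv : 0 < disc v) : ∃ z, Rel (1 / 3) v z := by
  by_cases ha : v 0 = 0
  · have hd : disc v = v 1 ^ 2 * (4 * v 1 * v 3 - 3 * v 2 ^ 2) := by
      simp only [disc, hessP, hessQ, hessR, ha]; ring
    have hb : v 1 ≠ 0 := by rintro h; simp [hd, h] at hv
    have hY : 0 < (4 * v 1 * v 3 - 3 * v 2 ^ 2) / (12 * v 1 ^ 2) :=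
      div_pos (pos_of_mul_pos_right (hd ▸ hv) (sq_nonneg _)) (by positivity)
    obtain ⟨z, -, -, h⟩ := rel_of_sq (e := 1 / 3) (by norm_num) (v := v) (x := -v 2 / (2 * v 1)) hY
      (by rw [ha]; field_simp; ring) (by rw [ha]; field_simp; ring)
    exact ⟨z, h⟩
  rcases exists_real_or_rel ha with ⟨t, ht⟩ | h
  · have hd : v 3 = -(v 0 * t ^ 3 + 3 * v 1 * t ^ 2 + 3 * v 2 * t) := by linarith
    set Δ := 4 * v 0 * (3 * v 2 + 3 * v 1 * t + v 0 * t ^ 2) - (3 * v 1 + v 0 * t) ^ 2 with hΔ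
    have hD : disc v * 27 = Δ * (v 2 + 2 * v 1 * t + v 0 * t ^ 2) ^ 2 * 9 := by
      simp only [disc, hessP, hessQ, hessR, hΔ, hd]; ring
    have hY : 0 < Δ / (4 * v 0 ^ 2) := by
      refine div_pos ?_ (by positivity)
      have : 0 < (v 2 + 2 * v 1 * t + v 0 * t ^ 2) ^ 2 * Δ := by linarith
      exact pos_of_mul_pos_right this (sq_nonneg _)
    obtain ⟨z, -, -, h⟩ := rel_of_sq (e := 1 / 3) (by norm_num) (v := v)
      (x := -(3 * v 1 + v 0 * t) / (2 * v 0)) hY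
      (by rw [hΔ]; field_simp; ring) (by rw [hΔ, hd]; field_simp; ring)
    exact ⟨z, h⟩
  · exact h

lemma exists_rel (he : e = -1 ∨ e = 1 / 3) {v : Fin 4 → ℝ} (hv : 0 < e * disc v) :
    ∃ z, Rel e v z := by
  rcases he with rfl | rfl
  · exact exists_rel_neg (by linarith)
  · exact exists_rel_pos (by linarith)

end CubicForm

namespace CubicForm

open Matrix UpperHalfPlane ModularGroup

variable {e : ℝ} {D : ℤ}

/-- The reducible form `3 X²Y + 3 c XY² + d Y³` of discriminant `D`. -/
def redForm (D : ℤ) : Fin 4 → ℤ := ![0, 1, D % 2, (D + 3 * (D % 2) ^ 2) / 4]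

lemma disc_redForm (h : IsDiscMod D) : disc (redForm D) = D := by
  have : 4 * ((D + 3 * (D % 2) ^ 2) / 4) = D + 3 * (D % 2) ^ 2 := by
    apply Int.mul_ediv_cancel'
    rcases h with h | h
    · have : D % 2 = 0 := by omega
      rw [this]; omega
    · have : D % 2 = 1 := by omega
      rw [this]; omega
  simp only [disc, hessP, hessQ, hessR, redForm, cons_val]
  linear_combination this

lemma exists_act_redForm (h : Fund D) {v : Fin 4 → ℤ} (hv : disc v = D) (h0 : v 0 = 0) :
    ∃ γ, act γ v = redForm D := by
  wlog hb : v 1 = 1 generalizing v with H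
  · have hD : D = v 1 ^ 2 * (4 * (v 1 * v 3) - 3 * v 2 ^ 2) := by
      rw [← hv]; simp only [disc, hessP, hessQ, hessR, h0]; ring
    have h1 := h.eq_one (F := 4 * (v 1 * v 3) - 3 * v 2 ^ 2) (by
      have := sq_mod_four (v 2)
      have := Int.emod_two_eq_zero_or_one (v 2)
      unfold IsDiscMod
      omega) hD
    have h2 : v 1 = -1 := by omega
    obtain ⟨γ, hγ⟩ := H (v := -v) (by simpa [disc, hessP, hessQ, hessR] using hv) (by simp [h0])
      (by simp [h2])
    exact ⟨-γ, by rw [act_neg, ← hγ, ← act_neg_one v, ← act_mul, ← act_neg_one (act γ v), ← act_mul]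
                  simp⟩
  have hD : D = 4 * v 3 - 3 * v 2 ^ 2 := by
    rw [← hv]; simp only [disc, hessP, hessQ, hessR, h0, hb]; ring
  refine ⟨⟨!![1, v 2 / 2; 0, 1], by simp [det_fin_two]⟩, ?_⟩
  have h2 : D % 2 = v 2 % 2 := by
    have := sq_mod_four (v 2)
    omega
  have h3 := Int.emod_add_mul_ediv (v 2) 2
  ext i
  fin_cases i
  · simp [act, subst, redForm, h0]
  · simp [act, subst, redForm, h0, hb]
  · simp [act, subst, redForm, h0, hb, h2]
    linarith
  · simp [act, subst, redForm, h0, hb, h2]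
    symm
    apply Int.ediv_eq_of_eq_mul_right (by norm_num)
    have h4 : v 2 % 2 = v 2 - 2 * (v 2 / 2) := by linarith
    rw [hD, h4]
    ring

/-- The integral forms of discriminant `D` whose point lies in the fundamental domain. -/
def reduced (e : ℝ) (F : Set ℍ) (D : ℤ) : Set (Fin 4 → ℤ) :=
  {v | disc v = D ∧ v 0 ≠ 0 ∧ ∃ z ∈ F, Rel e (toReal v) z}

lemma Rel.neg {v : Fin 4 → ℝ} {z : ℍ} (h : Rel e v z) : Rel e (-v) z := by
  obtain ⟨r, s, rfl⟩ := h
  refine ⟨-r, -s, ?_⟩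
  ext i
  fin_cases i <;> simp [Phi] <;> ring

lemma neg_mem_reduced {F : Set ℍ} {v : Fin 4 → ℤ} (h : v ∈ reduced e F D) :
    -v ∈ reduced e F D := by
  obtain ⟨h1, h2, z, hz, h3⟩ := h
  refine ⟨by simpa [disc, hessP, hessQ, hessR] using h1, by simpa using h2, z, hz, ?_⟩
  convert h3.neg using 1
  ext i
  simp [toReal]

lemma exists_reduced_rep (he : e = -1 ∨ e = 1 / 3) (heD : 0 < e * D) (h : Fund D)
    {o : Orbit} (ho : o.disc = D) (hr : o ≠ Quotient.mk orbitSetoid (redForm D)) :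
    ∃ v ∈ reduced e fd D, Quotient.mk orbitSetoid v = o := by
  induction o using Quotient.inductionOn with
  | h v =>
    rw [Orbit.disc_mk] at ho
    obtain ⟨z, hz⟩ := exists_rel he (v := toReal v) (by rwa [disc_toReal, ho])
    obtain ⟨γ, hγ⟩ := exists_smul_mem_fd z
    refine ⟨act γ v, ⟨by rw [disc_act, ho], fun h0 => hr ?_, _, hγ, hz.act he γ⟩,
      orbit_eq_iff.2 ⟨γ⁻¹, act_inv_act γ v⟩⟩
    obtain ⟨g, hg⟩ := exists_act_redForm h (by rw [disc_act, ho]) h0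
    exact orbit_eq_iff.2 ⟨g * γ, by rw [act_mul, hg]⟩

lemma finite_orbits (he : e = -1 ∨ e = 1 / 3) (heD : 0 < e * D) (h : Fund D)
    (hfin : (reduced e fd D).Finite) : {o : Orbit | o.disc = D}.Finite := by
  refine ((hfin.image (Quotient.mk orbitSetoid)).insert
    (Quotient.mk orbitSetoid (redForm D))).subset fun o ho => ?_
  by_cases hr : o = Quotient.mk orbitSetoid (redForm D)
  · exact Or.inl hr
  · exact Or.inr (exists_reduced_rep he heD h ho hr)

lemma ncard_diff_red (he : e = -1 ∨ e = 1 / 3) (heD : 0 < e * D) (h : Fund D)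
    (hfin : (reduced e fd D).Finite) :
    Set.ncard ({o : Orbit | o.disc = D} \ {Quotient.mk orbitSetoid (redForm D)}) + 1 =
      Nat.card {o : Orbit // o.disc = D} := by
  rw [Set.ncard_sdiff_singleton_add_one (a := Quotient.mk orbitSetoid (redForm D))
    (s := {o : Orbit | o.disc = D}) (disc_redForm h.1) (finite_orbits he heD h hfin)]
  rfl

/-- Orbits are bounded above by reduced forms. -/
theorem two_mul_card_orbit_le (he : e = -1 ∨ e = 1 / 3) (heD : 0 < e * D) (h : Fund D)
    (hfin : (reduced e fd D).Finite) :
    2 * Nat.card {o : Orbit // o.disc = D} ≤ (reduced e fd D).ncard + 2 := by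
  rw [← ncard_diff_red he heD h hfin]
  set O := {o : Orbit | o.disc = D} \ {Quotient.mk orbitSetoid (redForm D)}
  have key : ∀ o : O, ∃ v ∈ reduced e fd D, Quotient.mk orbitSetoid v = (o : Orbit) :=
    fun o => exists_reduced_rep he heD h o.2.1 o.2.2
  choose f hf hfo using key
  have := hfin.to_subtype
  let g : O × Bool → reduced e fd D := fun p =>
    if p.2 then ⟨f p.1, hf p.1⟩ else ⟨-f p.1, neg_mem_reduced (hf p.1)⟩
  have hgo : ∀ p, Quotient.mk orbitSetoid (g p : Fin 4 → ℤ) = (p.1 : Orbit) := by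
    rintro ⟨o, b⟩
    rw [← hfo]
    cases b
    · exact orbit_eq_iff.2 ⟨-1, by simp [g, act_neg_one]⟩
    · rfl
  have hg : Function.Injective g := by
    rintro ⟨o, b⟩ ⟨o', b'⟩ hp
    obtain rfl : o = o' := Subtype.ext (by rw [← hgo (o, b), ← hgo (o', b'), hp])
    have h0 := (hf o).2.1
    have hp0 := congrFun (congrArg Subtype.val hp) 0
    have : b = b' := by
      cases b <;> cases b' <;> simp [g] at hp0 ⊢ <;> omega
    rw [this]
  have := Nat.card_le_card_of_injective g hg
  rw [Nat.card_prod, Nat.card_coe_set_eq, Nat.card_coe_set_eq] at this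
  simp at this
  omega

lemma act_zero_of_c_eq_zero {γ : SpecialLinearGroup (Fin 2) ℤ} (hc : γ 1 0 = 0)
    {v : Fin 4 → ℤ} (h0 : v 0 = 0) : act γ v 0 = 0 := by
  simp [act, subst, hc, h0]

lemma exists_rel_redForm (he : e = -1 ∨ e = 1 / 3) (heD : 0 < e * D) (h : IsDiscMod D) :
    ∃ z : ℍ, Rel e (toReal (redForm D)) z ∧ z.im ^ 2 = e * D / 4 := by
  have hd : (D : ℝ) = 4 * toReal (redForm D) 3 - 3 * toReal (redForm D) 2 ^ 2 := by
    rw [← congrArg (Int.cast : ℤ → ℝ) (disc_redForm h), ← disc_toReal]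
    simp [disc, hessP, hessQ, hessR, toReal, redForm]
    ring
  have h0 : toReal (redForm D) 0 = 0 := by simp [toReal, redForm]
  have h1 : toReal (redForm D) 1 = 1 := by simp [toReal, redForm]
  obtain ⟨z, -, hz, h⟩ := rel_of_sq (e := e) (by rintro rfl; simp at heD) (v := toReal (redForm D))
    (x := -(toReal (redForm D) 2) / 2) (Y := e * D / 4) (by linarith)
    (by rw [h0, h1]; ring) (by rw [h0, h1, hd]; ring)
  exact ⟨z, h, hz⟩

lemma not_reduced_redForm (he : e = -1 ∨ e = 1 / 3) (heD : 16 < e * D) (h : IsDiscMod D)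
    {v : Fin 4 → ℤ} (hv : v ∈ reduced e fd D) :
    Quotient.mk orbitSetoid v ≠ Quotient.mk orbitSetoid (redForm D) := by
  intro ho
  obtain ⟨γ, rfl⟩ := orbit_eq_iff.1 ho.symm
  obtain ⟨hD, h0, z, hz, hrel⟩ := hv
  obtain ⟨z₀, hz₀, him⟩ := exists_rel_redForm he (by linarith) h
  have h1 := hz₀.act he γ
  have hne : disc (toReal (act γ (redForm D))) ≠ 0 := by
    rw [disc_toReal, hD]
    rintro h'
    rw [h'] at heD
    norm_num at heD
  obtain rfl := hrel.unique he hne h1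
  have hc : γ 1 0 ≠ 0 := fun hc => h0 (act_zero_of_c_eq_zero hc (by simp [redForm]))
  have h2 := three_le_four_mul_im_sq_of_mem_fd hz
  rw [ModularGroup.im_smul_eq_div_normSq] at h2
  have h3 : ((γ 1 0 : ℝ) * z₀.im) ^ 2 ≤ Complex.normSq (denom γ z₀) := by
    rw [Complex.normSq_apply]
    simp [denom]
    nlinarith [sq_nonneg ((γ 1 0 : ℝ) * z₀.re + γ 1 1)]
  have h4 : (1 : ℝ) ≤ (γ 1 0 : ℝ) ^ 2 := by
    have : (0 : ℤ) < (γ 1 0) ^ 2 := by positivity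
    exact_mod_cast Int.add_one_le_iff.2 this
  have hp := z₀.im_pos
  set N := Complex.normSq (denom γ z₀)
  have h5 : z₀.im ^ 2 ≤ N := by nlinarith [sq_nonneg z₀.im]
  have hN : 0 < N := lt_of_lt_of_le (by positivity) h5
  rw [div_pow, mul_div_assoc', le_div_iff₀ (by positivity)] at h2
  nlinarith

/-- Orbits are bounded below by forms with point in the open fundamental domain. -/
theorem ncard_reduced_fdo_le (he : e = -1 ∨ e = 1 / 3) (heD : 16 < e * D) (h : Fund D)
    (hfin : (reduced e fd D).Finite) :
    (reduced e fdo D).ncard + 2 ≤ 2 * Nat.card {o : Orbit // o.disc = D} := by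
  have heD' : 0 < e * D := by linarith
  rw [← ncard_diff_red he heD' h hfin]
  set O := {o : Orbit | o.disc = D} \ {Quotient.mk orbitSetoid (redForm D)} with hO
  have hsub : reduced e fdo D ⊆ reduced e fd D :=
    fun v ⟨h1, h2, z, hz, h3⟩ => ⟨h1, h2, z, fdo_subset_fd hz, h3⟩
  have hOfin : O.Finite := (finite_orbits he heD' h hfin).sdiff
  have hmaps : ∀ v ∈ reduced e fdo D, Quotient.mk orbitSetoid v ∈ O := fun v hv =>
    ⟨hv.1, not_reduced_redForm he heD h.1 (hsub hv)⟩
  classical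
  have hfib : ∀ v ∈ reduced e fdo D, ∀ w ∈ reduced e fdo D,
      Quotient.mk orbitSetoid v = Quotient.mk orbitSetoid w → w = v ∨ w = -v := by
    rintro v ⟨h1, -, z, hz, hv⟩ w ⟨h1', -, z', hz', hw⟩ hvw
    obtain ⟨γ, rfl⟩ := orbit_eq_iff.1 hvw
    have hne : disc (toReal (act γ v)) ≠ 0 := by
      rw [disc_toReal, h1']
      rintro h'
      rw [h'] at heD
      norm_num at heD
    obtain rfl := hw.unique he hne (hv.act he γ)
    rcases eq_one_or_neg_one_of_mem_fdo_mem_fdo hz hz' with rfl | rfl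
    · left; rw [act_one]
    · right; rw [act_neg_one]
  have hS := hfin.subset hsub
  have := Finset.card_le_mul_card_image_of_maps_to (s := hS.toFinset) (t := hOfin.toFinset)
    (f := Quotient.mk orbitSetoid) (fun v hv => by
      rw [Set.Finite.mem_toFinset] at hv ⊢
      exact hmaps v hv) 2 (fun o _ => by
      by_contra! hlt
      obtain ⟨a, ha⟩ := Finset.card_pos.1 (lt_trans (by norm_num) hlt)
      rw [Finset.mem_filter, Set.Finite.mem_toFinset] at ha
      have : (hS.toFinset.filter fun v => Quotient.mk orbitSetoid v = o) ⊆ {a, -a} := by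
        intro w hw
        rw [Finset.mem_filter, Set.Finite.mem_toFinset] at hw
        rw [Finset.mem_insert, Finset.mem_singleton]
        exact hfib a ha.1 w hw.1 (ha.2.trans hw.2.symm)
      have := (Finset.card_le_card this).trans Finset.card_le_two
      omega)
  rw [← Set.ncard_eq_toFinset_card _ hS, ← Set.ncard_eq_toFinset_card _ hOfin] at this
  omega

end CubicForm

namespace CubicForm

open Matrix UpperHalfPlane MeasureTheory Filter Topology

variable {e : ℝ}

/-- The Jacobian matrix of `Phi`. -/
def jac (e : ℝ) (w : Fin 4 → ℝ) : Matrix (Fin 4) (Fin 4) ℝ :=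
  !![0, 0, 1, 0;
    -w 2, e * w 3, -w 0, e * w 1;
    2 * w 0 * w 2 - 2 * e * w 3 * w 1, 2 * e * w 2 * w 1 - 2 * e * w 0 * w 3,
      e * w 1 ^ 2 + w 0 ^ 2, -2 * e * w 0 * w 1;
    -3 * e * w 2 * w 1 ^ 2 + 6 * e * w 0 * w 3 * w 1 - 3 * w 0 ^ 2 * w 2,
      3 * w 3 * w 1 ^ 2 - 6 * e * w 0 * w 2 * w 1 + 3 * e * w 0 ^ 2 * w 3,
      -3 * e * w 0 * w 1 ^ 2 - w 0 ^ 3, w 1 ^ 3 + 3 * e * w 0 ^ 2 * w 1]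

lemma det_jac (he : e = -1 ∨ e = 1 / 3) (w : Fin 4 → ℝ) :
    (jac e w).det = -(4 * e ^ 2 * w 1 ^ 4 * (w 2 ^ 2 + w 3 ^ 2)) := by
  rcases he with rfl | rfl <;>
  · simp [jac, det_succ_row_zero, Fin.sum_univ_succ, Fin.succAbove]
    ring

/-- The derivative of `Phi`. -/
noncomputable def derivPhi (e : ℝ) (w : Fin 4 → ℝ) : (Fin 4 → ℝ) →L[ℝ] (Fin 4 → ℝ) :=
  LinearMap.toContinuousLinearMap (Matrix.toLin' (jac e w))

lemma det_derivPhi (he : e = -1 ∨ e = 1 / 3) (w : Fin 4 → ℝ) :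
    (derivPhi e w).det = -(4 * e ^ 2 * w 1 ^ 4 * (w 2 ^ 2 + w 3 ^ 2)) := by
  rw [← det_jac he, derivPhi, ContinuousLinearMap.det]
  simp

lemma contDiff_Phi : ContDiff ℝ 1 (Phi e) := by
  rw [contDiff_pi]
  intro i
  fin_cases i <;> simp [Phi] <;> fun_prop

lemma hasFDerivAt_Phi (w : Fin 4 → ℝ) : HasFDerivAt (Phi e) (derivPhi e w) w := by
  have P := fun k : Fin 4 => hasFDerivAt_apply (𝕜 := ℝ) k w
  rw [hasFDerivAt_pi']
  intro i
  fin_cases i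
  · refine (P 2).congr_fderiv ?_
    ext v
    simp [derivPhi, jac, dotProduct, Fin.sum_univ_four]
  · refine ((((P 3).const_mul e).mul (P 1)).sub ((P 0).mul (P 2))).congr_fderiv ?_
    ext v
    simp [derivPhi, jac, dotProduct, Fin.sum_univ_four]
    ring
  · refine (((((P 2).const_mul e).mul ((P 1).pow 2)).sub (((P 0).const_mul 2).mul
      (((P 3).const_mul e).mul (P 1)))).add (((P 0).pow 2).mul (P 2))).congr_fderiv ?_
    ext v
    simp [derivPhi, jac, dotProduct, Fin.sum_univ_four]
    ring
  · refine (((((P 3).mul ((P 1).pow 3)).sub (((P 0).const_mul 3).mul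
      (((P 2).const_mul e).mul ((P 1).pow 2)))).add ((((P 0).pow 2).const_mul 3).mul
      (((P 3).const_mul e).mul (P 1)))).sub (((P 0).pow 3).mul (P 2))).congr_fderiv ?_
    ext v
    simp [derivPhi, jac, dotProduct, Fin.sum_univ_four]
    ring

/-- The absolute discriminant of `Phi e w`. -/
def sizeOf (e : ℝ) (w : Fin 4 → ℝ) : ℝ := 4 * |e| ^ 3 * (w 1 ^ 6 * (w 2 ^ 2 + w 3 ^ 2) ^ 2)

/-- The open parameter region. -/
def regU (e T : ℝ) : Set (Fin 4 → ℝ) :=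
  {w | |w 0| < 1 / 2 ∧ 1 < w 0 ^ 2 + w 1 ^ 2 ∧ 0 < w 1 ∧ w 1 < T ∧ w 2 ≠ 0 ∧ sizeOf e w < 1}

/-- The closed parameter region. -/
def regK (e T : ℝ) : Set (Fin 4 → ℝ) :=
  {w | |w 0| ≤ 1 / 2 ∧ 1 ≤ w 0 ^ 2 + w 1 ^ 2 ∧ 0 ≤ w 1 ∧ w 1 ≤ T ∧ sizeOf e w ≤ 1}

lemma regU_subset (e T : ℝ) : regU e T ⊆ regK e T :=
  fun _ ⟨h1, h2, h3, h4, _, h6⟩ => ⟨h1.le, h2.le, h3.le, h4.le, h6.le⟩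

lemma abs_disc_Phi (he : e = -1 ∨ e = 1 / 3) (w : Fin 4 → ℝ) : |disc (Phi e w)| = sizeOf e w := by
  rw [disc_Phi he, sizeOf, abs_mul, abs_mul, abs_pow, abs_of_pos (by norm_num : (0:ℝ) < 4),
    abs_of_nonneg (by positivity : (0:ℝ) ≤ w 1 ^ 6 * (w 2 ^ 2 + w 3 ^ 2) ^ 2)]

lemma isOpen_regU (e T : ℝ) : IsOpen (regU e T) := by
  unfold regU sizeOf
  exact (isOpen_lt (by fun_prop) (by fun_prop)).and <|
    (isOpen_lt (by fun_prop) (by fun_prop)).and <| (isOpen_lt (by fun_prop) (by fun_prop)).and <|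
    (isOpen_lt (by fun_prop) (by fun_prop)).and <|
    (isOpen_ne_fun (by fun_prop) (by fun_prop)).and (isOpen_lt (by fun_prop) (by fun_prop))

lemma isClosed_regK (e T : ℝ) : IsClosed (regK e T) := by
  unfold regK sizeOf
  have hc : ∀ {p q : (Fin 4 → ℝ) → Prop}, IsClosed {w | p w} → IsClosed {w | q w} →
      IsClosed {w | p w ∧ q w} := fun h h' => h.inter h'
  exact hc (isClosed_le (by fun_prop) (by fun_prop)) <|
    hc (isClosed_le (by fun_prop) (by fun_prop)) <|
    hc (isClosed_le (by fun_prop) (by fun_prop)) <|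
    hc (isClosed_le (by fun_prop) (by fun_prop)) (isClosed_le (by fun_prop) (by fun_prop))

lemma isCompact_regK (he : e = -1 ∨ e = 1 / 3) (T : ℝ) : IsCompact (regK e T) := by
  refine Metric.isCompact_of_isClosed_isBounded (isClosed_regK e T) ?_
  refine (Metric.isBounded_closedBall (x := 0) (r := max (|T| + 1) 6)).subset fun w hw => ?_
  obtain ⟨h1, h2, h3, h4, h6⟩ := hw
  have he3 : 4 / 27 ≤ 4 * |e| ^ 3 := by
    rcases he with rfl | rfl
    · norm_num
    · rw [abs_of_pos (by norm_num)]; norm_num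
  have hx : w 0 ^ 2 ≤ 1 / 4 := by
    rw [← sq_abs]; nlinarith [abs_nonneg (w 0)]
  have hy : 3 / 4 ≤ w 1 ^ 2 := by linarith
  have hy6 : 27 / 64 ≤ w 1 ^ 6 := by
    have := pow_le_pow_left₀ (by norm_num) hy 3
    nlinarith
  have hρ : w 2 ^ 2 + w 3 ^ 2 ≤ 4 := by
    by_contra! hlt
    have h7 : 16 < (w 2 ^ 2 + w 3 ^ 2) ^ 2 := by nlinarith
    have h8 : 27 / 4 < w 1 ^ 6 * (w 2 ^ 2 + w 3 ^ 2) ^ 2 := by nlinarith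
    unfold sizeOf at h6
    nlinarith
  rw [mem_closedBall_zero_iff, pi_norm_le_iff_of_nonneg (by positivity)]
  have hT := le_abs_self T
  intro i
  rw [Real.norm_eq_abs]
  fin_cases i
  · exact le_max_of_le_right (h1.trans (by norm_num))
  · exact le_max_of_le_left (by simp only [Fin.mk_one]; rw [abs_of_nonneg h3]; linarith)
  · exact le_max_of_le_right (show |w 2| ≤ 6 from
      abs_le_of_sq_le_sq (by nlinarith [sq_nonneg (w 2), sq_nonneg (w 3)]) (by norm_num))
  · exact le_max_of_le_right (show |w 3| ≤ 6 from
      abs_le_of_sq_le_sq (by nlinarith [sq_nonneg (w 2), sq_nonneg (w 3)]) (by norm_num))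

lemma injOn_Phi (he : e = -1 ∨ e = 1 / 3) : Set.InjOn (Phi e) {w | 0 < w 1 ∧ w 2 ≠ 0} := by
  rintro w ⟨hw1, hw2⟩ w' ⟨hw1', hw2'⟩ h
  have key : ∀ w : Fin 4 → ℝ, (hw : 0 < w 1) → Rel e (Phi e w) ⟨⟨w 0, w 1⟩, hw⟩ := fun w hw =>
    ⟨w 2, w 3, congrArg _ (by ext i; fin_cases i <;> rfl)⟩
  have hd : disc (Phi e w) ≠ 0 := by
    rw [disc_Phi he]
    have : e ≠ 0 := by rcases he with rfl | rfl <;> norm_num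
    positivity
  have := (key w hw1).unique he hd (h ▸ key w' hw1')
  have h0 : w 0 = w' 0 := congrArg UpperHalfPlane.re this
  have h1 : w 1 = w' 1 := congrArg UpperHalfPlane.im this
  have h2 : w 2 = w' 2 := congrFun h 0
  have h3 := congrFun h 1
  have he0 : e ≠ 0 := by rcases he with rfl | rfl <;> norm_num
  simp [Phi, h0, h1, h2, he0, hw1'.ne'] at h3
  ext i
  fin_cases i <;> assumption

lemma isOpen_image_regU (he : e = -1 ∨ e = 1 / 3) (T : ℝ) : IsOpen (Phi e '' regU e T) := by
  rw [isOpen_iff_mem_nhds]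
  rintro _ ⟨w, hw, rfl⟩
  have hs : HasStrictFDerivAt (Phi e) (derivPhi e w) w :=
    contDiff_Phi.contDiffAt.hasStrictFDerivAt' (hasFDerivAt_Phi w) (by norm_num)
  have hdet : IsUnit (Matrix.toLin' (jac e w)).det := by
    rw [LinearMap.det_toLin', det_jac he, isUnit_iff_ne_zero]
    have : e ≠ 0 := by rcases he with rfl | rfl <;> norm_num
    have := hw.2.2.1
    have := hw.2.2.2.2.1
    exact neg_ne_zero.2 (by positivity)
  have hr : (derivPhi e w).range = ⊤ := by
    have := (LinearMap.equivOfIsUnitDet hdet).range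
    rwa [LinearMap.coe_equivOfIsUnitDet] at this
  rw [← hs.map_nhds_eq_of_surj hr]
  exact Filter.image_mem_map ((isOpen_regU e T).mem_nhds hw)

end CubicForm

namespace CubicForm

open Matrix UpperHalfPlane MeasureTheory Filter Topology

lemma volume_eq_zero_of_lines {n : ℕ} {S : Set (Fin (n + 1) → ℝ)} (hS : MeasurableSet S)
    (i : Fin (n + 1)) (h : ∀ w, {t : ℝ | Function.update w i t ∈ S}.Countable) :
    volume S = 0 := by
  have hp := (volume_preserving_piFinSuccAbove (fun _ : Fin (n + 1) => ℝ) i).symm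
  rw [← hp.measure_preimage hS.nullMeasurableSet, Measure.volume_eq_prod,
    Measure.prod_apply_symm (hp.measurable hS)]
  refine (lintegral_congr fun y => ?_).trans lintegral_zero
  refine Set.Countable.measure_zero ?_ _
  refine (h (i.insertNth 0 y)).mono fun t ht => ?_
  rw [Set.mem_ofPred_eq, Fin.update_insertNth]
  exact ht

lemma countable_of_sq {S : Set ℝ} (h : ∀ t ∈ S, ∀ t' ∈ S, t ^ 2 = t' ^ 2) : S.Countable := by
  rcases S.eq_empty_or_nonempty with rfl | ⟨t, ht⟩
  · exact Set.countable_empty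
  · refine ((Set.finite_singleton (-t)).insert t).countable.mono fun t' ht' => ?_
    exact sq_eq_sq_iff_eq_or_eq_neg.1 (h t' ht' t ht)

variable {e : ℝ}

lemma volume_regK_diff (he : e = -1 ∨ e = 1 / 3) (T : ℝ) : volume (regK e T \ regU e T) = 0 := by
  have he0 : 0 < |e| := by rcases he with rfl | rfl <;> norm_num
  have hsub : regK e T \ regU e T ⊆ {w | |w 0| = 1 / 2} ∪ {w | w 0 ^ 2 + w 1 ^ 2 = 1} ∪
      {w | w 1 = 0} ∪ {w | w 1 = T} ∪ {w | w 2 = 0} ∪ {w | sizeOf e w = 1} := by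
    rintro w ⟨⟨h1, h2, h3, h4, h6⟩, h⟩
    simp only [Set.mem_union, Set.mem_ofPred_eq]
    by_contra! hne
    obtain ⟨⟨⟨⟨⟨n1, n2⟩, n3⟩, n4⟩, n5⟩, n6⟩ := hne
    exact h ⟨lt_of_le_of_ne h1 n1, lt_of_le_of_ne h2 (Ne.symm n2), lt_of_le_of_ne h3 (Ne.symm n3),
      lt_of_le_of_ne h4 n4, n5, lt_of_le_of_ne h6 n6⟩
  refine measure_mono_null hsub ?_
  simp only [measure_union_null_iff]
  refine ⟨⟨⟨⟨⟨?_, ?_⟩, ?_⟩, ?_⟩, ?_⟩, ?_⟩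
  · refine volume_eq_zero_of_lines (isClosed_eq (by fun_prop) (by fun_prop)).measurableSet 0
      fun w => countable_of_sq fun t ht t' ht' => ?_
    simp only [Set.mem_ofPred_eq, Function.update_self] at ht ht'
    rw [← sq_abs, ht, ← ht', sq_abs]
  · refine volume_eq_zero_of_lines (isClosed_eq (by fun_prop) (by fun_prop)).measurableSet 0
      fun w => countable_of_sq fun t ht t' ht' => ?_
    simp at ht ht'
    linarith
  · refine volume_eq_zero_of_lines (isClosed_eq (by fun_prop) (by fun_prop)).measurableSet 1
      fun w => countable_of_sq fun t ht t' ht' => ?_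
    simp at ht ht'
    rw [ht, ht']
  · refine volume_eq_zero_of_lines (isClosed_eq (by fun_prop) (by fun_prop)).measurableSet 1
      fun w => countable_of_sq fun t ht t' ht' => ?_
    simp at ht ht'
    rw [ht, ht']
  · refine volume_eq_zero_of_lines (isClosed_eq (by fun_prop) (by fun_prop)).measurableSet 2
      fun w => countable_of_sq fun t ht t' ht' => ?_
    simp at ht ht'
    rw [ht, ht']
  · refine volume_eq_zero_of_lines (isClosed_eq (by unfold sizeOf; fun_prop)
      (by fun_prop)).measurableSet 3 fun w => countable_of_sq fun t ht t' ht' => ?_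
    simp [sizeOf] at ht ht'
    have hw : w 1 ≠ 0 := by rintro h; simp [h] at ht
    have h := ht.trans ht'.symm
    have h' := mul_left_cancel₀ (by positivity) (mul_left_cancel₀ (by positivity) h)
    have := (pow_left_inj₀ (by positivity) (by positivity) (by norm_num)).1 h'
    linarith

lemma volume_image_diff (he : e = -1 ∨ e = 1 / 3) (T : ℝ) :
    volume (Phi e '' regK e T \ Phi e '' regU e T) = 0 := by
  refine measure_mono_null (t := Phi e '' (regK e T \ regU e T)) ?_ ?_
  · rintro _ ⟨⟨w, hw, rfl⟩, h⟩
    exact ⟨w, ⟨hw, fun hu => h ⟨w, hu, rfl⟩⟩, rfl⟩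
  exact addHaar_image_eq_zero_of_differentiableOn_of_addHaar_eq_zero _
    (fun w _ => (hasFDerivAt_Phi w).differentiableAt.differentiableWithinAt) (volume_regK_diff he T)

lemma isCompact_image_regK (he : e = -1 ∨ e = 1 / 3) (T : ℝ) : IsCompact (Phi e '' regK e T) :=
  (isCompact_regK he T).image contDiff_Phi.continuous

lemma volume_frontier_image_regK (he : e = -1 ∨ e = 1 / 3) (T : ℝ) :
    volume (frontier (Phi e '' regK e T)) = 0 := by
  refine measure_mono_null ?_ (volume_image_diff he T)
  rw [(isCompact_image_regK he T).isClosed.frontier_eq]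
  exact Set.sdiff_subset_sdiff_right
    (interior_maximal (Set.image_mono (regU_subset e T)) (isOpen_image_regU he T))

lemma volume_frontier_image_regU (he : e = -1 ∨ e = 1 / 3) (T : ℝ) :
    volume (frontier (Phi e '' regU e T)) = 0 := by
  refine measure_mono_null ?_ (volume_image_diff he T)
  rw [(isOpen_image_regU he T).frontier_eq]
  exact Set.sdiff_subset_sdiff_left
    (closure_minimal (Set.image_mono (regU_subset e T)) (isCompact_image_regK he T).isClosed)

lemma volume_image_regK (he : e = -1 ∨ e = 1 / 3) (T : ℝ) :
    volume (Phi e '' regK e T) = volume (Phi e '' regU e T) := by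
  refine measure_congr (ae_eq_set.2 ⟨volume_image_diff he T, ?_⟩)
  rw [Set.sdiff_eq_empty.2 (Set.image_mono (regU_subset e T)), measure_empty]

lemma lintegral_fin_four {f : (Fin 4 → ℝ) → ENNReal} (hf : Measurable f) :
    ∫⁻ w, f w = ∫⁻ x : ℝ, ∫⁻ y : ℝ, ∫⁻ p : ℝ × ℝ, f ![x, y, p.1, p.2] := by
  have h3 := (volume_preserving_piFinSuccAbove (fun _ : Fin 4 => ℝ) 0).symm
  have h2 := (volume_preserving_piFinSuccAbove (fun _ : Fin 3 => ℝ) 0).symm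
  have h1 := (volume_preserving_finTwoArrow ℝ).symm
  rw [← h3.lintegral_comp hf, Measure.volume_eq_prod,
    lintegral_prod (fun a => f ((MeasurableEquiv.piFinSuccAbove (fun _ : Fin 4 => ℝ) 0).symm a))
      (hf.comp h3.measurable).aemeasurable]
  refine lintegral_congr fun x => ?_
  have m2 : Measurable fun w : Fin 3 → ℝ =>
      f ((MeasurableEquiv.piFinSuccAbove (fun _ : Fin 4 => ℝ) 0).symm (x, w)) :=
    (hf.comp h3.measurable).comp measurable_prodMk_left
  rw [← h2.lintegral_comp m2, Measure.volume_eq_prod,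
    lintegral_prod (fun a => f ((MeasurableEquiv.piFinSuccAbove (fun _ : Fin 4 => ℝ) 0).symm
      (x, (MeasurableEquiv.piFinSuccAbove (fun _ : Fin 3 => ℝ) 0).symm a)))
      (m2.comp h2.measurable).aemeasurable]
  refine lintegral_congr fun y => ?_
  refine (h1.lintegral_comp ((m2.comp h2.measurable).comp
    (measurable_prodMk_left (x := y)))).symm.trans ?_
  refine lintegral_congr fun p => congrArg f ?_
  ext i
  fin_cases i <;> rfl

lemma setLIntegral_Ioo_ofReal {f : ℝ → ℝ} {a b : ℝ} (hab : a ≤ b) (hc : ContinuousOn f (Set.Icc a b))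
    (h0 : ∀ x ∈ Set.Icc a b, 0 ≤ f x) :
    ∫⁻ x in Set.Ioo a b, ENNReal.ofReal (f x) = ENNReal.ofReal (∫ x in a..b, f x) := by
  have hi : IntervalIntegrable f volume a b := ContinuousOn.intervalIntegrable_of_Icc hab hc
  rw [intervalIntegral.integral_of_le hab, ofReal_integral_eq_lintegral_ofReal hi.1
    ((ae_restrict_mem measurableSet_Ioc).mono fun x hx => h0 x ⟨hx.1.le, hx.2⟩),
    restrict_Ioo_eq_restrict_Ioc]

lemma lintegral_disk {q : ℝ} (hq : 0 < q) :
    ∫⁻ p : ℝ × ℝ, (if (p.1 ^ 2 + p.2 ^ 2) ^ 2 < q ^ 4 then ENNReal.ofReal (p.1 ^ 2 + p.2 ^ 2) else 0) =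
      ENNReal.ofReal (Real.pi * q ^ 4 / 2) := by
  rw [← lintegral_comp_polarCoord_symm, polarCoord_target]
  have hs : ∀ p : ℝ × ℝ, (p.1 * Real.cos p.2) ^ 2 + (p.1 * Real.sin p.2) ^ 2 = p.1 ^ 2 := fun p => by
    rw [mul_pow, mul_pow, ← mul_add, Real.cos_sq_add_sin_sq, mul_one]
  simp only [polarCoord_symm_apply, hs]
  have h1 : ∀ p ∈ Set.Ioi (0:ℝ) ×ˢ Set.Ioo (-Real.pi) Real.pi,
      ENNReal.ofReal p.1 • (if (p.1 ^ 2) ^ 2 < q ^ 4 then ENNReal.ofReal (p.1 ^ 2) else 0) =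
      (Set.Ioo 0 q).indicator (fun r => ENNReal.ofReal (r ^ 3)) p.1 * 1 := by
    rintro ⟨r, t⟩ ⟨hr, -⟩
    have hr : 0 < r := hr
    have : (r ^ 2) ^ 2 < q ^ 4 ↔ r < q := by
      rw [← pow_mul]; exact pow_lt_pow_iff_left₀ hr.le hq.le (by norm_num)
    by_cases h : r < q
    · simp only [this, h, if_true, mul_one, smul_eq_mul]
      rw [Set.indicator_of_mem (by exact ⟨hr, h⟩), ← ENNReal.ofReal_mul hr.le]
      congr 1; ring
    · simp only [this, h, if_false, smul_zero, mul_one]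
      rw [Set.indicator_of_notMem (fun h' => h h'.2)]
  rw [setLIntegral_congr_fun (measurableSet_Ioi.prod measurableSet_Ioo) h1, Measure.volume_eq_prod,
    ← Measure.prod_restrict, lintegral_prod_mul (g := fun _ => 1)
      (Measurable.indicator (by fun_prop) measurableSet_Ioo).aemeasurable aemeasurable_const,
    lintegral_indicator measurableSet_Ioo, Measure.restrict_restrict measurableSet_Ioo,
    Set.inter_eq_left.2 (fun r hr => hr.1), setLIntegral_Ioo_ofReal hq.le (by fun_prop)
      (fun x hx => pow_nonneg hx.1 3), lintegral_const, one_mul, Measure.restrict_apply_univ,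
    Real.volume_Ioo, integral_pow, ← ENNReal.ofReal_mul (by norm_num; positivity)]
  congr 1
  norm_num
  ring

lemma lintegral_column {C T x : ℝ} (hC : 0 ≤ C) (hT : 1 ≤ T) (hx : |x| < 1 / 2) :
    ∫⁻ y in Set.Ioo (√(1 - x ^ 2)) T, ENNReal.ofReal (C / y ^ 2) =
      ENNReal.ofReal (C * (1 / √(1 - x ^ 2) - 1 / T)) := by
  have hx2 : x ^ 2 < 1 := by rw [← sq_abs]; nlinarith [abs_nonneg x]
  have hs : 0 < √(1 - x ^ 2) := Real.sqrt_pos.2 (by linarith)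
  have hsT : √(1 - x ^ 2) ≤ T := (Real.sqrt_le_one.2 (by nlinarith)).trans hT
  have hne : ∀ y ∈ Set.Icc (√(1 - x ^ 2)) T, y ≠ 0 := fun y hy => (hs.trans_le hy.1).ne'
  have hc : ContinuousOn (fun y : ℝ => C / y ^ 2) (Set.Icc (√(1 - x ^ 2)) T) :=
    continuousOn_const.div (by fun_prop) fun y hy => pow_ne_zero 2 (hne y hy)
  rw [setLIntegral_Ioo_ofReal hsT hc (fun y hy => by positivity)]
  congr 1
  rw [intervalIntegral.integral_eq_sub_of_hasDerivAt (f := fun y => -C / y) (fun y hy => ?_)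
    (ContinuousOn.intervalIntegrable_of_Icc hsT hc)]
  · ring
  · rw [Set.uIcc_of_le hsT] at hy
    refine ((hasDerivAt_const y (-C)).div (hasDerivAt_id y) (hne y hy)).congr_deriv ?_
    simp

lemma lintegral_outer {C T : ℝ} (hC : 0 ≤ C) (hT : 1 ≤ T) :
    ∫⁻ x in Set.Ioo (-(1 / 2) : ℝ) (1 / 2), ENNReal.ofReal (C * (1 / √(1 - x ^ 2) - 1 / T)) =
      ENNReal.ofReal (C * (Real.pi / 3 - 1 / T)) := by
  have hx2 : ∀ x ∈ Set.Icc (-(1 / 2) : ℝ) (1 / 2), 0 < 1 - x ^ 2 := fun x hx => by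
    nlinarith [hx.1, hx.2]
  have hc : ContinuousOn (fun x : ℝ => C * (1 / √(1 - x ^ 2) - 1 / T)) (Set.Icc (-(1 / 2)) (1 / 2)) :=
    continuousOn_const.mul ((continuousOn_const.div (by fun_prop)
      fun x hx => (Real.sqrt_pos.2 (hx2 x hx)).ne').sub continuousOn_const)
  have h6 : Real.arcsin (1 / 2) = Real.pi / 6 := by
    rw [← Real.sin_pi_div_six, Real.arcsin_sin] <;> linarith [Real.pi_pos]
  rw [setLIntegral_Ioo_ofReal (by norm_num) hc]
  · congr 1
    rw [intervalIntegral.integral_eq_sub_of_hasDerivAt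
      (f := fun x => C * (Real.arcsin x - x / T)) (fun x hx => ?_)
      (ContinuousOn.intervalIntegrable_of_Icc (by norm_num) hc)]
    · rw [Real.arcsin_neg, h6]; ring
    · rw [Set.uIcc_of_le (by norm_num)] at hx
      exact ((Real.hasDerivAt_arcsin (by linarith [hx.1]) (by linarith [hx.2])).sub
        ((hasDerivAt_id x).div_const T)).const_mul C
  · intro x hx
    refine mul_nonneg hC (sub_nonneg.2 ?_)
    exact one_div_le_one_div_of_le (Real.sqrt_pos.2 (hx2 x hx))
      ((Real.sqrt_le_one.2 (by nlinarith)).trans hT)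

lemma volume_image_regU (he : e = -1 ∨ e = 1 / 3) {T : ℝ} (hT : 1 ≤ T) :
    volume (Phi e '' regU e T) =
      ENNReal.ofReal (Real.pi / (2 * |e|) * (Real.pi / 3 - 1 / T)) := by
  have he0 : 0 < |e| := by rcases he with rfl | rfl <;> norm_num
  set V : Set (Fin 4 → ℝ) := {w | |w 0| < 1 / 2 ∧ 1 < w 0 ^ 2 + w 1 ^ 2 ∧ 0 < w 1 ∧ w 1 < T ∧
    sizeOf e w < 1} with hV
  have hVo : IsOpen V := by
    rw [hV]; unfold sizeOf
    exact (isOpen_lt (by fun_prop) (by fun_prop)).and <|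
      (isOpen_lt (by fun_prop) (by fun_prop)).and <| (isOpen_lt (by fun_prop) (by fun_prop)).and <|
      (isOpen_lt (by fun_prop) (by fun_prop)).and (isOpen_lt (by fun_prop) (by fun_prop))
  have hpos : regU e T ⊆ {w | 0 < w 1 ∧ w 2 ≠ 0} := fun w hw => ⟨hw.2.2.1, hw.2.2.2.2.1⟩
  have hsub : regU e T ⊆ V := fun w ⟨h1, h2, h3, h4, _, h6⟩ => ⟨h1, h2, h3, h4, h6⟩
  have hsub' : V ⊆ regK e T := fun w ⟨h1, h2, h3, h4, h6⟩ => ⟨h1.le, h2.le, h3.le, h4.le, h6.le⟩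
  have hUV : regU e T =ᵐ[volume] V := by
    refine ae_eq_set.2 ⟨?_, measure_mono_null ?_ (volume_regK_diff he T)⟩
    · rw [Set.sdiff_eq_empty.2 hsub, measure_empty]
    · exact Set.sdiff_subset_sdiff_left hsub'
  rw [← lintegral_abs_det_fderiv_eq_addHaar_image _ (isOpen_regU e T).measurableSet
    (fun w _ => (hasFDerivAt_Phi w).hasFDerivWithinAt)
    ((injOn_Phi he).mono hpos), setLIntegral_congr hUV,
    ← lintegral_indicator hVo.measurableSet]
  simp only [det_derivPhi he]
  rw [lintegral_fin_four (Measurable.indicator (by fun_prop) hVo.measurableSet)]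
  set C := Real.pi / (2 * |e|)
  have hC : 0 ≤ C := by positivity
  rw [← lintegral_outer hC hT, ← lintegral_indicator measurableSet_Ioo]
  refine lintegral_congr fun x => ?_
  by_cases hx : |x| < 1 / 2
  swap
  · rw [Set.indicator_of_notMem (s := Set.Ioo (-(1 / 2) : ℝ) (1 / 2)) (fun h => hx (abs_lt.2 h))]
    refine (lintegral_congr fun y => (lintegral_congr fun p => ?_).trans lintegral_zero).trans
      lintegral_zero
    exact Set.indicator_of_notMem (fun h => hx h.1) _
  have hx' : x ∈ Set.Ioo (-(1 / 2) : ℝ) (1 / 2) := abs_lt.1 hx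
  rw [Set.indicator_of_mem (s := Set.Ioo (-(1 / 2) : ℝ) (1 / 2)) hx', ← lintegral_column hC hT hx,
    ← lintegral_indicator measurableSet_Ioo]
  refine lintegral_congr fun y => ?_
  have hx2 : x ^ 2 < 1 := by rw [← sq_abs]; nlinarith [abs_nonneg x]
  by_cases hy : y ∈ Set.Ioo (√(1 - x ^ 2)) T
  swap
  · rw [Set.indicator_of_notMem hy]
    refine (lintegral_congr fun p => ?_).trans lintegral_zero
    refine Set.indicator_of_notMem (fun h => hy ⟨?_, h.2.2.2.1⟩) _
    obtain ⟨-, h2, h3, -⟩ := h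
    simp at h2 h3
    rw [Real.sqrt_lt' h3]; linarith
  rw [Set.indicator_of_mem hy]
  have hy0 : 0 < y := (Real.sqrt_nonneg _).trans_lt hy.1
  have hy1 : 1 < x ^ 2 + y ^ 2 := by
    have := (Real.sqrt_lt' hy0).1 hy.1
    linarith
  set q := √√((4 * |e| ^ 3 * y ^ 6)⁻¹)
  have hk : 0 < 4 * |e| ^ 3 * y ^ 6 := by positivity
  have hq : 0 < q := Real.sqrt_pos.2 (Real.sqrt_pos.2 (inv_pos.2 hk))
  have hq4 : q ^ 4 = (4 * |e| ^ 3 * y ^ 6)⁻¹ := by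
    rw [show q ^ 4 = (q ^ 2) ^ 2 by ring, Real.sq_sqrt (Real.sqrt_nonneg _),
      Real.sq_sqrt (inv_pos.2 hk).le]
  have key : ∀ p : ℝ × ℝ, V.indicator (fun w => ENNReal.ofReal
      |-(4 * e ^ 2 * w 1 ^ 4 * (w 2 ^ 2 + w 3 ^ 2))|) ![x, y, p.1, p.2] =
      ENNReal.ofReal (4 * e ^ 2 * y ^ 4) * (if (p.1 ^ 2 + p.2 ^ 2) ^ 2 < q ^ 4 then
        ENNReal.ofReal (p.1 ^ 2 + p.2 ^ 2) else 0) := by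
    intro p
    have hm : ![x, y, p.1, p.2] ∈ V ↔ (p.1 ^ 2 + p.2 ^ 2) ^ 2 < q ^ 4 := by
      rw [hq4, ← one_div, lt_div_iff₀ hk]
      simp only [hV, sizeOf, Set.mem_ofPred_eq]
      refine ⟨fun h => ?_, fun h => ⟨hx, hy1, hy0, hy.2, ?_⟩⟩
      · have := h.2.2.2.2
        simp at this
        linarith
      · simp
        linarith
    by_cases h : (p.1 ^ 2 + p.2 ^ 2) ^ 2 < q ^ 4
    · rw [Set.indicator_of_mem (hm.2 h), if_pos h, ← ENNReal.ofReal_mul (by positivity), abs_neg]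
      congr 1
      exact abs_of_nonneg (by positivity)
    · rw [Set.indicator_of_notMem (mt hm.1 h), if_neg h, mul_zero]
  simp only [key]
  rw [lintegral_const_mul' _ _ ENNReal.ofReal_ne_top, lintegral_disk hq,
    ← ENNReal.ofReal_mul (by positivity), hq4]
  congr 1
  rw [← sq_abs e]
  simp only [C]
  field_simp

end CubicForm

namespace CubicForm

open Matrix UpperHalfPlane MeasureTheory Filter Topology

variable {e : ℝ}

/-- Integral vectors in a box. -/
noncomputable def box {n : ℕ} (B : Fin n → ℝ) : Finset (Fin n → ℤ) :=
  Fintype.piFinset fun i => Finset.Icc (-⌊B i⌋) ⌊B i⌋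

lemma mem_box {n : ℕ} {B : Fin n → ℝ} {v : Fin n → ℤ} : v ∈ box B ↔ ∀ i, |(v i : ℝ)| ≤ B i := by
  simp only [box, Fintype.mem_piFinset, Finset.mem_Icc]
  refine forall_congr' fun i => ?_
  rw [← abs_le, Int.le_floor]
  simp

lemma card_box {n : ℕ} {B : Fin n → ℝ} (hB : ∀ i, 0 ≤ B i) :
    ((box B).card : ℝ) ≤ ∏ i, (2 * B i + 1) := by
  rw [box, Fintype.card_piFinset]
  push_cast
  refine Finset.prod_le_prod (fun i _ => by positivity) fun i _ => ?_
  have h0 : 0 ≤ ⌊B i⌋ := Int.floor_nonneg.2 (hB i)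
  have : ((⌊B i⌋ + 1 - -⌊B i⌋).toNat : ℤ) = 2 * ⌊B i⌋ + 1 := by
    rw [Int.toNat_of_nonneg (by linarith)]; ring
  rw [Int.card_Icc]
  have h2 : ((⌊B i⌋ + 1 - -⌊B i⌋).toNat : ℝ) = 2 * ⌊B i⌋ + 1 := by exact_mod_cast this
  rw [h2]
  linarith [Int.floor_le (B i)]

lemma abs_Phi_le (he : e = -1 ∨ e = 1 / 3) {w : Fin 4 → ℝ} {A Y : ℝ} (hA : 0 ≤ A) (hY : 0 ≤ Y)
    (h0 : |w 0| ≤ 3 * Y) (h1 : |w 1| ≤ 2 * Y) (h2 : |w 2| ≤ 2 * A) (h3 : |w 3| ≤ 2 * A) (i : Fin 4) :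
    |Phi e w i| ≤ (![2 * A, 10 * (A * Y), 50 * (A * Y ^ 2), 250 * (A * Y ^ 3)] : Fin 4 → ℝ) i := by
  have hE : |e| ≤ 1 := by
    rcases he with rfl | rfl
    · norm_num
    · rw [abs_of_pos (by norm_num)]; norm_num
  fin_cases i
  · exact h2
  · show |e * w 3 * w 1 - w 0 * w 2| ≤ 10 * (A * Y)
    calc _ ≤ |e| * |w 3| * |w 1| + |w 0| * |w 2| := by
          refine (abs_sub _ _).trans ?_
          simp only [abs_mul]; rfl
      _ ≤ 1 * (2 * A) * (2 * Y) + (3 * Y) * (2 * A) := by gcongr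
      _ = _ := by ring
  · show |e * w 2 * w 1 ^ 2 - 2 * w 0 * (e * w 3 * w 1) + w 0 ^ 2 * w 2| ≤ 50 * (A * Y ^ 2)
    calc _ ≤ |e| * |w 2| * |w 1| ^ 2 + 2 * |w 0| * (|e| * |w 3| * |w 1|) + |w 0| ^ 2 * |w 2| := by
          refine (abs_add_le _ _).trans (add_le_add ((abs_sub _ _).trans ?_) ?_) <;>
          simp only [abs_mul, abs_pow, abs_two] <;> rfl
      _ ≤ 1 * (2 * A) * (2 * Y) ^ 2 + 2 * (3 * Y) * (1 * (2 * A) * (2 * Y)) +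
          (3 * Y) ^ 2 * (2 * A) := by gcongr
      _ = _ := by ring
  · show |w 3 * w 1 ^ 3 - 3 * w 0 * (e * w 2 * w 1 ^ 2) + 3 * w 0 ^ 2 * (e * w 3 * w 1)
      - w 0 ^ 3 * w 2| ≤ 250 * (A * Y ^ 3)
    have h33 : |(3:ℝ)| = 3 := by norm_num
    calc _ ≤ |w 3| * |w 1| ^ 3 + 3 * |w 0| * (|e| * |w 2| * |w 1| ^ 2) +
          3 * |w 0| ^ 2 * (|e| * |w 3| * |w 1|) + |w 0| ^ 3 * |w 2| := by
          refine (abs_sub _ _).trans (add_le_add ((abs_add_le _ _).trans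
            (add_le_add ((abs_sub _ _).trans ?_) ?_)) ?_) <;>
          simp only [abs_mul, abs_pow, h33] <;> rfl
      _ ≤ (2 * A) * (2 * Y) ^ 3 + 3 * (3 * Y) * (1 * (2 * A) * (2 * Y) ^ 2) +
          3 * (3 * Y) ^ 2 * (1 * (2 * A) * (2 * Y)) + (3 * Y) ^ 3 * (2 * A) := by gcongr
      _ = _ := by ring

/-- Integral forms with nonzero leading coefficient and bounded discriminant whose point lies in a
part of the standard fundamental domain. -/
def cusp (e X : ℝ) (J : Set ℝ) : Set (Fin 4 → ℤ) :=
  {v | v 0 ≠ 0 ∧ |((disc v : ℤ) : ℝ)| < X ∧ ∃ z ∈ ModularGroup.fd, z.im ∈ J ∧ Rel e (toReal v) z}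

/-- The constant in the count of points in a slice of the cusp. -/
def cuspConst : ℝ := 6 * 24 * 108 * 516

lemma sizeOf_ge (he : e = -1 ∨ e = 1 / 3) (w : Fin 4 → ℝ) :
    4 / 27 * (w 1 ^ 6 * (w 2 ^ 2 + w 3 ^ 2) ^ 2) ≤ sizeOf e w := by
  have he3 : 4 / 27 ≤ 4 * |e| ^ 3 := by
    rcases he with rfl | rfl
    · norm_num
    · rw [abs_of_pos (by norm_num)]; norm_num
  exact mul_le_mul_of_nonneg_right he3 (by positivity)

lemma disc_ne_zero_of_rel (he : e = -1 ∨ e = 1 / 3) {v : Fin 4 → ℝ} (h0 : v 0 ≠ 0) {z : ℍ}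
    (h : Rel e v z) : disc v ≠ 0 := by
  obtain ⟨r, s, rfl⟩ := h
  have hr : r ≠ 0 := h0
  have hz : 0 < z.im := z.im_pos
  have : e ≠ 0 := by rcases he with rfl | rfl <;> norm_num
  rw [disc_Phi he]
  have : 0 < r ^ 2 + s ^ 2 := by positivity
  simp
  exact ⟨‹e ≠ 0›, hz.ne', this.ne'⟩

lemma mem_box_of_rel (he : e = -1 ∨ e = 1 / 3) {Y A : ℝ} (hY : 0 < Y) (hA : 0 ≤ A)
    {v : Fin 4 → ℤ} (h0 : v 0 ≠ 0) (hX : |((disc v : ℤ) : ℝ)| < A ^ 4 * Y ^ 6) {z : ℍ}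
    (hz : Rel e (toReal v) z) (hre : |z.re| ≤ 3 * Y) (hY1 : Y ≤ z.im) (hY2 : z.im ≤ 2 * Y) :
    1 / 2 ≤ A ∧ v ∈ box ![2 * A, 10 * (A * Y), 50 * (A * Y ^ 2), 250 * (A * Y ^ 3)] := by
  obtain ⟨r, s, hrs⟩ := hz
  have hy := z.im_pos
  rw [← disc_toReal, hrs, abs_disc_Phi he] at hX
  have hX := (sizeOf_ge he _).trans_lt hX
  simp at hX
  have hρ : r ^ 2 + s ^ 2 ≤ (2 * A) ^ 2 := by
    have hY6 : Y ^ 6 ≤ z.im ^ 6 := by gcongr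
    by_contra! h
    have h1 : (2 * A) ^ 4 ≤ (r ^ 2 + s ^ 2) ^ 2 := by
      rw [show (2 * A) ^ 4 = ((2 * A) ^ 2) ^ 2 by ring]
      gcongr
    have h2 : Y ^ 6 * (2 * A) ^ 4 ≤ z.im ^ 6 * (r ^ 2 + s ^ 2) ^ 2 := by gcongr
    have : 0 ≤ A ^ 4 * Y ^ 6 := by positivity
    nlinarith
  have hr : |r| ≤ 2 * A := abs_le_of_sq_le_sq (by nlinarith [sq_nonneg s]) (by linarith)
  have hs : |s| ≤ 2 * A := abs_le_of_sq_le_sq (by nlinarith [sq_nonneg r]) (by linarith)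
  have hr1 : 1 ≤ |r| := by
    have : r = (v 0 : ℝ) := (congrFun hrs 0).symm
    rw [this]
    exact_mod_cast Int.one_le_abs h0
  refine ⟨by linarith, mem_box.2 fun i => ?_⟩
  have := abs_Phi_le he hA hY.le (w := ![z.re, z.im, r, s]) hre
    ((abs_of_pos hy).le.trans hY2) hr hs i
  rwa [← hrs] at this

lemma cusp_slice (he : e = -1 ∨ e = 1 / 3) {X Y : ℝ} (hX : 0 < X) (hY : 1 / 2 ≤ Y) :
    (cusp e X (Set.Ico Y (2 * Y))).Finite ∧
      ((cusp e X (Set.Ico Y (2 * Y))).ncard : ℝ) ≤ cuspConst * X / Y := by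
  have hY0 : 0 < Y := by linarith
  set A := √√(X / Y ^ 6)
  have hA : 0 ≤ A := Real.sqrt_nonneg _
  have hAX : A ^ 4 * Y ^ 6 = X := by
    rw [show A ^ 4 = (A ^ 2) ^ 2 by ring, Real.sq_sqrt (Real.sqrt_nonneg _),
      Real.sq_sqrt (by positivity)]
    field_simp
  set B : Fin 4 → ℝ := ![2 * A, 10 * (A * Y), 50 * (A * Y ^ 2), 250 * (A * Y ^ 3)]
  have key : ∀ v ∈ cusp e X (Set.Ico Y (2 * Y)), ∀ n : ℕ, n ≤ Y →
      1 / 2 ≤ A ∧ act (ModularGroup.T ^ (2 * n : ℤ)) v ∈ box B := by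
    rintro v ⟨h0, hd, z, hz, ⟨hY1, hY2⟩, hrel⟩ n hn
    have hsm : ModularGroup.T ^ (2 * n : ℤ) • z = ((2 * n : ℤ) : ℝ) +ᵥ z :=
      UpperHalfPlane.modular_T_zpow_smul z _
    have hrel' := hrel.act he (ModularGroup.T ^ (2 * n : ℤ))
    rw [hsm] at hrel'
    refine mem_box_of_rel he hY0 hA ?_ ?_ hrel' ?_ ?_ ?_
    · simpa [act, subst, ModularGroup.coe_T_zpow] using h0
    · rwa [disc_act, hAX]
    · rw [UpperHalfPlane.vadd_re]
      push_cast
      refine (abs_add_le _ _).trans ?_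
      rw [abs_of_nonneg (by positivity)]
      linarith [hz.2]
    · rwa [UpperHalfPlane.vadd_im]
    · rw [UpperHalfPlane.vadd_im]; exact hY2.le
  have hfin : (cusp e X (Set.Ico Y (2 * Y))).Finite := by
    refine (box B).finite_toSet.subset fun v hv => ?_
    have := (key v hv 0 (by simpa using hY0.le)).2
    simpa [act_one] using this
  refine ⟨hfin, ?_⟩
  rcases (cusp e X (Set.Ico Y (2 * Y))).eq_empty_or_nonempty with h | ⟨v₀, hv₀⟩
  · rw [h]; simp; unfold cuspConst; positivity
  have hA2 := (key v₀ hv₀ 0 (by simpa using hY0.le)).1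
  set N := ⌊Y⌋₊ + 1
  have hcard : N * hfin.toFinset.card ≤ (box B).card := by
    rw [← Finset.card_range N, ← Finset.card_product]
    refine Finset.card_le_card_of_injOn
      (fun p => act (ModularGroup.T ^ (2 * p.1 : ℤ)) p.2) ?_ ?_
    · rintro ⟨n, v⟩ hp
      simp only [Finset.coe_product, Set.mem_prod, Finset.mem_coe, Finset.mem_range,
        Set.Finite.mem_toFinset] at hp
      refine (key v hp.2 n ?_).2
      exact (Nat.cast_le.2 (Nat.lt_succ_iff.1 hp.1)).trans (Nat.floor_le hY0.le)
    · rintro ⟨n, v⟩ hp ⟨m, u⟩ hq heq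
      simp only [Finset.coe_product, Set.mem_prod, Finset.mem_coe, Finset.mem_range,
        Set.Finite.mem_toFinset] at hp hq heq
      obtain ⟨h0, -, z, hz, -, hrel⟩ := hp.2
      obtain ⟨-, -, z', hz', -, hrel'⟩ := hq.2
      have h1 := hrel.act he (ModularGroup.T ^ (2 * n : ℤ))
      have h2 := hrel'.act he (ModularGroup.T ^ (2 * m : ℤ))
      rw [UpperHalfPlane.modular_T_zpow_smul] at h1 h2
      have hd : disc (toReal (act (ModularGroup.T ^ (2 * n : ℤ)) v)) ≠ 0 := by
        rw [disc_toReal, disc_act, ← disc_toReal]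
        exact disc_ne_zero_of_rel he (by simpa [toReal] using h0) hrel
      have h3 := congrArg UpperHalfPlane.re (h1.unique he hd (heq ▸ h2))
      rw [UpperHalfPlane.vadd_re, UpperHalfPlane.vadd_re] at h3
      have hnm : n = m := by
        have a1 := abs_le.1 hz.2
        have a2 := abs_le.1 hz'.2
        push_cast at h3
        have l1 : (n : ℝ) < m + 1 := by linarith
        have l2 : (m : ℝ) < n + 1 := by linarith
        have l1' : n < m + 1 := by exact_mod_cast l1
        have l2' : m < n + 1 := by exact_mod_cast l2
        omega
      subst hnm
      have := congrArg (act (ModularGroup.T ^ (2 * n : ℤ))⁻¹) heq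
      rw [act_inv_act, act_inv_act] at this
      rw [this]
  rw [Set.ncard_eq_toFinset_card _ hfin, le_div_iff₀ hY0]
  have hB := card_box (B := B) (by
    intro i; fin_cases i <;> simp [B] <;> positivity)
  have hN : Y ≤ N := by push_cast [N]; exact (Nat.lt_floor_add_one Y).le
  have hAY : 1 / 4 ≤ A * Y := by nlinarith
  have hAY2 : 1 / 8 ≤ A * Y ^ 2 := by nlinarith
  have hAY3 : 1 / 16 ≤ A * Y ^ 3 := by nlinarith [pow_pos hY0 2]
  calc (hfin.toFinset.card : ℝ) * Y ≤ N * hfin.toFinset.card := by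
        rw [mul_comm]; gcongr
    _ ≤ (box B).card := by exact_mod_cast hcard
    _ ≤ _ := hB
    _ ≤ (6 * A) * (24 * (A * Y)) * (108 * (A * Y ^ 2)) * (516 * (A * Y ^ 3)) := by
        rw [Fin.prod_univ_four]
        simp only [B, Matrix.cons_val]
        gcongr <;> linarith
    _ = cuspConst * X := by rw [← hAX, cuspConst]; ring

lemma cusp_union {X : ℝ} {J J' : Set ℝ} :
    cusp e X (J ∪ J') = cusp e X J ∪ cusp e X J' := by
  ext v
  constructor
  · rintro ⟨h0, hd, z, hz, hJ | hJ, h⟩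
    · exact Or.inl ⟨h0, hd, z, hz, hJ, h⟩
    · exact Or.inr ⟨h0, hd, z, hz, hJ, h⟩
  · rintro (⟨h0, hd, z, hz, hJ, h⟩ | ⟨h0, hd, z, hz, hJ, h⟩)
    · exact ⟨h0, hd, z, hz, Or.inl hJ, h⟩
    · exact ⟨h0, hd, z, hz, Or.inr hJ, h⟩

lemma cusp_slices (he : e = -1 ∨ e = 1 / 3) {X : ℝ} (hX : 0 < X) (n : ℕ) :
    ∀ Y : ℝ, 1 / 2 ≤ Y → (cusp e X (Set.Ico Y (2 ^ n * Y))).Finite ∧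
      ((cusp e X (Set.Ico Y (2 ^ n * Y))).ncard : ℝ) ≤ 2 * cuspConst * X / Y := by
  induction n with
  | zero =>
    intro Y hY
    have : cusp e X (Set.Ico Y (2 ^ 0 * Y)) = ∅ := by
      ext v; simp [cusp]
    rw [this]
    refine ⟨Set.finite_empty, ?_⟩
    simp only [Set.ncard_empty, Nat.cast_zero]
    unfold cuspConst
    have : 0 < Y := by linarith
    positivity
  | succ n ih =>
    intro Y hY
    have hY0 : 0 < Y := by linarith
    have h1 := cusp_slice he hX hY
    have h2 := ih (2 * Y) (by linarith)
    have hu : Set.Ico Y (2 ^ (n + 1) * Y) = Set.Ico Y (2 * Y) ∪ Set.Ico (2 * Y) (2 ^ n * (2 * Y)) := by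
      rw [Set.Ico_union_Ico_eq_Ico (by linarith) (by
        have : (1:ℝ) ≤ 2 ^ n := one_le_pow₀ (by norm_num)
        nlinarith), pow_succ, mul_assoc]
    rw [hu, cusp_union]
    refine ⟨h1.1.union h2.1, ?_⟩
    calc _ ≤ ((cusp e X (Set.Ico Y (2 * Y))).ncard : ℝ) +
          (cusp e X (Set.Ico (2 * Y) (2 ^ n * (2 * Y)))).ncard := by
          exact_mod_cast Set.ncard_union_le _ _
      _ ≤ cuspConst * X / Y + 2 * cuspConst * X / (2 * Y) := add_le_add h1.2 h2.2
      _ = _ := by field_simp; ring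

theorem cusp_count (he : e = -1 ∨ e = 1 / 3) {X T : ℝ} (hX : 0 < X) (hT : 1 / 2 ≤ T) :
    (cusp e X (Set.Ici T)).Finite ∧
      ((cusp e X (Set.Ici T)).ncard : ℝ) ≤ 2 * cuspConst * X / T := by
  have hT0 : 0 < T := by linarith
  obtain ⟨n, hn⟩ := pow_unbounded_of_one_lt ((27 / 4 * X + 1) / T) (one_lt_two (α := ℝ))
  rw [div_lt_iff₀ hT0] at hn
  have : cusp e X (Set.Ici T) = cusp e X (Set.Ico T (2 ^ n * T)) := by
    ext v
    constructor
    swap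
    · rintro ⟨h0, hd, z, hz, hJ, h⟩
      exact ⟨h0, hd, z, hz, hJ.1, h⟩
    rintro ⟨h0, hd, z, hz, hJ, h⟩
    refine ⟨h0, hd, z, hz, ⟨hJ, lt_of_not_ge fun hlt => ?_⟩, h⟩
    obtain ⟨r, s, hrs⟩ := h
    rw [← disc_toReal, hrs, abs_disc_Phi he] at hd
    have hd := (sizeOf_ge he _).trans_lt hd
    simp at hd
    have hr : r = (v 0 : ℝ) := (congrFun hrs 0).symm
    have hr2 : 1 ≤ r ^ 2 := by
      rw [hr, ← sq_abs]
      have : (1:ℝ) ≤ |(v 0 : ℝ)| := by exact_mod_cast Int.one_le_abs h0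
      nlinarith
    have h1 : 1 ≤ (r ^ 2 + s ^ 2) ^ 2 := one_le_pow₀ (by nlinarith [sq_nonneg s])
    have h2 : z.im ≤ z.im ^ 6 := le_self_pow₀ (by linarith) (by norm_num)
    have h3 : z.im ≤ z.im ^ 6 * (r ^ 2 + s ^ 2) ^ 2 := by nlinarith
    linarith
  rw [this]
  exact cusp_slices he hX n T hT

lemma half_le_im {z : ℍ} (hz : z ∈ ModularGroup.fd) : 1 / 2 ≤ z.im := by
  have := ModularGroup.three_le_four_mul_im_sq_of_mem_fd hz
  nlinarith [z.im_pos]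

end CubicForm

namespace CubicForm

open Matrix

section Local

variable {p : ℕ}

lemma sq_zero : (p : ZMod (p ^ 2)) ^ 2 = 0 := by
  have := ZMod.natCast_self (p ^ 2)
  push_cast at this
  exact this

variable (p) [hp : Fact p.Prime]

/-- Reduction from `ℤ/p²` to `ℤ/p`. -/
def red : ZMod (p ^ 2) →+* ZMod p := ZMod.castHom (dvd_pow_self p two_ne_zero) (ZMod p)

lemma red_intCast (n : ℤ) : red p n = n := map_intCast _ n

variable {p}

lemma red_eq_zero {x : ZMod (p ^ 2)} (h : red p x = 0) : ∃ k, x = p * k := by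
  have : NeZero (p ^ 2) := ⟨pow_ne_zero 2 hp.out.ne_zero⟩
  rw [← ZMod.natCast_zmod_val x, map_natCast, ZMod.natCast_eq_zero_iff] at h
  obtain ⟨k, hk⟩ := h
  exact ⟨k, by rw [← ZMod.natCast_zmod_val x, hk]; push_cast; rfl⟩

lemma mul_eq_zero_of_red {x y : ZMod (p ^ 2)} (hx : red p x = 0) (hy : red p y = 0) :
    x * y = 0 := by
  obtain ⟨k, rfl⟩ := red_eq_zero hx
  obtain ⟨l, rfl⟩ := red_eq_zero hy
  linear_combination k * l * sq_zero (p := p)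

variable (p) in
/-- Vectors modulo `p²` with a double root modulo `p` at infinity. -/
def condInf (u : Fin 4 → ZMod (p ^ 2)) : Prop := u 0 = 0 ∧ red p (u 1) = 0 ∧ red p (u 2) ≠ 0

variable (p) in
/-- Vectors modulo `p²` with a double root modulo `p` at `T`. -/
def condAt (T : ZMod (p ^ 2)) (u : Fin 4 → ZMod (p ^ 2)) : Prop :=
  subst 1 T 0 1 u 3 = 0 ∧ red p (subst 1 T 0 1 u 2) = 0 ∧ red p (subst 1 T 0 1 u 1) ≠ 0

variable (p) in
/-- Vectors modulo `p²` with vanishing Hessian modulo `p`. -/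
def condHess (u : Fin 4 → ZMod (p ^ 2)) : Prop :=
  red p (hessP u) = 0 ∧ red p (hessQ u) = 0 ∧ red p (hessR u) = 0

lemma condAt_congr {T T' : ZMod (p ^ 2)} (h : red p T = red p T') {u : Fin 4 → ZMod (p ^ 2)}
    (hu : condAt p T u) : condAt p T' u := by
  have hd : red p (T' - T) = 0 := by rw [map_sub, h, sub_self]
  obtain ⟨h3, h2, h1⟩ := hu
  have h2' : red p (subst 1 T' 0 1 u 2) = red p (subst 1 T 0 1 u 2) := by
    simp [subst, h]
  have h1' : red p (subst 1 T' 0 1 u 1) = red p (subst 1 T 0 1 u 1) := by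
    simp [subst, h]
  refine ⟨?_, h2'.trans h2, by rwa [h1']⟩
  have a1 := mul_eq_zero_of_red hd h2
  have a2 := mul_eq_zero_of_red hd hd
  rw [← h3]
  simp [subst] at a1 ⊢
  linear_combination 3 * a1 + (3 * u 1 + 3 * u 0 * T + u 0 * (T' - T)) * a2

/-- The reduction of an integral vector. -/
def toMod (m : ℕ) (v : Fin 4 → ℤ) : Fin 4 → ZMod m := fun i => (v i : ZMod m)

lemma condHess_iff {v : Fin 4 → ℤ} : condHess p (toMod (p ^ 2) v) ↔ Bad1 p v := by
  simp only [condHess, Bad1, ← ZMod.intCast_zmod_eq_zero_iff_dvd]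
  simp [toMod, hessP, hessQ, hessR]

lemma isUnit_of_red {x : ZMod (p ^ 2)} (hx : red p x ≠ 0) : IsUnit x := by
  have : NeZero (p ^ 2) := ⟨pow_ne_zero 2 hp.out.ne_zero⟩
  rw [← ZMod.natCast_zmod_val x, map_natCast, Ne, ZMod.natCast_eq_zero_iff] at hx
  rw [← ZMod.natCast_zmod_val x, ZMod.isUnit_iff_coprime]
  exact ((hp.out.coprime_iff_not_dvd.2 hx).symm).pow_right 2

lemma bad2_of_condInf {v : Fin 4 → ℤ} (h : condInf p (toMod (p ^ 2) v)) : Bad2 p v := by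
  obtain ⟨h0, h1, -⟩ := h
  refine ⟨1, ?_, ?_⟩
  · rw [act_one]
    have := (ZMod.intCast_zmod_eq_zero_iff_dvd _ _).1 h0
    exact_mod_cast this
  · rw [act_one]
    rw [toMod, red_intCast] at h1
    exact (ZMod.intCast_zmod_eq_zero_iff_dvd _ _).1 h1

lemma bad2_of_condAt {v : Fin 4 → ℤ} {T : ZMod (p ^ 2)} (h : condAt p T (toMod (p ^ 2) v)) :
    Bad2 p v := by
  obtain ⟨t, rfl⟩ := ZMod.intCast_surjective T
  obtain ⟨h3, h2, -⟩ := h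
  refine ⟨⟨!![0, 1; -1, t], by simp [det_fin_two]⟩, ?_, ?_⟩
  · have : act ⟨!![0, 1; -1, t], by simp [det_fin_two]⟩ v 0 = subst 1 t 0 1 v 3 := by
      simp [act, subst]
    rw [this]
    have := (ZMod.intCast_zmod_eq_zero_iff_dvd (subst 1 t 0 1 v 3) (p ^ 2)).1 (by
      rw [← h3]; simp [subst, toMod])
    exact_mod_cast this
  · have : act ⟨!![0, 1; -1, t], by simp [det_fin_two]⟩ v 1 = -subst 1 t 0 1 v 2 := by
      simp [act, subst]
      ring
    rw [this, dvd_neg]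
    refine (ZMod.intCast_zmod_eq_zero_iff_dvd (subst 1 t 0 1 v 2) p).1 ?_
    rw [← h2, ← red_intCast]; simp only [subst, toMod]; congr 1; simp

lemma cond_of_bad2 {v : Fin 4 → ℤ} (h : Bad2 p v) (h1 : ¬ Bad1 p v) :
    condInf p (toMod (p ^ 2) v) ∨ ∃ T, condAt p T (toMod (p ^ 2) v) := by
  obtain ⟨γ, hγ0, hγ1⟩ := h
  rw [← condHess_iff] at h1
  have hdet : γ 1 1 * γ 0 0 - (-γ 0 1) * (-γ 1 0) = 1 := by
    have := det_eq γ; linarith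
  have hγ0' : ((act γ v 0 : ℤ) : ZMod (p ^ 2)) = 0 := by
    rw [ZMod.intCast_zmod_eq_zero_iff_dvd]; exact_mod_cast hγ0
  have hγ1' : red p ((act γ v 1 : ℤ) : ZMod (p ^ 2)) = 0 := by
    rw [red_intCast, ZMod.intCast_zmod_eq_zero_iff_dvd]; exact_mod_cast hγ1
  have hdet' := congrArg (Int.cast : ℤ → ZMod (p ^ 2)) hdet
  set u := toMod (p ^ 2) v with hu
  simp [act, subst, -map_add, -map_mul] at hγ0' hγ1' hdet'
  simp only [show ∀ i, (v i : ZMod (p ^ 2)) = u i from fun i => rfl] at hγ0' hγ1'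
  generalize ((γ 1 1 : ℤ) : ZMod (p ^ 2)) = x at *
  generalize ((γ 0 0 : ℤ) : ZMod (p ^ 2)) = s at *
  generalize ((γ 1 0 : ℤ) : ZMod (p ^ 2)) = y at *
  generalize ((γ 0 1 : ℤ) : ZMod (p ^ 2)) = q at *
  have L1 : red p (u 0 * x ^ 2 - 2 * u 1 * x * y + u 2 * y ^ 2) = 0 := by
    refine Eq.trans (congrArg _ ?_) ((map_mul _ y _).trans (by rw [hγ1', mul_zero]))
    linear_combination s * hγ0' - (u 0 * x ^ 2 - 2 * u 1 * x * y + u 2 * y ^ 2) * hdet'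
  have L2 : red p (u 1 * x ^ 2 - 2 * u 2 * x * y + u 3 * y ^ 2) = 0 := by
    refine Eq.trans (congrArg _ ?_) ((map_mul _ x _).trans (by rw [hγ1', mul_zero]))
    linear_combination q * hγ0' - (u 1 * x ^ 2 - 2 * u 2 * x * y + u 3 * y ^ 2) * hdet'
  by_cases hy : red p y = 0
  · left
    have hxs : red p x * red p s = 1 := by
      rw [← map_mul, ← map_one (red p), ← hdet', map_sub, map_mul _ q, hy, mul_zero, sub_zero]
    have hx : red p x ≠ 0 := left_ne_zero_of_mul_eq_one hxs
    have hu0 : red p (u 0) = 0 := by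
      simpa [hy, hx] using L1
    have hu1 : red p (u 1) = 0 := by
      simpa [hy, hx] using L2
    have m1 := mul_eq_zero_of_red hu1 hy
    have m2 := mul_eq_zero_of_red hy hy
    refine ⟨?_, hu1, fun hu2 => h1 ?_⟩
    · have : u 0 * x ^ 3 = 0 := by
        linear_combination hγ0' + 3 * x ^ 2 * m1 + (u 3 * y - 3 * u 2 * x) * m2
      exact ((isUnit_of_red hx).pow 3).mul_left_eq_zero.1 this
    · simp [condHess, hessP, hessQ, hessR, hu0, hu1, hu2]
  · right
    obtain ⟨z, hz⟩ := (isUnit_of_red hy).exists_right_inv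
    have e3 : subst 1 (-(x * z)) 0 1 u 3 = 0 := by
      simp [subst]
      linear_combination (-z ^ 3) * hγ0' + (3 * x * z * u 2 * (y * z + 1) - 3 * x ^ 2 * z ^ 2 * u 1
        - u 3 * ((y * z) ^ 2 + y * z + 1)) * hz
    have e2 : red p (subst 1 (-(x * z)) 0 1 u 2) = 0 := by
      refine Eq.trans (congrArg _ ?_) ((map_mul _ (z ^ 2) _).trans (by rw [L1, mul_zero]))
      simp [subst]
      linear_combination (2 * u 1 * x * z - u 2 * (y * z + 1)) * hz
    refine ⟨-(x * z), e3, e2, fun e1 => h1 ?_⟩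
    have hP := hessP_subst 1 (-(x * z)) 0 1 u
    have hQ := hessQ_subst 1 (-(x * z)) 0 1 u
    have hR := hessR_subst 1 (-(x * z)) 0 1 u
    generalize subst 1 (-(x * z)) 0 1 u = w at *
    have hP' : red p (hessP u) = 0 := by
      rw [show hessP u = hessP w by rw [hP]; ring]
      simp [hessP, e1, e2]
    have hQ' : red p (hessQ u) = 0 := by
      rw [show hessQ u = hessQ w + 2 * (x * z) * hessP u by rw [hQ]; ring, map_add, map_mul, hP']
      simp [hessQ, e1, e3]
    refine ⟨hP', hQ', ?_⟩
    rw [show hessR u = hessR w - (x * z) ^ 2 * hessP u + (x * z) * hessQ u by rw [hR]; ring,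
      map_add, map_sub, map_mul, map_mul _ (x * z), hP', hQ']
    simp [hessR, e2, e3]

end Local

end CubicForm

namespace CubicForm

open Matrix Finset

section Local

lemma card_preimage_hom {A B : Type*} [AddGroup A] [AddGroup B] [Fintype A] [Fintype B]
    [DecidableEq B] (f : A →+ B) (hf : Function.Surjective f) (S : B → Prop) [DecidablePred S]
    [DecidablePred fun a => S (f a)] :
    #{a | S (f a)} * Fintype.card B = #{b | S b} * Fintype.card A := by
  have hc : ∀ b b', #{a | f a = b} = #{a | f a = b'} := fun b b' =>
    AddMonoidHom.card_fiber_eq_of_mem_range f (hf b) (hf b')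
  have h1 : ∀ b, Fintype.card A = Fintype.card B * #{a | f a = b} := fun b => by
    rw [← Finset.card_univ, Finset.card_eq_sum_card_fiberwise (f := f) (t := univ) (by simp),
      Finset.sum_congr rfl (fun b' _ => hc b' b), sum_const, smul_eq_mul, Finset.card_univ]
  have h2 : #{a | S (f a)} = #{b | S b} * #{a | f a = 0} := by
    rw [Finset.card_eq_sum_card_fiberwise (f := f) (t := {b | S b}) (by intro a; simp)]
    rw [← smul_eq_mul, ← sum_const]
    refine Finset.sum_congr rfl fun b hb => ?_
    rw [← hc b 0, filter_filter]
    congr 1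
    ext a
    simp only [mem_filter, mem_univ, true_and] at hb ⊢
    exact ⟨fun h => h.2, fun h => ⟨h ▸ hb, h⟩⟩
  rw [h2, h1 0]
  ring

variable {p : ℕ} [hp : Fact p.Prime]

lemma red_surjective : Function.Surjective (red p) := ZMod.ringHom_surjective _

open Classical in
lemma card_red_zero : #{x : ZMod (p ^ 2) | red p x = 0} = p := by
  have := card_preimage_hom (red p).toAddMonoidHom red_surjective (fun x => x = 0)
  rw [ZMod.card, ZMod.card, Finset.filter_eq' univ (0 : ZMod p), if_pos (mem_univ _),
    card_singleton, one_mul] at this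
  exact Nat.eq_of_mul_eq_mul_right hp.out.pos (this.trans (sq p))

open Classical in
lemma card_red_ne_zero : #{x : ZMod (p ^ 2) | red p x ≠ 0} = p * (p - 1) := by
  have h := Finset.card_filter_add_card_filter_not (s := univ)
    (fun x : ZMod (p ^ 2) => red p x = 0)
  rw [card_red_zero, Finset.card_univ, ZMod.card] at h
  rw [Nat.mul_sub, mul_one, ← sq]
  exact Nat.eq_sub_of_add_eq' h

open Classical in
lemma card_condInf : #{u | condInf p u} = p ^ 4 * (p - 1) := by
  have : (univ.filter fun u : Fin 4 → ZMod (p ^ 2) => condInf p u) = Fintype.piFinset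
      ![{0}, univ.filter fun x => red p x = 0, univ.filter fun x => red p x ≠ 0, univ] := by
    ext u
    simp only [mem_filter, mem_univ, true_and]
    simp [Fintype.mem_piFinset, Fin.forall_fin_succ, condInf]
  rw [this, Fintype.card_piFinset, Fin.prod_univ_four]
  simp [card_red_zero, card_red_ne_zero, ZMod.card]
  ring

open Classical in
lemma card_condAt (T : ZMod (p ^ 2)) : #{u | condAt p T u} = p ^ 4 * (p - 1) := by
  have : #{u | condAt p T u} = #{u : Fin 4 → ZMod (p ^ 2) | u 3 = 0 ∧ red p (u 2) = 0 ∧ red p (u 1) ≠ 0} := by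
    refine Finset.card_bij' (fun u _ => subst 1 T 0 1 u) (fun u _ => subst 1 (-T) 0 1 u) ?_ ?_ ?_ ?_
    · intro u hu
      rw [mem_filter] at hu ⊢
      exact ⟨mem_univ _, hu.2⟩
    · intro u hu
      rw [mem_filter] at hu ⊢
      simpa [condAt, subst_subst, subst_one] using hu
    · intro u hu
      simp [subst_subst, subst_one]
    · intro u hu
      simp [subst_subst, subst_one]
  rw [this]
  have : (univ.filter fun u : Fin 4 → ZMod (p ^ 2) => u 3 = 0 ∧ red p (u 2) = 0 ∧ red p (u 1) ≠ 0) =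
      Fintype.piFinset ![univ, univ.filter fun x => red p x ≠ 0, univ.filter fun x => red p x = 0, {0}] := by
    ext u
    simp [Fintype.mem_piFinset, Fin.forall_fin_succ]
    tauto
  rw [this, Fintype.card_piFinset, Fin.prod_univ_four]
  simp [card_red_zero, card_red_ne_zero, ZMod.card]
  ring

open Classical in
lemma card_hess_field :
    #{u : Fin 4 → ZMod p | hessP u = 0 ∧ hessQ u = 0 ∧ hessR u = 0} = p ^ 2 := by
  have : (univ.filter fun u : Fin 4 → ZMod p => hessP u = 0 ∧ hessQ u = 0 ∧ hessR u = 0) =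
      univ.image fun x : ZMod p × ZMod p => if x.1 = 0 then ![0, 0, 0, x.2] else
        ![x.1, x.2, x.2 ^ 2 / x.1, x.2 ^ 3 / x.1 ^ 2] := by
    ext u
    simp only [mem_filter, mem_univ, true_and, mem_image]
    simp only [hessP, hessQ, hessR]
    constructor
    · rintro ⟨hP, hQ, hR⟩
      by_cases h0 : u 0 = 0
      · have h1 : u 1 = 0 := by simpa [h0] using hP
        have h2 : u 2 = 0 := by simpa [h1] using hR
        refine ⟨(0, u 3), ?_⟩
        rw [if_pos rfl]
        ext i
        fin_cases i <;> simp [h0, h1, h2]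
      · refine ⟨(u 0, u 1), ?_⟩
        rw [if_neg h0]
        have h2 : u 1 ^ 2 / u 0 = u 2 := by field_simp; linear_combination hP
        have h3 : u 1 ^ 3 / u 0 ^ 2 = u 3 := by
          field_simp; linear_combination u 1 * hP + u 0 * hQ
        ext i
        fin_cases i <;> simp [h2, h3]
    · rintro ⟨⟨a, b⟩, rfl⟩
      split_ifs with h
      · simp
      · simp at h
        simp
        refine ⟨?_, ?_, ?_⟩ <;> field_simp <;> ring
  rw [this, Finset.card_image_of_injective, Finset.card_univ, Fintype.card_prod, ZMod.card, sq]
  rintro ⟨a, b⟩ ⟨c, d⟩ h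
  simp only at h
  have e0 := congrFun h 0
  have e1 := congrFun h 1
  have e3 := congrFun h 3
  split_ifs at e0 e1 e3 with h1 h2 h2 <;> simp_all

open Classical in
lemma card_condHess : #{u | condHess p u} = p ^ 6 := by
  let f : (Fin 4 → ZMod (p ^ 2)) →+ (Fin 4 → ZMod p) := (red p).toAddMonoidHom.compLeft (Fin 4)
  have hf : Function.Surjective f := red_surjective.comp_left
  have := card_preimage_hom f hf (fun u => hessP u = 0 ∧ hessQ u = 0 ∧ hessR u = 0)
  rw [card_hess_field] at this
  simp only [Fintype.card_fun, ZMod.card, Fintype.card_fin] at this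
  have e : #{u | condHess p u} = #{a | hessP (f a) = 0 ∧ hessQ (f a) = 0 ∧ hessR (f a) = 0} := by
    congr 1
    ext u
    simp [condHess, hessP, hessQ, hessR, f]
  rw [e]
  refine Nat.eq_of_mul_eq_mul_right (pow_pos hp.out.pos 4) (this.trans (by ring))

variable (p) in
/-- Vectors modulo `p²` whose lifts are good at `p`. -/
def goodMod : Set (Fin 4 → ZMod (p ^ 2)) :=
  {u | ¬ condHess p u ∧ ¬ condInf p u ∧ ∀ T, ¬ condAt p T u}

lemma mem_goodMod {v : Fin 4 → ℤ} : toMod (p ^ 2) v ∈ goodMod p ↔ ¬ Bad1 p v ∧ ¬ Bad2 p v := by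
  simp only [goodMod, Set.mem_ofPred_eq, condHess_iff]
  refine and_congr_right fun h1 => ⟨fun ⟨h, h'⟩ hb => ?_, fun h => ⟨fun h' => h ?_, fun T h' => h ?_⟩⟩
  · rcases cond_of_bad2 hb h1 with h2 | ⟨T, h2⟩
    exacts [h h2, h' T h2]
  · exact bad2_of_condInf h'
  · exact bad2_of_condAt h'

lemma not_condHess_of_condInf {u : Fin 4 → ZMod (p ^ 2)} (h : condInf p u) : ¬ condHess p u := by
  rintro ⟨-, -, hR⟩
  obtain ⟨-, h1, h2⟩ := h
  simp [hessR, h1] at hR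
  exact h2 hR

lemma not_condHess_of_condAt {T} {u : Fin 4 → ZMod (p ^ 2)} (h : condAt p T u) :
    ¬ condHess p u := by
  rintro ⟨hP, -, -⟩
  obtain ⟨-, h2, h1⟩ := h
  have := hessP_subst 1 T 0 1 u
  rw [show hessP u = hessP (subst 1 T 0 1 u) by rw [this]; ring] at hP
  simp only [hessP, map_sub, map_mul, map_pow, h2] at hP
  simp at hP
  exact h1 hP

lemma not_condInf_of_condAt {T} {u : Fin 4 → ZMod (p ^ 2)} (h : condAt p T u) :
    ¬ condInf p u := by
  rintro ⟨h0, h1, -⟩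
  apply h.2.2
  simp [subst, h0, h1]

lemma red_eq_of_condAt {T T'} {u : Fin 4 → ZMod (p ^ 2)} (h : condAt p T u)
    (h' : condAt p T' u) : red p T = red p T' := by
  by_contra hne
  have hd : red p (T' - T) ≠ 0 := by rw [map_sub]; exact sub_ne_zero.2 (Ne.symm hne)
  have e : subst 1 T' 0 1 u = subst 1 (T' - T) 0 1 (subst 1 T 0 1 u) := by
    simp [subst_subst]
  rw [condAt, e] at h'
  obtain ⟨h3, h2, h1⟩ := h
  generalize subst 1 T 0 1 u = w at *
  generalize T' - T = t at *
  obtain ⟨k3, k2, -⟩ := h'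
  replace k3 := congrArg (red p) k3
  have e2 : red p 2 = 2 := map_ofNat _ 2
  have e3 : red p 3 = 3 := map_ofNat _ 3
  simp [subst, h3, h2, e2, e3] at k2 k3
  have : red p (w 1) * red p t ^ 2 = 0 := by linear_combination k3 - red p t * k2
  simp [h1, hd] at this

open Classical in
theorem ncard_goodMod : ((goodMod p).ncard : ℝ) = (p : ℝ) ^ 8 * (1 - 1 / (p : ℝ) ^ 2) ^ 2 := by
  have hp0 : (p : ℝ) ≠ 0 := by exact_mod_cast hp.out.ne_zero
  have hval : ∀ T : ZMod (p ^ 2), red p (((red p T).val : ℕ) : ZMod (p ^ 2)) = red p T := by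
    intro T; simp
  have hU : #{u | ∃ T, condAt p T u} = p * (p ^ 4 * (p - 1)) := by
    have : (univ.filter fun u : Fin 4 → ZMod (p ^ 2) => ∃ T, condAt p T u) = (univ : Finset (ZMod p)).biUnion
        fun t => univ.filter fun u => condAt p (t.val : ZMod (p ^ 2)) u := by
      ext u
      simp only [mem_filter, mem_univ, true_and, mem_biUnion]
      exact ⟨fun ⟨T, h⟩ => ⟨red p T, condAt_congr (hval T).symm h⟩, fun ⟨t, h⟩ => ⟨_, h⟩⟩
    rw [this, Finset.card_biUnion, Finset.sum_congr rfl (fun t _ => card_condAt _), sum_const,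
      Finset.card_univ, ZMod.card, smul_eq_mul]
    intro t _ t' _ hne
    rw [Function.onFun, Finset.disjoint_left]
    intro u h h'
    simp only [mem_filter, mem_univ, true_and] at h h'
    have := red_eq_of_condAt h h'
    simp at this
    exact hne this
  have hcompl : (goodMod p)ᶜ = ((univ.filter (condHess p) ∪ univ.filter (condInf p) ∪
      univ.filter fun u => ∃ T, condAt p T u : Finset (Fin 4 → ZMod (p ^ 2))) : Set _) := by
    ext u
    simp [goodMod]
    tauto
  have h1 := Set.ncard_add_ncard_compl (goodMod p)
  rw [hcompl, Set.ncard_coe_finset, card_union_of_disjoint, card_union_of_disjoint, card_condHess,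
    card_condInf, hU, Nat.card_eq_fintype_card] at h1
  · simp only [Fintype.card_fun, ZMod.card, Fintype.card_fin] at h1
    have h2 := congrArg (Nat.cast : ℕ → ℝ) h1
    push_cast [Nat.cast_sub hp.out.one_le] at h2
    have : ((goodMod p).ncard : ℝ) = (p : ℝ) ^ 8 - 2 * p ^ 6 + p ^ 4 := by linear_combination h2
    rw [this]
    field_simp
    ring
  · rw [Finset.disjoint_left]
    intro u h h'
    simp only [mem_filter, mem_univ, true_and] at h h'
    exact not_condHess_of_condInf h' h
  · rw [Finset.disjoint_left]
    intro u h h'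
    simp only [mem_filter, mem_univ, true_and, mem_union] at h h'
    obtain ⟨T, h'⟩ := h'
    exact h.elim (not_condHess_of_condAt h') (not_condInf_of_condAt h')

end Local

end CubicForm

namespace CubicForm

open Filter Topology MeasureTheory

section Crt

variable {n : ℕ}

lemma exists_crt {ι : Type*} [Fintype ι] (a : ι → ℕ)
    (hc : Pairwise (Function.onFun Nat.Coprime a)) (S : ∀ i, Set (Fin n → ZMod (a i))) :
    ∃ S' : Set (Fin n → ZMod (∏ i, a i)),
      (∀ v : Fin n → ℤ, (fun j => (v j : ZMod (∏ i, a i))) ∈ S' ↔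
        ∀ i, (fun j => (v j : ZMod (a i))) ∈ S i) ∧ S'.ncard = ∏ i, (S i).ncard := by
  let E := ZMod.prodEquivPi a hc
  let F : (Fin n → ZMod (∏ i, a i)) ≃ (∀ i, Fin n → ZMod (a i)) :=
    (Equiv.arrowCongr (Equiv.refl _) E.toEquiv).trans (Equiv.piComm _)
  refine ⟨F ⁻¹' Set.univ.pi S, fun v => ?_, ?_⟩
  · simp [F, Set.mem_pi, Equiv.piComm, Equiv.arrowCongr, Function.comp_def]
    rfl
  · rw [Set.ncard_preimage_of_injective_subset_range F.injective (by simp),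
      ← Nat.card_coe_set_eq, Nat.card_congr (Equiv.Set.univPi S), Nat.card_pi]
    simp

theorem tendsto_count_local {R : Set (Fin n → ℝ)} (hb : Bornology.IsBounded R)
    (hR : MeasurableSet R) (hf : volume (frontier R) = 0) (P : Finset ℕ) (a : ℕ → ℕ)
    (ha : ∀ p ∈ P, a p ≠ 0) (hc : (P : Set ℕ).Pairwise (Function.onFun Nat.Coprime a))
    (S : ∀ p, Set (Fin n → ZMod (a p))) :
    Tendsto (fun l : ℝ => ({v : Fin n → ℤ | (∀ p ∈ P, (fun j => (v j : ZMod (a p))) ∈ S p) ∧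
      (fun i => (v i : ℝ) / l) ∈ R}.ncard : ℝ) / l ^ n) atTop
      (𝓝 ((∏ p ∈ P, ((S p).ncard : ℝ) / (a p : ℝ) ^ n) * volume.real R)) := by
  obtain ⟨S', hS', hcard⟩ := exists_crt (fun p : P => a p)
    (fun p q h => hc p.2 q.2 (fun h' => h (Subtype.ext h'))) (fun p => S p)
  have : NeZero (∏ p : P, a p) := ⟨Finset.prod_ne_zero_iff.2 fun p _ => ha p p.2⟩
  have := tendsto_count_periodic hb hR hf S'
  simp only [hS', Fintype.card_fin, hcard] at this
  convert this using 4
  · simp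
  · push_cast
    rw [← Finset.prod_pow, ← Finset.prod_div_distrib, ← Finset.prod_coe_sort]

/-- The partial product of `1 - p⁻²`. -/
noncomputable def kap (M : ℕ) : ℝ := ∏ p ∈ (Finset.range (M + 1)).filter Nat.Prime, (1 - 1 / (p : ℝ) ^ 2)

theorem tendsto_count_good {R : Set (Fin 4 → ℝ)} (hb : Bornology.IsBounded R)
    (hR : MeasurableSet R) (hf : volume (frontier R) = 0) (M : ℕ) :
    Tendsto (fun l : ℝ => ({v : Fin 4 → ℤ | (∀ p : ℕ, p.Prime → p ≤ M → ¬ Bad1 p v ∧ ¬ Bad2 p v) ∧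
      (fun i => (v i : ℝ) / l) ∈ R}.ncard : ℝ) / l ^ 4) atTop
      (𝓝 (kap M ^ 2 * volume.real R)) := by
  classical
  let P := (Finset.range (M + 1)).filter Nat.Prime
  let S : ∀ p : ℕ, Set (Fin 4 → ZMod (p ^ 2)) := fun p =>
    if h : p.Prime then haveI := Fact.mk h; goodMod p else ∅
  have key := tendsto_count_local hb hR hf P (fun p => p ^ 2)
    (fun p hp => pow_ne_zero 2 (Finset.mem_filter.1 hp).2.ne_zero)
    (fun p hp q hq hne => (Nat.coprime_pow_left_iff two_pos _ _).2
      ((Nat.coprime_pow_right_iff two_pos _ _).2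
        ((Nat.coprime_primes (Finset.mem_filter.1 hp).2 (Finset.mem_filter.1 hq).2).2 hne))) S
  convert key using 4
  · congr 1
    ext v
    simp only [Set.mem_ofPred_eq]
    refine and_congr_left fun _ => ?_
    simp only [P, Finset.mem_filter, Finset.mem_range]
    constructor
    · rintro h p ⟨hpM, hp⟩
      have := Fact.mk hp
      simp only [S, dif_pos hp]
      exact mem_goodMod.2 (h p hp (by omega))
    · intro h p hp hpM
      have := Fact.mk hp
      have := h p ⟨by omega, hp⟩
      simp only [S, dif_pos hp] at this
      exact mem_goodMod.1 this
  · rw [kap, ← Finset.prod_pow]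
    refine Finset.prod_congr rfl fun p hp => ?_
    have hp := (Finset.mem_filter.1 hp).2
    have := Fact.mk hp
    have hp0 : (p : ℝ) ≠ 0 := by exact_mod_cast hp.ne_zero
    simp only [S, dif_pos hp]
    rw [ncard_goodMod]
    push_cast
    field_simp

theorem kap_pos (M : ℕ) : 0 < kap M := by
  refine Finset.prod_pos fun p hp => ?_
  have hp := (Finset.mem_filter.1 hp).2.two_le
  have : (2 : ℝ) ≤ p := by exact_mod_cast hp
  have : 1 / (p : ℝ) ^ 2 < 1 := by
    rw [div_lt_one (by positivity)]; nlinarith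
  linarith

theorem tendsto_kap : Tendsto kap atTop (𝓝 (6 / Real.pi ^ 2)) := by
  have h := riemannZeta_eulerProduct (s := 2) (by norm_num)
  rw [riemannZeta_two] at h
  have h' := (tendsto_add_atTop_iff_nat 1).2 (h.inv₀ (by
    simp [Real.pi_ne_zero]))
  have h2 := (Complex.continuous_re.tendsto _).comp h'
  convert h2 using 1
  · ext M
    have : (∏ p ∈ (M + 1).primesBelow, (1 - (p : ℂ) ^ (-2 : ℂ))⁻¹)⁻¹ = ((kap M : ℝ) : ℂ) := by
      rw [kap, Complex.ofReal_prod, ← Finset.prod_inv_distrib]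
      refine Finset.prod_congr rfl fun p hp => ?_
      rw [inv_inv, Complex.cpow_neg]
      norm_num
    simp only [Function.comp_apply]
    rw [this, Complex.ofReal_re]
  · rw [show ((Real.pi : ℂ) ^ 2 / 6)⁻¹ = ((6 / Real.pi ^ 2 : ℝ) : ℂ) by push_cast; rw [inv_div],
      Complex.ofReal_re]

end Crt

end CubicForm

namespace CubicForm

open Finset

section Tail1

lemma card_modEq_le (N : ℕ) {p : ℕ} (hp : 0 < p) (r : ZMod p) :
    (#((Icc (-N : ℤ) N).filter fun x : ℤ => (x : ZMod p) = r) : ℝ) ≤ (2 * N + 1) / p + 1 := by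
  obtain ⟨r, rfl⟩ := ZMod.intCast_surjective r
  have hI : Icc (-N : ℤ) N = Ioc (-N - 1 : ℤ) N := by ext x; rw [mem_Icc, mem_Ioc]; omega
  have hpZ : (0 : ℤ) < p := by exact_mod_cast hp
  have hpQ : (0 : ℚ) < p := by exact_mod_cast hp
  have h := Int.Ioc_filter_modEq_card (-N - 1 : ℤ) N hpZ r
  simp only [← ZMod.intCast_eq_intCast_iff] at h
  rw [hI]
  suffices (#((Ioc (-N - 1 : ℤ) N).filter fun x : ℤ => (x : ZMod p) = r) : ℚ) ≤
      (2 * N + 1) / p + 1 by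
    have := (Rat.cast_le (K := ℝ)).2 this
    push_cast at this
    exact this
  have h' := congrArg (Int.cast : ℤ → ℚ) h
  rw [Int.cast_natCast] at h'
  rw [h', Int.cast_max]
  refine max_le ?_ (by simp; positivity)
  push_cast
  have h1 := Int.floor_le (((N : ℚ) - r) / p : ℚ)
  have h2 := Int.lt_floor_add_one ((-N - 1 - r) / p : ℚ)
  have : (2 * N + 1 : ℚ) / p = ((N : ℚ) - r) / p - (-N - 1 - r) / p := by ring
  rw [this]
  linarith

/-- The integral points of a cube. -/
noncomputable def cube (N : ℕ) : Finset (Fin 4 → ℤ) := Fintype.piFinset fun _ => Icc (-N : ℤ) N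

lemma mem_cube {N : ℕ} {v : Fin 4 → ℤ} : v ∈ cube N ↔ ∀ i, -(N : ℤ) ≤ v i ∧ v i ≤ N := by
  simp [cube]

open Classical in
lemma card_bad1_small {N p : ℕ} (hp : p.Prime) (hpN : p ≤ N) :
    (#((cube N).filter (Bad1 p)) : ℝ) ≤ 256 * N ^ 4 * ((p : ℝ) ^ 2)⁻¹ := by
  have := Fact.mk hp
  have hp0 : (0 : ℝ) < p := by exact_mod_cast hp.pos
  let H := univ.filter fun u : Fin 4 → ZMod p => hessP u = 0 ∧ hessQ u = 0 ∧ hessR u = 0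
  have hmap : ∀ v ∈ (cube N).filter (Bad1 p), toMod p v ∈ H := by
    intro v hv
    obtain ⟨hP, hQ, hR⟩ := (mem_filter.1 hv).2
    simp only [← ZMod.intCast_zmod_eq_zero_iff_dvd] at hP hQ hR
    simp only [H, mem_filter, mem_univ, true_and, toMod]
    simp only [hessP, hessQ, hessR] at hP hQ hR ⊢
    push_cast at hP hQ hR
    exact ⟨hP, hQ, hR⟩
  rw [Finset.card_eq_sum_card_fiberwise (f := toMod p) hmap]
  push_cast
  have hfib : ∀ u ∈ H, (#(((cube N).filter (Bad1 p)).filter fun v => toMod p v = u) : ℝ) ≤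
      (4 * N / p) ^ 4 := by
    intro u _
    have hsub : (((cube N).filter (Bad1 p)).filter fun v => toMod p v = u) ⊆
        Fintype.piFinset fun i => (Icc (-N : ℤ) N).filter fun x : ℤ => (x : ZMod p) = u i := by
      intro v hv
      simp only [mem_filter, Fintype.mem_piFinset, mem_cube, mem_Icc] at hv ⊢
      exact fun i => ⟨hv.1.1 i, congrFun hv.2 i⟩
    refine (Nat.cast_le.2 (card_le_card hsub)).trans ?_
    rw [Fintype.card_piFinset]
    push_cast
    refine (prod_le_prod (fun _ _ => by positivity) (fun i _ => card_modEq_le N hp.pos (u i))).trans ?_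
    rw [prod_const, card_univ, Fintype.card_fin]
    gcongr
    rw [div_add_one hp0.ne']
    gcongr
    have : (p : ℝ) ≤ N := by exact_mod_cast hpN
    have : (2 : ℝ) ≤ p := by exact_mod_cast hp.two_le
    linarith
  refine (sum_le_sum hfib).trans ?_
  rw [sum_const, nsmul_eq_mul, show #H = p ^ 2 from card_hess_field]
  push_cast
  refine le_of_eq ?_
  field_simp
  ring

open Classical in
lemma card_singular (N : ℕ) :
    #((cube N).filter fun v => v 0 ≠ 0 ∧ hessP v = 0) ≤ (2 * N + 1) ^ 3 := by
  have hcard : #(Icc (-N : ℤ) N) = 2 * N + 1 := by simp; omega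
  calc _ ≤ #(Icc (-N : ℤ) N ×ˢ Icc (-N : ℤ) N ×ˢ Icc (-N : ℤ) N) := by
        refine card_le_card_of_injOn (fun v => (v 0, v 1, v 3)) ?_ ?_
        · intro v hv
          have := mem_cube.1 (mem_filter.1 hv).1
          simp [this]
        · intro v hv w hw h
          simp only [Prod.mk.injEq] at h
          obtain ⟨h0, h1, h3⟩ := h
          have hv := (mem_filter.1 hv).2
          have hw := (mem_filter.1 hw).2
          have h2 : v 2 = w 2 := by
            have e1 := hv.2
            have e2 := hw.2
            simp only [hessP] at e1 e2
            rw [← h0, ← h1] at e2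
            exact mul_left_cancel₀ hv.1 (by linarith)
          ext i
          fin_cases i <;> assumption
    _ = _ := by rw [card_product, card_product, hcard]; ring

lemma card_large_primes {N : ℕ} {n : ℤ} (hn : n ≠ 0) (h : |n| ≤ 2 * N ^ 2) :
    #(n.natAbs.primeFactors.filter fun p => N < p) ≤ 2 := by
  by_contra! hc
  set S := n.natAbs.primeFactors.filter fun p => N < p
  have h1 : (N + 1) ^ #S ≤ ∏ p ∈ S, p := by
    rw [← prod_const]
    exact prod_le_prod' fun p hp => (mem_filter.1 hp).2
  have h2 : ∏ p ∈ S, p ∣ n.natAbs :=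
    (prod_dvd_prod_of_subset _ _ _ (filter_subset _ _)).trans (Nat.prod_primeFactors_dvd _)
  have h3 := Nat.le_of_dvd (Int.natAbs_pos.2 hn) h2
  have h4 : n.natAbs ≤ 2 * N ^ 2 := by
    zify; exact h
  have h5 : (N + 1) ^ 3 ≤ (N + 1) ^ #S := Nat.pow_le_pow_right (by omega) hc
  have h6 := h5.trans (h1.trans (h3.trans h4))
  ring_nf at h6
  have := Nat.zero_le (N ^ 3)
  omega

open Classical in
lemma card_bad1_large (N : ℕ) :
    #((cube N).filter fun v => v 0 ≠ 0 ∧ hessP v ≠ 0 ∧ ∃ p : ℕ, p.Prime ∧ N < p ∧ Bad1 p v) ≤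
      6 * (2 * N + 1) ^ 3 := by
  have hcard : #(Icc (-N : ℤ) N) = 2 * N + 1 := by simp; omega
  set S := (cube N).filter fun v => v 0 ≠ 0 ∧ hessP v ≠ 0 ∧ ∃ p : ℕ, p.Prime ∧ N < p ∧ Bad1 p v
  let f : (Fin 4 → ℤ) → ℤ × ℤ × ℤ := fun v => (v 0, v 1, v 2)
  have himage : #(S.image f) ≤ (2 * N + 1) ^ 3 := by
    calc _ ≤ #(Icc (-N : ℤ) N ×ˢ Icc (-N : ℤ) N ×ˢ Icc (-N : ℤ) N) := by
          refine card_le_card (image_subset_iff.2 fun v hv => ?_)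
          have := mem_cube.1 (mem_filter.1 hv).1
          simp [f, this]
      _ = _ := by rw [card_product, card_product, hcard]; ring
  refine (card_le_mul_card_image (f := f) S 6 ?_).trans (Nat.mul_le_mul_left 6 himage)
  intro b hb
  obtain ⟨w, hw, rfl⟩ := mem_image.1 hb
  have hw' := (mem_filter.1 hw).2
  have hwc := mem_cube.1 (mem_filter.1 hw).1
  let D : ℕ → Finset ℤ := fun p => (Icc (-N : ℤ) N).filter fun d => (p : ℤ) ∣ w 1 * w 2 - w 0 * d
  let Q := (hessP w).natAbs.primeFactors.filter fun p => N < p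
  have hQ : #Q ≤ 2 := by
    refine card_large_primes hw'.2.1 ?_
    have h1 : |w 1| ≤ N := abs_le.2 (hwc 1)
    have h0 : |w 0| ≤ N := abs_le.2 (hwc 0)
    have h2 : |w 2| ≤ N := abs_le.2 (hwc 2)
    calc |hessP w| ≤ |w 1 ^ 2| + |w 0 * w 2| := by rw [hessP]; exact abs_sub _ _
      _ ≤ (N : ℤ) ^ 2 + N * N := by rw [abs_pow, abs_mul]; gcongr
      _ = _ := by ring
  have hD : ∀ p ∈ Q, #(D p) ≤ 3 := by
    intro p hp
    obtain ⟨hp, hpN⟩ := mem_filter.1 hp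
    have hpp := Nat.prime_of_mem_primeFactors hp
    rcases (D p).eq_empty_or_nonempty with he | ⟨d, hd⟩
    · simp [he]
    have hd := (mem_filter.1 hd).2
    have hsub : D p ⊆ (Icc (-N : ℤ) N).filter fun x : ℤ => (x : ZMod p) = (d : ZMod p) := by
      intro x hx
      obtain ⟨hx1, hx2⟩ := mem_filter.1 hx
      refine mem_filter.2 ⟨hx1, ?_⟩
      rw [← sub_eq_zero, ← Int.cast_sub, ZMod.intCast_zmod_eq_zero_iff_dvd]
      have h1 : (p : ℤ) ∣ w 0 * (x - d) := by
        have := dvd_sub hd hx2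
        ring_nf at this ⊢
        exact this
      refine ((Nat.prime_iff_prime_int.1 hpp).dvd_or_dvd h1).resolve_left fun h => ?_
      have := Int.le_of_dvd (abs_pos.2 hw'.1) ((dvd_abs _ _).2 h)
      have := abs_le.2 (hwc 0)
      omega
    refine (card_le_card hsub).trans ?_
    have h1 := card_modEq_le N hpp.pos (d : ZMod p)
    have hp0 : (0 : ℝ) < p := by exact_mod_cast hpp.pos
    have h2 : ((2 * N + 1) / p + 1 : ℝ) ≤ 3 := by
      have : (N : ℝ) + 1 ≤ p := by exact_mod_cast hpN
      have : ((2 * N + 1) / p : ℝ) ≤ 2 := by rw [div_le_iff₀ hp0]; linarith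
      linarith
    exact_mod_cast h1.trans h2
  calc #(S.filter fun a => f a = f w) ≤ #(Q.biUnion D) := by
        refine card_le_card_of_injOn (fun v => v 3) ?_ ?_
        · intro v hv
          obtain ⟨hv, hvf⟩ := mem_filter.1 hv
          simp only [f, Prod.mk.injEq] at hvf
          obtain ⟨h0, h1, h2⟩ := hvf
          obtain ⟨hv, -, hP, p, hp, hpN, hb⟩ := mem_filter.1 hv
          have eP : hessP v = hessP w := by simp only [hessP, h0, h1, h2]
          simp only [coe_biUnion, Set.mem_iUnion, mem_coe]
          refine ⟨p, mem_filter.2 ⟨Nat.mem_primeFactors.2 ⟨hp, ?_, ?_⟩, hpN⟩, mem_filter.2 ⟨?_, ?_⟩⟩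
          · rw [← eP]; exact Int.natCast_dvd.1 hb.1
          · exact Int.natAbs_ne_zero.2 (eP ▸ hP)
          · exact mem_Icc.2 (mem_cube.1 hv 3)
          · have := hb.2.1
            rwa [hessQ, h0, h1, h2] at this
        · intro v hv v' hv' h
          have e1 := (mem_filter.1 hv).2
          have e2 := (mem_filter.1 hv').2
          have e := e1.trans e2.symm
          simp only [f, Prod.mk.injEq] at e
          ext i
          fin_cases i
          exacts [e.1, e.2.1, e.2.2, h]
    _ ≤ ∑ p ∈ Q, #(D p) := card_biUnion_le
    _ ≤ #Q * 3 := sum_le_card_nsmul _ _ _ hD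
    _ ≤ 6 := by omega

open Classical in
theorem card_bad1_tail {N M : ℕ} (hM : M ≠ 0) (hN : N ≠ 0) :
    (#((cube N).filter fun v => v 0 ≠ 0 ∧ ∃ p : ℕ, p.Prime ∧ M < p ∧ Bad1 p v) : ℝ) ≤
      256 * N ^ 4 / M + 189 * N ^ 3 := by
  let A := ((Ioc M N).filter Nat.Prime).biUnion fun p => (cube N).filter (Bad1 p)
  let B := (cube N).filter fun v => v 0 ≠ 0 ∧ hessP v = 0
  let C := (cube N).filter fun v => v 0 ≠ 0 ∧ hessP v ≠ 0 ∧ ∃ p : ℕ, p.Prime ∧ N < p ∧ Bad1 p v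
  have hsub : ((cube N).filter fun v => v 0 ≠ 0 ∧ ∃ p : ℕ, p.Prime ∧ M < p ∧ Bad1 p v) ⊆
      A ∪ (B ∪ C) := by
    intro v hv
    obtain ⟨hv, h0, p, hp, hpM, hb⟩ := mem_filter.1 hv
    by_cases hpN : p ≤ N
    · refine mem_union_left _ (mem_biUnion.2 ⟨p, ?_, mem_filter.2 ⟨hv, hb⟩⟩)
      exact mem_filter.2 ⟨mem_Ioc.2 ⟨hpM, hpN⟩, hp⟩
    · refine mem_union_right _ ?_
      by_cases hP : hessP v = 0
      · exact mem_union_left _ (mem_filter.2 ⟨hv, h0, hP⟩)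
      · exact mem_union_right _ (mem_filter.2 ⟨hv, h0, hP, p, hp, by omega, hb⟩)
  have hA : (#A : ℝ) ≤ 256 * N ^ 4 / M := by
    calc (#A : ℝ) ≤ ∑ p ∈ (Ioc M N).filter Nat.Prime, (#((cube N).filter (Bad1 p)) : ℝ) := by
          exact_mod_cast card_biUnion_le
      _ ≤ ∑ p ∈ (Ioc M N).filter Nat.Prime, 256 * N ^ 4 * ((p : ℝ) ^ 2)⁻¹ :=
          sum_le_sum fun p hp => card_bad1_small (mem_filter.1 hp).2
            (mem_Ioc.1 (mem_filter.1 hp).1).2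
      _ ≤ ∑ p ∈ Ioc M N, 256 * N ^ 4 * ((p : ℝ) ^ 2)⁻¹ :=
          sum_le_sum_of_subset_of_nonneg (filter_subset _ _) fun _ _ _ => by positivity
      _ = 256 * N ^ 4 * ∑ p ∈ Ioc M N, ((p : ℝ) ^ 2)⁻¹ := by rw [mul_sum]
      _ ≤ 256 * N ^ 4 * (M : ℝ)⁻¹ := by
          gcongr
          rcases le_or_gt M N with h | h
          · refine (sum_Ioc_inv_sq_le_sub hM h).trans ?_
            have : (0 : ℝ) ≤ (N : ℝ)⁻¹ := by positivity
            linarith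
          · rw [Ioc_eq_empty (by omega)]; simp
      _ = _ := by rw [div_eq_mul_inv]
  have hBC : (#(B ∪ C) : ℝ) ≤ 189 * N ^ 3 := by
    have h1 : #(B ∪ C) ≤ 7 * (2 * N + 1) ^ 3 :=
      (card_union_le _ _).trans ((add_le_add (card_singular N) (card_bad1_large N)).trans
        (by ring_nf; rfl))
    have h2 : (2 * N + 1) ^ 3 ≤ (3 * N) ^ 3 := Nat.pow_le_pow_left (by omega) 3
    have h3 : #(B ∪ C) ≤ 189 * N ^ 3 := by
      rw [mul_pow] at h2
      omega
    exact_mod_cast h3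
  calc _ ≤ (#(A ∪ (B ∪ C)) : ℝ) := by exact_mod_cast card_le_card hsub
    _ ≤ #A + #(B ∪ C) := by exact_mod_cast card_union_le _ _
    _ ≤ _ := add_le_add hA hBC

end Tail1

end CubicForm

namespace CubicForm

open Finset Matrix ModularGroup UpperHalfPlane

section Tail2

lemma card_interval_le (x : ℝ) {ρ : ℝ} (hρ : 0 ≤ ρ) :
    (#(Icc ⌈x - ρ⌉ ⌊x + ρ⌋) : ℝ) ≤ 2 * ρ + 1 := by
  have h1 := Int.le_ceil (x - ρ)
  have h2 := Int.floor_le (x + ρ)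
  have h3 : ((#(Icc ⌈x - ρ⌉ ⌊x + ρ⌋) : ℤ) : ℝ) ≤ 2 * ρ + 1 := by
    rw [Int.card_Icc, Int.toNat_eq_max, Int.cast_max]
    refine max_le ?_ (by simp; linarith)
    push_cast
    linarith
  exact_mod_cast h3

/-- Representatives for the orbits of forms with a root at infinity. -/
def redSet (Y : ℝ) : Set (Fin 4 → ℤ) :=
  {v | v 0 = 0 ∧ 0 ≤ v 2 ∧ v 2 < 2 * |v 1| ∧ disc v ≠ 0 ∧ |((disc v : ℤ) : ℝ)| < Y}

lemma disc_of_zero {v : Fin 4 → ℤ} (h : v 0 = 0) :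
    disc v = v 1 ^ 2 * (4 * v 1 * v 3 - 3 * v 2 ^ 2) := by
  simp [disc, hessP, hessQ, hessR, h]; ring

lemma redSet_count {Y : ℝ} (hY : 0 < Y) :
    (redSet Y).Finite ∧ ((redSet Y).ncard : ℝ) ≤ 8 * Y := by
  classical
  let x : ℤ → ℤ → ℝ := fun b c => 3 * c ^ 2 / (4 * b)
  let ρ : ℕ → ℝ := fun n => Y / (4 * n ^ 3)
  have hρ : ∀ n, 0 ≤ ρ n := fun n => by positivity
  let F : Finset (Fin 4 → ℤ) := (Ioo 0 ⌈√Y⌉₊).biUnion fun n => ({(n : ℤ), -(n : ℤ)} : Finset ℤ).biUnion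
    fun b => (Ico (0 : ℤ) (2 * n)).biUnion fun c =>
      (Icc ⌈x b c - ρ n⌉ ⌊x b c + ρ n⌋).image fun d => ![0, b, c, d]
  have hsub : redSet Y ⊆ F := by
    rintro v ⟨h0, h2, h2', hd, hdY⟩
    rw [disc_of_zero h0] at hd hdY
    have h1 : v 1 ≠ 0 := fun h => hd (by rw [h]; ring)
    have hb0 : (0 : ℝ) < |(v 1 : ℝ)| := abs_pos.2 (by exact_mod_cast h1)
    have hne : (4 * v 1 * v 3 - 3 * v 2 ^ 2) ≠ 0 := right_ne_zero_of_mul hd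
    have hge : (1 : ℝ) ≤ |((4 * v 1 * v 3 - 3 * v 2 ^ 2 : ℤ) : ℝ)| := by
      exact_mod_cast Int.one_le_abs hne
    rw [Int.cast_mul, abs_mul, Int.cast_pow, abs_pow] at hdY
    have hcast : ((v 1).natAbs : ℝ) = |(v 1 : ℝ)| := by rw [Nat.cast_natAbs, Int.cast_abs]
    simp only [F, coe_biUnion, Set.mem_iUnion, coe_image]
    refine ⟨(v 1).natAbs, ?_, v 1, ?_, v 2, ?_, v 3, ?_, ?_⟩
    · rw [mem_coe, mem_Ioo]
      refine ⟨Int.natAbs_pos.2 h1, Nat.lt_ceil.2 ?_⟩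
      rw [hcast]
      refine Real.lt_sqrt_of_sq_lt ?_
      nlinarith [sq_nonneg |(v 1 : ℝ)|]
    · rw [mem_coe, mem_insert, mem_singleton]
      omega
    · rw [mem_coe, mem_Ico]
      exact ⟨h2, by rw [Int.natCast_natAbs]; exact h2'⟩
    · rw [mem_coe, mem_Icc, Int.ceil_le, Int.le_floor]
      have : |(v 3 : ℝ) - x (v 1) (v 2)| ≤ ρ (v 1).natAbs := by
        have e : (v 3 : ℝ) - x (v 1) (v 2) =
            ((4 * v 1 * v 3 - 3 * v 2 ^ 2 : ℤ) : ℝ) / (4 * v 1) := by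
          have : (v 1 : ℝ) ≠ 0 := by exact_mod_cast h1
          simp only [x]; push_cast; field_simp
        rw [e, abs_div, abs_mul, abs_of_pos (by norm_num : (0 : ℝ) < 4)]
        simp only [ρ, hcast]
        rw [div_le_div_iff₀ (by positivity) (by positivity)]
        nlinarith
      have := abs_le.1 this
      constructor <;> linarith
    · ext i
      fin_cases i <;> simp [h0]
  refine ⟨F.finite_toSet.subset hsub, ?_⟩
  have hF : (#F : ℝ) ≤ ∑ n ∈ Ioo 0 ⌈√Y⌉₊, (2 * Y * ((n : ℝ) ^ 2)⁻¹ + 4 * √Y) := by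
    refine (Nat.cast_le.2 card_biUnion_le).trans ?_
    push_cast
    refine sum_le_sum fun n hn => ?_
    obtain ⟨hn0, hnY⟩ := mem_Ioo.1 hn
    have hn0' : (0 : ℝ) < n := by exact_mod_cast hn0
    have hnY' : (n : ℝ) ≤ √Y := (Nat.lt_ceil.1 hnY).le
    have hc : ∀ b : ℤ, (#((Ico (0 : ℤ) (2 * n)).biUnion fun c =>
        (Icc ⌈x b c - ρ n⌉ ⌊x b c + ρ n⌋).image fun d => (![0, b, c, d] : Fin 4 → ℤ)) : ℝ) ≤
        2 * n * (2 * ρ n + 1) := by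
      intro b
      refine (Nat.cast_le.2 card_biUnion_le).trans ?_
      push_cast
      refine (sum_le_card_nsmul _ _ (2 * ρ n + 1) fun c _ => ?_).trans (le_of_eq ?_)
      · exact (Nat.cast_le.2 card_image_le).trans (card_interval_le _ (hρ n))
      · have : #(Ico (0 : ℤ) (2 * n)) = 2 * n := by rw [Int.card_Ico]; omega
        rw [this, nsmul_eq_mul]
        push_cast
        ring
    refine (Nat.cast_le.2 card_biUnion_le).trans ?_
    push_cast
    refine (sum_le_card_nsmul _ _ _ fun b _ => hc b).trans ?_
    rw [nsmul_eq_mul]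
    calc _ ≤ 2 * (2 * n * (2 * ρ n + 1)) := by
          have := hρ n
          gcongr
          exact_mod_cast card_le_two
      _ = 2 * Y * ((n : ℝ) ^ 2)⁻¹ + 4 * n := by
          simp only [ρ]; field_simp; ring
      _ ≤ _ := by gcongr
  calc ((redSet Y).ncard : ℝ) ≤ #F := by
        rw [← Set.ncard_coe_finset]
        exact_mod_cast Set.ncard_le_ncard hsub F.finite_toSet
    _ ≤ _ := hF
    _ = 2 * Y * ∑ n ∈ Ioo 0 ⌈√Y⌉₊, ((n : ℝ) ^ 2)⁻¹ + (⌈√Y⌉₊ - 0 - 1 : ℕ) * (4 * √Y) := by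
        rw [sum_add_distrib, mul_sum, sum_const, Nat.card_Ioo, nsmul_eq_mul]
    _ ≤ 2 * Y * 2 + √Y * (4 * √Y) := by
        gcongr
        · refine (sum_Ioo_inv_sq_le 0 ⌈√Y⌉₊).trans ?_
          norm_num
        · have := Nat.ceil_lt_add_one (Real.sqrt_nonneg Y)
          have h1 : 1 ≤ ⌈√Y⌉₊ := Nat.one_le_iff_ne_zero.2 (by simpa using hY)
          rw [Nat.sub_zero, Nat.cast_sub h1]
          push_cast
          linarith
    _ = 8 * Y := by
        have := Real.mul_self_sqrt hY.le
        linear_combination 4 * this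

variable {e : ℝ}

/-- A set of forms meeting all orbits of discriminant less than `Y`. -/
def reps (e Y : ℝ) : Set (Fin 4 → ℤ) := cusp e Y (Set.Ici (1 / 2)) ∪ redSet Y

/-- The constant in the count of orbits. -/
noncomputable def repsConst : ℝ := 4 * cuspConst + 8

lemma reps_count (he : e = -1 ∨ e = 1 / 3) {Y : ℝ} (hY : 0 < Y) :
    (reps e Y).Finite ∧ ((reps e Y).ncard : ℝ) ≤ repsConst * Y := by
  have h1 := cusp_count he hY (T := 1 / 2) le_rfl
  have h2 := redSet_count hY
  refine ⟨h1.1.union h2.1, ?_⟩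
  calc ((reps e Y).ncard : ℝ) ≤ (cusp e Y (Set.Ici (1 / 2))).ncard + (redSet Y).ncard := by
        exact_mod_cast Set.ncard_union_le _ _
    _ ≤ 2 * cuspConst * Y / (1 / 2) + 8 * Y := add_le_add h1.2 h2.2
    _ = _ := by rw [repsConst]; ring

lemma exists_act_mem_redSet {v : Fin 4 → ℤ} {Y : ℝ} (h0 : v 0 = 0) (hd : disc v ≠ 0)
    (hY : |((disc v : ℤ) : ℝ)| < Y) : ∃ γ, act γ v ∈ redSet Y := by
  have h1 : v 1 ≠ 0 := fun h => hd (by rw [disc_of_zero h0, h]; ring)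
  have hv : ∃ k : ℤ, (v 2) % (2 * v 1) = v 2 + 2 * v 1 * k :=
    ⟨-(v 2 / (2 * v 1)), by have := Int.emod_def (v 2) (2 * v 1); linarith⟩
  obtain ⟨k, hk⟩ := hv
  refine ⟨⟨!![1, -k; 0, 1], by simp [det_fin_two]⟩, ?_⟩
  have e0 : act ⟨!![1, -k; 0, 1], by simp [det_fin_two]⟩ v 0 = 0 := by simp [act, subst, h0]
  have e1 : act ⟨!![1, -k; 0, 1], by simp [det_fin_two]⟩ v 1 = v 1 := by simp [act, subst, h0]
  have e2 : act ⟨!![1, -k; 0, 1], by simp [det_fin_two]⟩ v 2 = v 2 % (2 * v 1) := by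
    simp [act, subst, h0, hk]; ring
  refine ⟨e0, ?_, ?_, ?_, ?_⟩
  · rw [e2]; exact Int.emod_nonneg _ (by omega)
  · rw [e1, e2]
    refine (Int.emod_lt_abs _ (by omega)).trans_eq ?_
    rw [abs_mul]; norm_num
  · exact (disc_act _ v).trans_ne hd
  · exact (congrArg (fun n : ℤ => |(n : ℝ)|) (disc_act _ v)).trans_lt hY

lemma exists_act_mem_reps (he : e = -1 ∨ e = 1 / 3) {v : Fin 4 → ℤ} {Y : ℝ}
    (hd : 0 < e * disc v) (hY : |((disc v : ℤ) : ℝ)| < Y) : ∃ γ, act γ v ∈ reps e Y := by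
  obtain ⟨z, hz⟩ := exists_rel he (v := toReal v) (by rwa [disc_toReal])
  obtain ⟨γ, hγ⟩ := exists_smul_mem_fd z
  by_cases h0 : act γ v 0 = 0
  · obtain ⟨δ, hδ⟩ := exists_act_mem_redSet (Y := Y) h0
      (by rw [disc_act]; rintro h; simp [h] at hd) (by rwa [disc_act])
    exact ⟨δ * γ, Or.inr (by rwa [act_mul])⟩
  · exact ⟨γ, Or.inl ⟨h0, by rwa [disc_act], _, hγ, half_le_im hγ, hz.act he γ⟩⟩

lemma Rel.of_smul {t : ℝ} (ht : t ≠ 0) {v : Fin 4 → ℝ} {z : ℍ} (h : Rel e (t • v) z) :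
    Rel e v z := by
  obtain ⟨r, s, h⟩ := h
  refine ⟨r / t, s / t, ?_⟩
  have : v = t⁻¹ • Phi e ![z.re, z.im, r, s] := by rw [← h, smul_smul, inv_mul_cancel₀ ht, one_smul]
  rw [this]
  ext i
  fin_cases i <;> simp [Phi] <;> field_simp

lemma of_smul_mem_reps {p : ℕ} (hp : p ≠ 0) {Y : ℝ} {v : Fin 4 → ℤ}
    (h : (p : ℤ) • v ∈ reps e Y) : v ∈ reps e (Y / p ^ 4) := by
  have hp0 : (0 : ℝ) < p := by exact_mod_cast Nat.pos_of_ne_zero hp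
  have hpZ : (0 : ℤ) < p := by exact_mod_cast Nat.pos_of_ne_zero hp
  have hd : ∀ w : Fin 4 → ℤ, |((disc ((p : ℤ) • w) : ℤ) : ℝ)| < Y →
      |((disc w : ℤ) : ℝ)| < Y / p ^ 4 := by
    intro w hw
    rw [disc_smul] at hw
    push_cast at hw
    rw [abs_mul, abs_of_pos (by positivity)] at hw
    rwa [lt_div_iff₀ (by positivity), mul_comm]
  rcases h with ⟨h0, hD, z, hz, hJ, hr⟩ | ⟨h0, h2, h2', hne, hD⟩
  · refine Or.inl ⟨fun h => h0 (by simp [h]), hd v hD, z, hz, hJ, ?_⟩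
    refine Rel.of_smul hp0.ne' (t := p) ?_
    convert hr using 1
    ext i
    simp [toReal]
  · refine Or.inr ⟨?_, ?_, ?_, ?_, hd v hD⟩
    · simpa [hp] using h0
    · simp only [Pi.smul_apply, smul_eq_mul] at h2
      exact (mul_nonneg_iff_of_pos_left hpZ).1 h2
    · simp only [Pi.smul_apply, smul_eq_mul, abs_mul, abs_of_pos hpZ] at h2'
      nlinarith
    · rw [disc_smul] at hne
      exact right_ne_zero_of_mul hne

end Tail2

end CubicForm

namespace CubicForm

open Finset Matrix ModularGroup UpperHalfPlane

section Tail3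

variable {e : ℝ}

/-- The restriction of a form to a sublattice of index `p`. -/
def lat (p : ℕ) (r : Fin 4 → ℤ) : Option (ZMod p) → Fin 4 → ℤ
  | none => subst 1 0 0 p r
  | some k => subst p k.val 0 1 r

lemma subst_eq_act {α β γ δ : ℤ} (h : α * δ - β * γ = 1) :
    ∃ g, ∀ v, subst α β γ δ v = act g v :=
  ⟨⟨!![δ, -β; -γ, α], by rw [det_fin_two_of]; linarith⟩, fun v => by simp [act]⟩

lemma subst_smul' (t α β γ δ : ℤ) (v : Fin 4 → ℤ) :
    subst α β γ δ (t • v) = t • subst α β γ δ v := by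
  ext i
  fin_cases i <;> simp [subst] <;> ring

lemma exists_lat {p : ℕ} (hp : p.Prime) {u r : Fin 4 → ℤ} {α β γ δ : ℤ}
    (h : α * δ - β * γ = 1) (hu : (p : ℤ) • u = subst (p : ℤ) 0 0 1 (subst α β γ δ r)) :
    ∃ i g, (p : ℤ) • act g u = lat p r i := by
  have := Fact.mk hp
  have hpZ : Prime (p : ℤ) := Nat.prime_iff_prime_int.1 hp
  suffices ∃ i, ∃ α' β' γ' δ' : ℤ, α' * δ' - β' * γ' = 1 ∧
      (p : ℤ) • u = subst α' β' γ' δ' (lat p r i) by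
    obtain ⟨i, α', β', γ', δ', h', hu'⟩ := this
    obtain ⟨g, hg⟩ := subst_eq_act (α := δ') (β := -β') (γ := -γ') (δ := α') (by linarith)
    refine ⟨i, g, ?_⟩
    rw [← hg, ← subst_smul', hu', subst_subst]
    convert subst_one _ using 2 <;> linarith
  rw [subst_subst] at hu
  by_cases hd : (p : ℤ) ∣ δ
  · obtain ⟨m, rfl⟩ := hd
    refine ⟨none, α * p, β, γ, m, by linarith, ?_⟩
    rw [hu, lat, subst_subst]
    congr 1 <;> ring
  · have hd' : (δ : ZMod p) ≠ 0 := fun h' => hd ((ZMod.intCast_zmod_eq_zero_iff_dvd _ _).1 h')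
    let k : ZMod p := β / δ
    have hk : (p : ℤ) ∣ β - k.val * δ := by
      rw [← ZMod.intCast_zmod_eq_zero_iff_dvd]
      push_cast
      rw [ZMod.natCast_zmod_val, div_mul_cancel₀ _ hd', sub_self]
    obtain ⟨m, hm⟩ := hk
    refine ⟨some k, α - k.val * γ, m, γ * p, δ, by linear_combination h + γ * hm, ?_⟩
    rw [hu, lat, subst_subst]
    congr 1 <;> linarith

lemma Bad2.exists_lat {p : ℕ} (hp : p.Prime) {v : Fin 4 → ℤ} (h : Bad2 p v) :
    ∃ w : Fin 4 → ℤ, disc v = p ^ 2 * disc w ∧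
      ∀ δ, ∃ i g, (p : ℤ) • act g v = lat p (act δ w) i := by
  obtain ⟨γ, ⟨a, ha⟩, ⟨b, hb⟩⟩ := h
  refine ⟨![a, b, act γ v 2, p * act γ v 3], ?_, fun δ => ?_⟩
  · rw [← disc_rescale, ← disc_act γ v]
    congr 1
    ext i
    fin_cases i <;> simp [ha, hb]
  · have h1 : (p : ℤ) • act γ v = subst (p : ℤ) 0 0 1 ![a, b, act γ v 2, p * act γ v 3] := by
      ext i
      fin_cases i <;> simp [subst, ha, hb] <;> ring
    rw [← act_inv_act δ ![a, b, act γ v 2, p * act γ v 3], act] at h1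
    have := det_eq δ⁻¹
    obtain ⟨i, g, hg⟩ := CubicForm.exists_lat hp (by linear_combination this) h1
    exact ⟨i, g * γ, by rw [act_mul]; exact hg⟩

lemma card_lat_le {p : ℕ} [hp : Fact p.Prime] (hp3 : 3 < p) {r : Fin 4 → ℤ}
    (hr : ¬ ∀ j, (p : ℤ) ∣ r j) :
    #(univ.filter fun i : Option (ZMod p) => ∀ j, (p : ℤ) ∣ lat p r i j) ≤ 3 := by
  classical
  have h3 : (3 : ZMod p) ≠ 0 := by
    have : ((3 : ℕ) : ZMod p) ≠ 0 := by
      rw [Ne, ZMod.natCast_eq_zero_iff]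
      exact fun h => absurd (Nat.le_of_dvd (by norm_num) h) (by omega)
    exact_mod_cast this
  let C : Cubic (ZMod p) := ⟨r 0, 3 * r 1, 3 * r 2, r 3⟩
  have hC : C.toPoly ≠ 0 := by
    intro h
    apply hr
    rw [← Cubic.zero, Cubic.toPoly_injective] at h
    have h0 := congrArg Cubic.a h
    have h1 := congrArg Cubic.b h
    have h2 := congrArg Cubic.c h
    have h4 := congrArg Cubic.d h
    simp only [← ZMod.intCast_zmod_eq_zero_iff_dvd, Fin.forall_fin_succ]
    change (3 : ZMod p) * r 1 = 0 at h1
    change (3 : ZMod p) * r 2 = 0 at h2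
    change (r 0 : ZMod p) = 0 at h0
    change (r 3 : ZMod p) = 0 at h4
    replace h1 := (mul_eq_zero.1 h1).resolve_left h3
    replace h2 := (mul_eq_zero.1 h2).resolve_left h3
    simpa using ⟨h0, h1, h2, h4⟩
  have hsome : ∀ k, (∀ j, (p : ℤ) ∣ lat p r (some k) j) → k ∈ C.toPoly.roots.toFinset := by
    intro k hk
    have := hk 3
    rw [← ZMod.intCast_zmod_eq_zero_iff_dvd] at this
    rw [Multiset.mem_toFinset, Polynomial.mem_roots hC, Polynomial.IsRoot]
    simp [lat, subst] at this
    simp [Cubic.toPoly, C]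
    linear_combination this
  have hcard : #C.toPoly.roots.toFinset ≤ C.toPoly.natDegree :=
    (Multiset.toFinset_card_le _).trans (Polynomial.card_roots' _)
  by_cases h0 : (r 0 : ZMod p) = 0
  · have hsub : (univ.filter fun i : Option (ZMod p) => ∀ j, (p : ℤ) ∣ lat p r i j) ⊆
        insertNone C.toPoly.roots.toFinset := by
      rintro (_ | k) hi
      · simp
      · simpa using hsome k (mem_filter.1 hi).2
    refine (card_le_card hsub).trans ?_
    rw [card_insertNone]
    have : C.toPoly.natDegree ≤ 2 := Cubic.natDegree_of_a_eq_zero h0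
    omega
  · have hsub : (univ.filter fun i : Option (ZMod p) => ∀ j, (p : ℤ) ∣ lat p r i j) ⊆
        C.toPoly.roots.toFinset.map ⟨some, Option.some_injective _⟩ := by
      rintro (_ | k) hi
      · exfalso
        have := (mem_filter.1 hi).2 0
        rw [← ZMod.intCast_zmod_eq_zero_iff_dvd] at this
        simp [lat, subst] at this
        exact h0 this
      · simpa using hsome k (mem_filter.1 hi).2
    refine (card_le_card hsub).trans ?_
    rw [card_map]
    have : C.toPoly.natDegree ≤ 3 := (Cubic.natDegree_of_a_ne_zero h0).le
    omega

lemma fdo_eq_or_neg (he : e = -1 ∨ e = 1 / 3) {v w : Fin 4 → ℤ} {z z' : ℍ} (hz : z ∈ fdo)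
    (hz' : z' ∈ fdo) (hv : Rel e (toReal v) z) (hw : Rel e (toReal w) z') (hd : disc v ≠ 0)
    (h : Quotient.mk orbitSetoid v = Quotient.mk orbitSetoid w) : w = v ∨ w = -v := by
  obtain ⟨γ, rfl⟩ := orbit_eq_iff.1 h
  have hne : disc (toReal (act γ v)) ≠ 0 := by
    rw [disc_toReal, disc_act]
    exact_mod_cast hd
  obtain rfl := hw.unique he hne (hv.act he γ)
  rcases eq_one_or_neg_one_of_mem_fdo_mem_fdo hz hz' with rfl | rfl
  · left; rw [act_one]
  · right; rw [act_neg_one]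

/-- Reduced forms with nonzero leading coefficient. -/
def redo (e X : ℝ) : Set (Fin 4 → ℤ) :=
  {v | v 0 ≠ 0 ∧ |((disc v : ℤ) : ℝ)| < X ∧ ∃ z ∈ fdo, Rel e (toReal v) z}

lemma redo_subset (e X : ℝ) : redo e X ⊆ cusp e X (Set.Ici (1 / 2)) :=
  fun _ ⟨h0, hd, z, hz, h⟩ => ⟨h0, hd, z, fdo_subset_fd hz, half_le_im (fdo_subset_fd hz), h⟩

lemma redo_finite (he : e = -1 ∨ e = 1 / 3) {X : ℝ} (hX : 0 < X) : (redo e X).Finite :=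
  (cusp_count he hX le_rfl).1.subset (redo_subset e X)

lemma Rel.mul_disc_nonneg (he : e = -1 ∨ e = 1 / 3) {v : Fin 4 → ℝ} {z : ℍ} (h : Rel e v z) :
    0 ≤ e * disc v := by
  obtain ⟨r, s, rfl⟩ := h
  rw [disc_Phi he]
  generalize (![z.re, z.im, r, s] : Fin 4 → ℝ) = w
  have : e * (4 * e ^ 3 * (w 1 ^ 6 * (w 2 ^ 2 + w 3 ^ 2) ^ 2)) =
    4 * (e ^ 2 * w 1 ^ 3 * (w 2 ^ 2 + w 3 ^ 2)) ^ 2 := by ring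
  rw [this]
  positivity

theorem card_bad2 (he : e = -1 ∨ e = 1 / 3) {p : ℕ} (hp : p.Prime) (hp3 : 3 < p) {X : ℝ}
    (hX : 0 < X) :
    ((redo e X ∩ {v | Bad2 p v}).ncard : ℝ) ≤ 8 * repsConst * X * ((p : ℝ) ^ 2)⁻¹ := by
  classical
  have := Fact.mk hp
  have hp0 : (0 : ℝ) < p := by exact_mod_cast hp.pos
  have hp1 : (1 : ℝ) ≤ p := by exact_mod_cast hp.one_le
  obtain ⟨hfin, hcard⟩ := reps_count he (Y := X / p ^ 2) (by positivity)
  obtain ⟨hfin', hcard'⟩ := reps_count he (Y := X / p ^ 2 / p ^ 4) (by positivity)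
  set R := hfin.toFinset with hR
  rw [Set.ncard_eq_toFinset_card _ hfin, ← hR] at hcard
  let T : Finset ((_ : Fin 4 → ℤ) × Option (ZMod p)) := R.sigma fun r =>
    univ.filter fun i => ∀ j, (p : ℤ) ∣ lat p r i j
  have hV : (redo e X ∩ {v | Bad2 p v}).Finite := (redo_finite he hX).inter_of_left _
  set V := hV.toFinset with hVdef
  have key : ∀ v ∈ V, ∃ q ∈ T, ∃ g, (p : ℤ) • act g v = lat p q.1 q.2 := by
    intro v hv
    rw [hVdef, Set.Finite.mem_toFinset] at hv
    obtain ⟨⟨h0, hd, z, hz, hrel⟩, hb⟩ := hv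
    obtain ⟨w, hw, hlat⟩ := Bad2.exists_lat hp hb
    have hne := disc_ne_zero_of_rel he (v := toReal v) (Int.cast_ne_zero.2 h0) hrel
    have hnn := hrel.mul_disc_nonneg he
    rw [disc_toReal] at hne hnn
    have hw' : ((disc v : ℤ) : ℝ) = p ^ 2 * (disc w : ℤ) := by rw [hw]; push_cast; rfl
    have he0 : e ≠ 0 := by rcases he with rfl | rfl <;> norm_num
    have hpos : 0 < e * (disc w : ℤ) := by
      have : 0 < e * (disc v : ℤ) := lt_of_le_of_ne hnn (mul_ne_zero he0 hne).symm
      rw [hw', mul_left_comm] at this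
      exact (mul_pos_iff_of_pos_left (by positivity)).1 this
    obtain ⟨δ, hδ⟩ := exists_act_mem_reps he (Y := X / p ^ 2) hpos (by
      rw [hw', abs_mul, abs_of_pos (by positivity)] at hd
      rwa [lt_div_iff₀ (by positivity), mul_comm])
    obtain ⟨i, g, hg⟩ := hlat δ
    refine ⟨⟨act δ w, i⟩, mem_sigma.2 ⟨by rwa [hR, Set.Finite.mem_toFinset], mem_filter.2
      ⟨mem_univ _, fun j => ?_⟩⟩, g, hg⟩
    rw [← hg]
    exact ⟨_, rfl⟩
  choose! f hfT g hg using key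
  have h1 : #V ≤ 2 * #T := by
    refine card_le_mul_card_image_of_maps_to hfT 2 fun q _ => ?_
    by_contra! hlt
    obtain ⟨a, ha⟩ := card_pos.1 (lt_trans (by norm_num) hlt)
    obtain ⟨haV, haq⟩ := mem_filter.1 ha
    have hsub : (V.filter fun v => f v = q) ⊆ {a, -a} := by
      intro w hw
      obtain ⟨hwV, hwq⟩ := mem_filter.1 hw
      rw [mem_insert, mem_singleton]
      have e1 := hg a haV
      have e2 := hg w hwV
      rw [haq] at e1
      rw [hwq, ← e1] at e2
      have e3 := smul_right_injective (Fin 4 → ℤ) (r := (p : ℤ)) (by exact_mod_cast hp.ne_zero) e2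
      rw [hVdef, Set.Finite.mem_toFinset] at haV hwV
      obtain ⟨⟨h0, -, z, hz, hrel⟩, -⟩ := haV
      obtain ⟨⟨-, -, z', hz', hrel'⟩, -⟩ := hwV
      have hne := disc_ne_zero_of_rel he (v := toReal a) (Int.cast_ne_zero.2 h0) hrel
      rw [disc_toReal] at hne
      refine fdo_eq_or_neg he hz hz' hrel hrel' (by exact_mod_cast hne)
        (orbit_eq_iff.2 ⟨(g w)⁻¹ * g a, ?_⟩)
      rw [act_mul, ← e3, act_inv_act]
    have := (card_le_card hsub).trans card_le_two
    omega
  have h2 : #T ≤ 3 * #R + (p + 1) * #(R.filter fun r => ∀ j, (p : ℤ) ∣ r j) := by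
    rw [card_sigma, ← sum_filter_add_sum_filter_not R fun r => ∀ j, (p : ℤ) ∣ r j, add_comm]
    refine add_le_add ?_ ?_
    · refine (sum_le_card_nsmul _ _ 3 fun r hr => card_lat_le hp3 (mem_filter.1 hr).2).trans ?_
      rw [smul_eq_mul, mul_comm]
      exact Nat.mul_le_mul_left 3 (card_le_card (filter_subset _ _))
    · refine (sum_le_card_nsmul _ _ (p + 1) fun r _ => (card_le_univ _).trans ?_).trans ?_
      · rw [Fintype.card_option, ZMod.card]
      · rw [smul_eq_mul, mul_comm]
  have h3 : (#(R.filter fun r => ∀ j, (p : ℤ) ∣ r j) : ℝ) ≤ repsConst * (X / p ^ 2 / p ^ 4) := by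
    refine le_trans ?_ hcard'
    rw [Set.ncard_eq_toFinset_card _ hfin']
    refine Nat.cast_le.2 (card_le_card_of_injOn (fun r j => r j / p) ?_ ?_)
    · intro r hr
      obtain ⟨hr, hd⟩ := mem_filter.1 hr
      rw [mem_coe, Set.Finite.mem_toFinset]
      refine of_smul_mem_reps hp.ne_zero ?_
      rw [hR, Set.Finite.mem_toFinset] at hr
      convert hr using 1
      ext j
      exact Int.mul_ediv_cancel' (hd j)
    · intro r hr r' hr' h
      ext j
      have := congrFun h j
      simp only at this
      rw [← Int.mul_ediv_cancel' ((mem_filter.1 hr).2 j), this,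
        Int.mul_ediv_cancel' ((mem_filter.1 hr').2 j)]
  have hC : 0 ≤ repsConst := by unfold repsConst cuspConst; norm_num
  rw [Set.ncard_eq_toFinset_card _ hV, ← hVdef]
  calc (#V : ℝ) ≤ 2 * (3 * #R + (p + 1) * #(R.filter fun r => ∀ j, (p : ℤ) ∣ r j)) := by
        exact_mod_cast h1.trans (Nat.mul_le_mul_left 2 h2)
    _ ≤ 2 * (3 * (repsConst * (X / p ^ 2)) + p ^ 4 * (repsConst * (X / p ^ 2 / p ^ 4))) := by
        gcongr
        have : (3 : ℝ) < p := by exact_mod_cast hp3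
        calc (p + 1 : ℝ) ≤ p ^ 2 := by nlinarith
          _ ≤ p ^ 4 := pow_le_pow_right₀ hp1 (by norm_num)
    _ = _ := by field_simp; ring

theorem card_bad2_tail (he : e = -1 ∨ e = 1 / 3) {M : ℕ} (hM : 3 ≤ M) {X : ℝ} (hX : 0 < X) :
    ((redo e X ∩ {v | ∃ p : ℕ, p.Prime ∧ M < p ∧ Bad2 p v}).ncard : ℝ) ≤
      8 * repsConst * X / M := by
  classical
  have hC : 0 ≤ repsConst := by unfold repsConst cuspConst; norm_num
  let I := (Ioc M (M + ⌈X⌉₊)).filter Nat.Prime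
  have hsub : redo e X ∩ {v | ∃ p : ℕ, p.Prime ∧ M < p ∧ Bad2 p v} ⊆
      ⋃ p ∈ I, redo e X ∩ {v | Bad2 p v} := by
    rintro v ⟨hv, p, hp, hpM, hb⟩
    simp only [Set.mem_iUnion]
    refine ⟨p, mem_filter.2 ⟨mem_Ioc.2 ⟨hpM, ?_⟩, hp⟩, hv, hb⟩
    obtain ⟨w, hw, -⟩ := Bad2.exists_lat hp hb
    obtain ⟨h0, hd, z, hz, hrel⟩ := hv
    have hne := disc_ne_zero_of_rel he (v := toReal v) (Int.cast_ne_zero.2 h0) hrel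
    rw [disc_toReal, hw] at hne
    rw [hw] at hd
    push_cast at hne hd
    have h1 : (1 : ℝ) ≤ |((disc w : ℤ) : ℝ)| := by
      exact_mod_cast Int.one_le_abs (by exact_mod_cast right_ne_zero_of_mul hne)
    rw [abs_mul, abs_of_nonneg (by positivity)] at hd
    have hp1 : (1 : ℝ) ≤ p := by exact_mod_cast hp.one_le
    have h2 : (p : ℝ) < X := by nlinarith [sq_nonneg (p : ℝ)]
    have h3 : (p : ℝ) ≤ ⌈X⌉₊ := h2.le.trans (Nat.le_ceil _)
    have : p ≤ ⌈X⌉₊ := by exact_mod_cast h3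
    omega
  have hfin : ∀ p ∈ I, (redo e X ∩ {v | Bad2 p v}).Finite :=
    fun p _ => (redo_finite he hX).inter_of_left _
  calc _ ≤ ((⋃ p ∈ I, redo e X ∩ {v | Bad2 p v}).ncard : ℝ) := by
        exact_mod_cast Set.ncard_le_ncard hsub (Set.Finite.biUnion I.finite_toSet hfin)
    _ ≤ ∑ p ∈ I, ((redo e X ∩ {v | Bad2 p v}).ncard : ℝ) := by
        exact_mod_cast Finset.set_ncard_biUnion_le _ _
    _ ≤ ∑ p ∈ I, 8 * repsConst * X * ((p : ℝ) ^ 2)⁻¹ := by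
        refine sum_le_sum fun p hp => ?_
        obtain ⟨hp, hpp⟩ := mem_filter.1 hp
        have := (mem_Ioc.1 hp).1
        exact card_bad2 he hpp (by omega) hX
    _ ≤ ∑ p ∈ Ioc M (M + ⌈X⌉₊), 8 * repsConst * X * ((p : ℝ) ^ 2)⁻¹ :=
        sum_le_sum_of_subset_of_nonneg (filter_subset _ _) fun _ _ _ => by positivity
    _ = 8 * repsConst * X * ∑ p ∈ Ioc M (M + ⌈X⌉₊), ((p : ℝ) ^ 2)⁻¹ := by rw [mul_sum]
    _ ≤ 8 * repsConst * X * (M : ℝ)⁻¹ := by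
        gcongr
        refine (sum_Ioc_inv_sq_le_sub (by omega) (by omega)).trans ?_
        have : (0 : ℝ) ≤ ((M + ⌈X⌉₊ : ℕ) : ℝ)⁻¹ := by positivity
        linarith
    _ = _ := by rw [div_eq_mul_inv]

end Tail3

end CubicForm

namespace CubicForm

open Finset Matrix ModularGroup UpperHalfPlane Filter Topology MeasureTheory

section Sieve

variable {e : ℝ}

open Classical in
/-- Fundamental discriminants of the sign of `e` and absolute value less than `X`. -/
noncomputable def famD (e X : ℝ) : Finset ℤ :=
  (Icc (-⌈X⌉) ⌈X⌉).filter fun D : ℤ => Fund D ∧ 0 < e * D ∧ |(D : ℝ)| < X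

lemma mem_famD {X : ℝ} {D : ℤ} : D ∈ famD e X ↔ Fund D ∧ 0 < e * D ∧ |(D : ℝ)| < X := by
  classical
  rw [famD, mem_filter, and_iff_right_iff_imp, mem_Icc]
  rintro ⟨-, -, h⟩
  have := h.le.trans (Int.le_ceil X)
  have := abs_le.1 (show |D| ≤ ⌈X⌉ by exact_mod_cast this)
  exact this

/-- The number of classes of forms of discriminant `D`. -/
noncomputable def numOrb (D : ℤ) : ℕ := Nat.card {o : Orbit // o.disc = D}

lemma Rel.mul_disc_pos (he : e = -1 ∨ e = 1 / 3) {v : Fin 4 → ℤ} (h0 : v 0 ≠ 0) {z : ℍ}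
    (h : Rel e (toReal v) z) : 0 < e * (disc v : ℤ) := by
  have hne := disc_ne_zero_of_rel he (v := toReal v) (Int.cast_ne_zero.2 h0) h
  have hnn := h.mul_disc_nonneg he
  rw [disc_toReal] at hne hnn
  have he0 : e ≠ 0 := by rcases he with rfl | rfl <;> norm_num
  exact lt_of_le_of_ne hnn (mul_ne_zero he0 hne).symm

lemma reduced_subset {X : ℝ} {D : ℤ} (hD : |(D : ℝ)| < X) :
    reduced e fd D ⊆ cusp e X (Set.Ici (1 / 2)) := by
  rintro v ⟨rfl, h0, z, hz, h⟩
  exact ⟨h0, hD, z, hz, half_le_im hz, h⟩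

lemma sum_le_ncard (he : e = -1 ∨ e = 1 / 3) {X : ℝ} (hX : 0 < X) :
    ∑ D ∈ famD e X, (2 * (numOrb D : ℝ) - 2) ≤
      (cusp e X (Set.Ici (1 / 2)) ∩ {v | Fund (disc v)}).ncard := by
  classical
  have hfin := (cusp_count he hX (le_refl (1 / 2 : ℝ))).1
  have hfin' := hfin.inter_of_left {v | Fund (disc v)}
  rw [Set.ncard_eq_toFinset_card _ hfin']
  have hmaps : ∀ v ∈ hfin'.toFinset, disc v ∈ famD e X := by
    intro v hv
    rw [Set.Finite.mem_toFinset] at hv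
    obtain ⟨⟨h0, hd, z, hz, -, h⟩, hF⟩ := hv
    exact mem_famD.2 ⟨hF, h.mul_disc_pos he h0, hd⟩
  rw [card_eq_sum_card_fiberwise hmaps]
  push_cast
  refine sum_le_sum fun D hD => ?_
  obtain ⟨hF, hpos, hlt⟩ := mem_famD.1 hD
  have hr := hfin.subset (reduced_subset (e := e) hlt)
  have h1 := two_mul_card_orbit_le he hpos hF hr
  have h2 : (reduced e fd D).ncard ≤ #(hfin'.toFinset.filter fun v => disc v = D) := by
    rw [Set.ncard_eq_toFinset_card _ hr]
    refine card_le_card fun v hv => ?_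
    rw [Set.Finite.mem_toFinset] at hv
    rw [mem_filter, Set.Finite.mem_toFinset]
    refine ⟨⟨reduced_subset hlt hv, ?_⟩, hv.1⟩
    change Fund (disc v)
    rwa [hv.1]
  have h3 : (2 * numOrb D : ℝ) ≤ (reduced e fd D).ncard + 2 := by exact_mod_cast h1
  have h4 : ((reduced e fd D).ncard : ℝ) ≤ #(hfin'.toFinset.filter fun v => disc v = D) := by
    exact_mod_cast h2
  linarith

lemma ncard_le_sum (he : e = -1 ∨ e = 1 / 3) {X : ℝ} (hX : 0 < X) :
    ((redo e X ∩ {v | Fund (disc v) ∧ 16 < e * (disc v : ℤ)}).ncard : ℝ) ≤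
      ∑ D ∈ famD e X, (2 * (numOrb D : ℝ) - 2) + 194 := by
  classical
  have hfin' := (redo_finite he hX).inter_of_left {v | Fund (disc v) ∧ 16 < e * (disc v : ℤ)}
  have hsplit := sum_filter_add_sum_filter_not (famD e X) (fun D : ℤ => 16 < e * D)
    fun D => (2 * (numOrb D : ℝ) - 2)
  have h1 : -194 ≤ ∑ D ∈ (famD e X).filter fun D : ℤ => ¬ 16 < e * D, (2 * (numOrb D : ℝ) - 2) := by
    have hc : #((famD e X).filter fun D : ℤ => ¬ 16 < e * D) ≤ #(Icc (-48 : ℤ) 48) := by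
      refine card_le_card fun D hD => ?_
      obtain ⟨hD, hle⟩ := mem_filter.1 hD
      obtain ⟨-, hpos, -⟩ := mem_famD.1 hD
      rw [not_lt] at hle
      rw [mem_Icc]
      have : (-48 : ℝ) ≤ D ∧ (D : ℝ) ≤ 48 := by
        rcases he with rfl | rfl <;> constructor <;> linarith
      exact_mod_cast this
    have hc' : (#((famD e X).filter fun D : ℤ => ¬ 16 < e * D) : ℝ) ≤ 97 := by
      exact_mod_cast hc.trans (by simp)
    have := card_nsmul_le_sum ((famD e X).filter fun D : ℤ => ¬ 16 < e * D)
      (fun D => (2 * (numOrb D : ℝ) - 2)) (-2) fun D _ => by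
        have : (0 : ℝ) ≤ numOrb D := by positivity
        linarith
    rw [nsmul_eq_mul] at this
    linarith
  suffices ((redo e X ∩ {v | Fund (disc v) ∧ 16 < e * (disc v : ℤ)}).ncard : ℝ) ≤
      ∑ D ∈ (famD e X).filter fun D : ℤ => 16 < e * D, (2 * (numOrb D : ℝ) - 2) by linarith
  rw [Set.ncard_eq_toFinset_card _ hfin']
  have hmaps : ∀ v ∈ hfin'.toFinset, disc v ∈ (famD e X).filter fun D : ℤ => 16 < e * D := by
    intro v hv
    rw [Set.Finite.mem_toFinset] at hv
    obtain ⟨⟨h0, hd, z, hz, h⟩, hF, h16⟩ := hv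
    exact mem_filter.2 ⟨mem_famD.2 ⟨hF, h.mul_disc_pos he h0, hd⟩, h16⟩
  rw [card_eq_sum_card_fiberwise hmaps]
  push_cast
  refine sum_le_sum fun D hD => ?_
  obtain ⟨hD, h16⟩ := mem_filter.1 hD
  obtain ⟨hF, hpos, hlt⟩ := mem_famD.1 hD
  have hr := (cusp_count he hX (le_refl (1 / 2 : ℝ))).1.subset (reduced_subset (e := e) hlt)
  have hr' : (reduced e fdo D).Finite := hr.subset fun v ⟨h1, h2, z, hz, h3⟩ =>
    ⟨h1, h2, z, fdo_subset_fd hz, h3⟩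
  have h1 := ncard_reduced_fdo_le he h16 hF hr
  have h2 : #(hfin'.toFinset.filter fun v => disc v = D) ≤ (reduced e fdo D).ncard := by
    rw [Set.ncard_eq_toFinset_card _ hr']
    refine card_le_card fun v hv => ?_
    rw [mem_filter, Set.Finite.mem_toFinset] at hv
    rw [Set.Finite.mem_toFinset]
    obtain ⟨⟨⟨h0, -, h⟩, -⟩, hd⟩ := hv
    exact ⟨hd, h0, h⟩
  have h3 : ((reduced e fdo D).ncard + 2 : ℝ) ≤ 2 * numOrb D := by exact_mod_cast h1
  have h4 : (#(hfin'.toFinset.filter fun v => disc v = D) : ℝ) ≤ (reduced e fdo D).ncard := by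
    exact_mod_cast h2
  linarith

lemma Phi_smul (t : ℝ) (w : Fin 4 → ℝ) : Phi e ![w 0, w 1, t * w 2, t * w 3] = t • Phi e w := by
  ext i
  fin_cases i <;> simp [Phi] <;> ring

lemma toReal_eq_smul {l : ℝ} (hl : 0 < l) (v : Fin 4 → ℤ) :
    toReal v = l • fun i => (v i : ℝ) / l := by
  ext i
  simp only [toReal, Pi.smul_apply, smul_eq_mul]
  field_simp

lemma disc_div {l : ℝ} (hl : 0 < l) (v : Fin 4 → ℤ) :
    ((disc v : ℤ) : ℝ) = l ^ 4 * disc fun i => (v i : ℝ) / l := by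
  rw [← disc_toReal, toReal_eq_smul hl, disc_smul]

lemma mem_image_regK (he : e = -1 ∨ e = 1 / 3) {l T : ℝ} (hl : 0 < l) {v : Fin 4 → ℤ}
    (hv : v ∈ cusp e (l ^ 4) (Set.Iic T)) : (fun i => (v i : ℝ) / l) ∈ Phi e '' regK e T := by
  obtain ⟨h0, hd, z, hz, hT, r, s, h⟩ := hv
  have hw : Phi e ![z.re, z.im, l⁻¹ * r, l⁻¹ * s] = fun i => (v i : ℝ) / l := by
    have := Phi_smul (e := e) l⁻¹ ![z.re, z.im, r, s]
    simp only [Matrix.cons_val] at this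
    rw [this, ← h, toReal_eq_smul hl, smul_smul, inv_mul_cancel₀ hl.ne', one_smul]
  refine ⟨_, ⟨?_, ?_, ?_, ?_, ?_⟩, hw⟩
  · exact hz.2
  · have := hz.1
    rw [Complex.normSq_apply] at this
    simpa [sq] using this
  · exact z.im_pos.le
  · exact hT
  · rw [← abs_disc_Phi he, hw]
    rw [disc_div hl, abs_mul, abs_of_pos (by positivity)] at hd
    nlinarith [pow_pos hl 4]

lemma mem_redo_of_regU (he : e = -1 ∨ e = 1 / 3) {l T : ℝ} (hl : 0 < l) {v : Fin 4 → ℤ}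
    (hv : (fun i => (v i : ℝ) / l) ∈ Phi e '' regU e T) : v ∈ redo e (l ^ 4) := by
  obtain ⟨w, ⟨h1, h2, h3, h4, h5, h6⟩, hw⟩ := hv
  refine ⟨?_, ?_, ⟨⟨w 0, w 1⟩, h3⟩, ⟨?_, h1⟩, l * w 2, l * w 3, ?_⟩
  · rintro h0
    have := congrFun hw 0
    simp [Phi, h0, h5] at this
  · rw [disc_div hl, abs_mul, abs_of_pos (by positivity), ← hw, abs_disc_Phi he]
    nlinarith [pow_pos hl 4]
  · change 1 < Complex.normSq ⟨w 0, w 1⟩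
    rw [Complex.normSq_mk]
    nlinarith
  · rw [toReal_eq_smul hl, ← hw, ← Phi_smul]
    rfl

end Sieve

end CubicForm

namespace CubicForm

open Finset Matrix ModularGroup UpperHalfPlane Filter Topology MeasureTheory

section Sieve2

variable {e : ℝ}

/-- The total excess of class counts over the trivial ones. -/
noncomputable def excess (e X : ℝ) : ℝ := ∑ D ∈ famD e X, (2 * (numOrb D : ℝ) - 2)

/-- Forms in a dilated region that are fundamental at all primes up to `M`. -/
def goodIn (R : Set (Fin 4 → ℝ)) (M : ℕ) (l : ℝ) : Set (Fin 4 → ℤ) :=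
  {v | (∀ p : ℕ, p.Prime → p ≤ M → ¬ Bad1 p v ∧ ¬ Bad2 p v) ∧ (fun i => (v i : ℝ) / l) ∈ R}

lemma finite_goodIn {R : Set (Fin 4 → ℝ)} (hb : Bornology.IsBounded R) (M : ℕ) {l : ℝ}
    (hl : 0 < l) : (goodIn R M l).Finite := by
  refine (finite_coset hb one_pos 0 hl).subset fun v hv => ?_
  simpa using hv.2

lemma volume_real_regU (he : e = -1 ∨ e = 1 / 3) {T : ℝ} (hT : 1 ≤ T) :
    volume.real (Phi e '' regU e T) = Real.pi / (2 * |e|) * (Real.pi / 3 - 1 / T) := by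
  rw [Measure.real, volume_image_regU he hT, ENNReal.toReal_ofReal]
  have h1 : 1 / T ≤ 1 := by rw [div_le_one (by linarith)]; exact hT
  have := Real.pi_gt_three
  have h2 : 0 ≤ Real.pi / 3 - 1 / T := by linarith
  positivity

lemma excess_lt (he : e = -1 ∨ e = 1 / 3) {T : ℝ} (hT : 1 ≤ T) (M : ℕ) {c : ℝ}
    (hc : kap M ^ 2 * (Real.pi / (2 * |e|) * (Real.pi / 3 - 1 / T)) + 2 * cuspConst / T < c) :
    ∀ᶠ l : ℝ in atTop, excess e (l ^ 4) / l ^ 4 < c := by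
  have hK := isCompact_image_regK he T
  have hlim := tendsto_count_good hK.isBounded hK.measurableSet (volume_frontier_image_regK he T) M
  rw [Measure.real, volume_image_regK he, ← Measure.real, volume_real_regU he hT] at hlim
  filter_upwards [hlim.eventually (gt_mem_nhds (lt_sub_iff_add_lt.2 hc)), eventually_gt_atTop 0]
    with l hl hl0
  have hX : 0 < l ^ 4 := by positivity
  obtain ⟨hcf, hcc⟩ := cusp_count he hX (T := T) (by linarith)
  have h1 := sum_le_ncard he hX
  have hsub : cusp e (l ^ 4) (Set.Ici (1 / 2)) ∩ {v | Fund (disc v)} ⊆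
      goodIn (Phi e '' regK e T) M l ∪ cusp e (l ^ 4) (Set.Ici T) := by
    rintro v ⟨⟨h0, hd, z, hz, -, h⟩, hF⟩
    rcases le_total z.im T with hzT | hzT
    · exact Or.inl ⟨fun p hp _ => fund_disc_iff.1 hF p hp,
        mem_image_regK he hl0 ⟨h0, hd, z, hz, hzT, h⟩⟩
    · exact Or.inr ⟨h0, hd, z, hz, hzT, h⟩
  have h2 := (Set.ncard_le_ncard hsub
    ((finite_goodIn hK.isBounded M hl0).union hcf)).trans (Set.ncard_union_le _ _)
  have h3 : ((cusp e (l ^ 4) (Set.Ici (1 / 2)) ∩ {v | Fund (disc v)}).ncard : ℝ) ≤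
      (goodIn (Phi e '' regK e T) M l).ncard + (cusp e (l ^ 4) (Set.Ici T)).ncard := by
    exact_mod_cast h2
  have h4 : ((goodIn (Phi e '' regK e T) M l).ncard : ℝ) / l ^ 4 < c - 2 * cuspConst / T := hl
  rw [div_lt_iff₀ hX] at h4 ⊢
  have h5 : 2 * cuspConst * l ^ 4 / T = 2 * cuspConst / T * l ^ 4 := by ring
  rw [h5] at hcc
  unfold excess
  nlinarith

lemma goodIn_regU_subset (he : e = -1 ∨ e = 1 / 3) {T l : ℝ} (hl : 0 < l) {B : ℝ}
    (hB : ∀ x ∈ Phi e '' regU e T, ‖x‖ ≤ B) {N : ℕ} (hN : B * l ≤ N) (M : ℕ) :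
    goodIn (Phi e '' regU e T) M l ⊆
      ((redo e (l ^ 4) ∩ {v | Fund (disc v) ∧ 16 < e * (disc v : ℤ)}) ∪ redo e 49) ∪
      ({v ∈ (cube N : Set (Fin 4 → ℤ)) | v 0 ≠ 0 ∧ ∃ p : ℕ, p.Prime ∧ M < p ∧ Bad1 p v} ∪
        (redo e (l ^ 4) ∩ {v | ∃ p : ℕ, p.Prime ∧ M < p ∧ Bad2 p v})) := by
  rintro v ⟨hg, hv⟩
  have hr := mem_redo_of_regU he hl hv
  obtain ⟨h0, hd, z, hz, h⟩ := id hr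
  by_cases hF : Fund (disc v)
  · left
    by_cases h16 : 16 < e * (disc v : ℤ)
    · exact Or.inl ⟨hr, hF, h16⟩
    · right
      refine ⟨h0, ?_, z, hz, h⟩
      have := h.mul_disc_pos he h0
      rw [abs_lt]
      rcases he with rfl | rfl <;> constructor <;> linarith
  · right
    rw [fund_disc_iff] at hF
    push Not at hF
    obtain ⟨p, hp, hb⟩ := hF
    have hpM : M < p := by
      by_contra! hle
      exact (hg p hp hle).2 (hb (hg p hp hle).1)
    by_cases hb1 : Bad1 p v
    · left
      refine ⟨?_, h0, p, hp, hpM, hb1⟩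
      rw [mem_coe, mem_cube]
      intro i
      have h1 := (norm_le_pi_norm _ i).trans (hB _ hv)
      rw [Real.norm_eq_abs, abs_div, abs_of_pos hl, div_le_iff₀ hl] at h1
      have h2 := abs_le.1 (h1.trans hN)
      exact_mod_cast h2
    · exact Or.inr ⟨hr, p, hp, hpM, hb hb1⟩

lemma lt_excess (he : e = -1 ∨ e = 1 / 3) {T : ℝ} (hT : 1 ≤ T) :
    ∃ K : ℝ, ∀ M : ℕ, 3 ≤ M → ∀ c,
      c < kap M ^ 2 * (Real.pi / (2 * |e|) * (Real.pi / 3 - 1 / T)) - K / M →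
      ∀ᶠ l : ℝ in atTop, c < excess e (l ^ 4) / l ^ 4 := by
  classical
  have hb : Bornology.IsBounded (Phi e '' regU e T) :=
    (isCompact_image_regK he T).isBounded.subset (Set.image_mono (regU_subset e T))
  obtain ⟨B, hB0, hB⟩ := hb.exists_pos_norm_le
  refine ⟨256 * (B + 1) ^ 4 + 8 * repsConst, fun M hM c hc => ?_⟩
  have hM0 : (0 : ℝ) < M := by exact_mod_cast (by omega : 0 < M)
  have hlim := tendsto_count_good hb (isOpen_image_regU he T).measurableSet
    (volume_frontier_image_regU he T) M
  rw [volume_real_regU he hT] at hlim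
  have hsmall : Tendsto (fun l : ℝ => 189 * (B + 1) ^ 3 * l⁻¹ + (194 + (redo e 49).ncard) * (l⁻¹) ^ 4)
      atTop (𝓝 0) := by
    have := tendsto_inv_atTop_zero (𝕜 := ℝ)
    simpa using (this.const_mul (189 * (B + 1) ^ 3)).add
      ((this.pow 4).const_mul (194 + ((redo e 49).ncard : ℝ)))
  have htot := (hlim.sub_const ((256 * (B + 1) ^ 4 + 8 * repsConst) / M)).sub hsmall
  rw [sub_zero] at htot
  filter_upwards [htot.eventually (lt_mem_nhds hc), eventually_ge_atTop 1] with l hl hl1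
  refine hl.trans_le ?_
  have hl0 : 0 < l := by linarith
  have hX : 0 < l ^ 4 := by positivity
  set N := ⌈B * l⌉₊ with hNdef
  have hN : B * l ≤ N := Nat.le_ceil _
  have hN1 : (N : ℝ) ≤ (B + 1) * l := by
    have := Nat.ceil_lt_add_one (mul_pos hB0 hl0).le
    rw [← hNdef] at this
    linarith
  have hN0 : N ≠ 0 := (Nat.ceil_pos.2 (mul_pos hB0 hl0)).ne'
  have hsub := goodIn_regU_subset he hl0 hB hN M
  have hf1 := (redo_finite he hX).inter_of_left {v | Fund (disc v) ∧ 16 < e * (disc v : ℤ)}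
  have hf2 := redo_finite he (X := 49) (by norm_num)
  have hf3 := (cube N).finite_toSet.subset
    (Set.sep_subset (cube N : Set (Fin 4 → ℤ)) fun v =>
      v 0 ≠ 0 ∧ ∃ p : ℕ, p.Prime ∧ M < p ∧ Bad1 p v)
  have hf4 := (redo_finite he hX).inter_of_left {v | ∃ p : ℕ, p.Prime ∧ M < p ∧ Bad2 p v}
  have h1 := (Set.ncard_le_ncard hsub ((hf1.union hf2).union (hf3.union hf4))).trans
    ((Set.ncard_union_le _ _).trans
      (add_le_add (Set.ncard_union_le _ _) (Set.ncard_union_le _ _)))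
  have h2 := ncard_le_sum he hX
  have h3 := card_bad1_tail (N := N) (M := M) (by omega) hN0
  have h4 := card_bad2_tail he hM hX
  have h5 : {v ∈ (cube N : Set (Fin 4 → ℤ)) | v 0 ≠ 0 ∧ ∃ p : ℕ, p.Prime ∧ M < p ∧ Bad1 p v}.ncard =
      #((cube N).filter fun v => v 0 ≠ 0 ∧ ∃ p : ℕ, p.Prime ∧ M < p ∧ Bad1 p v) := by
    rw [← Set.ncard_coe_finset, coe_filter]
    rfl
  rw [h5] at h1
  have h6 : 256 * (N : ℝ) ^ 4 / M + 189 * (N : ℝ) ^ 3 ≤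
      256 * ((B + 1) * l) ^ 4 / M + 189 * ((B + 1) * l) ^ 3 := by gcongr
  have h7 : ((goodIn (Phi e '' regU e T) M l).ncard : ℝ) ≤
      excess e (l ^ 4) + 194 + (redo e 49).ncard +
        (256 * ((B + 1) * l) ^ 4 / M + 189 * ((B + 1) * l) ^ 3 + 8 * repsConst * l ^ 4 / M) := by
    have : ((goodIn (Phi e '' regU e T) M l).ncard : ℝ) ≤ _ := Nat.cast_le.2 h1
    push_cast at this
    unfold excess
    refine this.trans ?_
    refine add_le_add (add_le_add h2 le_rfl) (add_le_add ?_ h4)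
    refine le_trans (le_of_eq ?_) (h3.trans h6)
    congr!
  rw [le_div_iff₀ hX, sub_mul, sub_mul]
  have h8 : ((goodIn (Phi e '' regU e T) M l).ncard : ℝ) / l ^ 4 * l ^ 4 =
      (goodIn (Phi e '' regU e T) M l).ncard := by field_simp
  have h9 : (189 * (B + 1) ^ 3 * l⁻¹ + (194 + ((redo e 49).ncard : ℝ)) * (l⁻¹) ^ 4) * l ^ 4 =
      189 * ((B + 1) * l) ^ 3 + (194 + (redo e 49).ncard) := by field_simp
  have h10 : (256 * (B + 1) ^ 4 + 8 * repsConst) / M * l ^ 4 =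
      256 * ((B + 1) * l) ^ 4 / M + 8 * repsConst * l ^ 4 / M := by ring
  rw [h9, h10]
  have : ((goodIn (Phi e '' regU e T) M l).ncard : ℝ) / l ^ 4 * l ^ 4 -
    (256 * ((B + 1) * l) ^ 4 / M + 8 * repsConst * l ^ 4 / M) -
    (189 * ((B + 1) * l) ^ 3 + (194 + (redo e 49).ncard)) ≤ excess e (l ^ 4) := by
    rw [h8]; linarith
  exact this

theorem tendsto_excess (he : e = -1 ∨ e = 1 / 3) :
    Tendsto (fun l : ℝ => excess e (l ^ 4) / l ^ 4) atTop (𝓝 (6 / (Real.pi ^ 2 * |e|))) := by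
  have he0 : 0 < |e| := by rcases he with rfl | rfl <;> norm_num
  have hval : 6 / (Real.pi ^ 2 * |e|) =
      (6 / Real.pi ^ 2) ^ 2 * (Real.pi / (2 * |e|) * (Real.pi / 3 - 0)) := by
    have := Real.pi_ne_zero
    field_simp
    ring
  have hT : Tendsto (fun T : ℝ => 1 / T) atTop (𝓝 0) := by
    simpa using tendsto_inv_atTop_zero (𝕜 := ℝ)
  have hv := (hT.const_sub (Real.pi / 3)).const_mul (Real.pi / (2 * |e|))
  rw [hval]
  refine tendsto_order.2 ⟨fun c hc => ?_, fun c hc => ?_⟩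
  · obtain ⟨T, hcT, hT1⟩ := (((hv.const_mul ((6 / Real.pi ^ 2) ^ 2)).eventually
      (lt_mem_nhds hc)).and (eventually_ge_atTop 1)).exists
    obtain ⟨K, hK⟩ := lt_excess he hT1
    have hM := ((tendsto_kap.pow 2).mul_const (Real.pi / (2 * |e|) * (Real.pi / 3 - 1 / T))).sub
      (tendsto_const_div_atTop_nhds_zero_nat K)
    rw [sub_zero] at hM
    obtain ⟨M, hcM, hM3⟩ := ((hM.eventually (lt_mem_nhds hcT)).and (eventually_ge_atTop 3)).exists
    exact hK M hM3 c hcM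
  · have hv' := (hv.const_mul ((6 / Real.pi ^ 2) ^ 2)).add (hT.const_mul (2 * cuspConst))
    rw [mul_zero, add_zero] at hv'
    obtain ⟨T, hcT, hT1⟩ := ((hv'.eventually (gt_mem_nhds hc)).and (eventually_ge_atTop 1)).exists
    have hM := ((tendsto_kap.pow 2).mul_const
      (Real.pi / (2 * |e|) * (Real.pi / 3 - 1 / T))).add_const (2 * cuspConst * (1 / T))
    obtain ⟨M, hcM⟩ := (hM.eventually (gt_mem_nhds hcT)).exists
    exact excess_lt he hT1 M (by rwa [mul_one_div] at hcM)

end Sieve2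

end CubicForm

namespace CubicForm

open Finset Filter Topology MeasureTheory

section FundCount

variable {e : ℝ}

/-- The condition at `p` for being a fundamental discriminant. -/
def fundAt (p : ℕ) (D : ℤ) : Prop :=
  if p = 2 then D % 4 = 1 ∨ D % 16 = 8 ∨ D % 16 = 12 else ¬ (p : ℤ) ^ 2 ∣ D

instance (p : ℕ) : DecidablePred (fundAt p) := fun D => by unfold fundAt; infer_instance

/-- The modulus on which the condition at `p` depends. -/
def fundMod (p : ℕ) : ℕ := if p = 2 then 16 else p ^ 2

lemma fundAt_emod (p : ℕ) (D : ℤ) : fundAt p (D % (fundMod p : ℕ)) ↔ fundAt p D := by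
  unfold fundAt fundMod
  split_ifs
  · push_cast; omega
  · push_cast
    rw [Int.emod_def, dvd_sub_left (dvd_mul_right _ _)]

lemma fund_iff_fundAt {D : ℤ} : Fund D ↔ ∀ p : ℕ, p.Prime → fundAt p D := by
  constructor
  · rintro ⟨h, hD⟩ p hp
    unfold fundAt
    split_ifs with hp2
    · subst hp2
      have h2 := hD 2 hp (D / 4)
      unfold IsDiscMod at h h2
      push_cast at h2
      omega
    · exact Fund.not_dvd_sq ⟨h, hD⟩ hp hp2
  · intro h
    have h2 := h 2 Nat.prime_two
    rw [fundAt, if_pos rfl] at h2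
    refine ⟨by unfold IsDiscMod; omega, fun p hp E hE hdE => ?_⟩
    by_cases hp2 : p = 2
    · subst hp2
      unfold IsDiscMod at hdE
      push_cast at hE
      omega
    · have := h p hp
      rw [fundAt, if_neg hp2] at this
      exact this ⟨E, hE⟩

lemma ncard_val (n : ℕ) [NeZero n] (Q : ℕ → Prop) [DecidablePred Q] :
    {x : Fin 1 → ZMod n | Q (x 0).val}.ncard = #((range n).filter Q) := by
  rw [← Set.ncard_coe_finset]
  refine Set.ncard_congr (fun x _ => (x 0).val) ?_ ?_ ?_
  · intro x hx
    rw [mem_coe, mem_filter, mem_range]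
    exact ⟨ZMod.val_lt _, hx⟩
  · intro x y _ _ h
    ext i
    rw [Subsingleton.elim i 0]
    exact ZMod.val_injective n h
  · intro k hk
    rw [mem_coe, mem_filter, mem_range] at hk
    have : ((k : ZMod n)).val = k := ZMod.val_cast_of_lt hk.1
    exact ⟨fun _ => k, by simpa [this] using hk.2, this⟩

lemma card_fundAt_two : #((range 16).filter fun k : ℕ => fundAt 2 k) = 6 := by decide

lemma card_fundAt {p : ℕ} (hp : p.Prime) (hp2 : p ≠ 2) :
    #((range (p ^ 2)).filter fun k : ℕ => fundAt p k) = p ^ 2 - 1 := by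
  have : (range (p ^ 2)).filter (fun k : ℕ => fundAt p k) = (range (p ^ 2)).erase 0 := by
    ext k
    simp only [mem_filter, mem_range, mem_erase, fundAt, if_neg hp2]
    constructor
    · rintro ⟨h1, h2⟩
      exact ⟨fun h => h2 (by simp [h]), h1⟩
    · rintro ⟨h1, h2⟩
      refine ⟨h2, fun h => ?_⟩
      have : p ^ 2 ∣ k := by exact_mod_cast h
      exact absurd (Nat.le_of_dvd (Nat.pos_of_ne_zero h1) this) (by omega)
  rw [this, card_erase_of_mem (mem_range.2 (pow_pos hp.pos 2)), card_range]

/-- Signed integers of absolute value less than `X` that are fundamental at all primes up to `M`. -/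
def fundIn (e : ℝ) (M : ℕ) (X : ℝ) : Set (Fin 1 → ℤ) :=
  {v | (∀ p : ℕ, p.Prime → p ≤ M → fundAt p (v 0)) ∧ 0 < e * v 0 ∧ |(v 0 : ℝ)| < X}

lemma volume_signed (he : e = -1 ∨ e = 1 / 3) :
    volume.real {x : Fin 1 → ℝ | 0 < e * x 0 ∧ |x 0| < 1} = 1 := by
  have : {x : Fin 1 → ℝ | 0 < e * x 0 ∧ |x 0| < 1} = Set.univ.pi fun _ =>
      if e = -1 then Set.Ioo (-1) 0 else Set.Ioo 0 1 := by
    ext x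
    rw [Set.mem_univ_pi, Fin.forall_fin_one, Set.mem_ofPred_eq, abs_lt]
    rcases he with rfl | rfl
    · rw [if_pos rfl, Set.mem_Ioo]
      constructor
      · rintro ⟨h1, h2, h3⟩; constructor <;> linarith
      · rintro ⟨h1, h2⟩; refine ⟨?_, ?_, ?_⟩ <;> linarith
    · rw [if_neg (by norm_num), Set.mem_Ioo]
      constructor
      · rintro ⟨h1, h2, h3⟩; constructor <;> linarith
      · rintro ⟨h1, h2⟩; refine ⟨?_, ?_, ?_⟩ <;> linarith
  rw [this, Measure.real, volume_pi_pi]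
  split_ifs <;> simp

lemma tendsto_fundIn (he : e = -1 ∨ e = 1 / 3) {M : ℕ} (hM : 2 ≤ M) :
    Tendsto (fun X : ℝ => ((fundIn e M X).ncard : ℝ) / X) atTop (𝓝 (kap M / 2)) := by
  classical
  let P := (range (M + 1)).filter Nat.Prime
  let R := {x : Fin 1 → ℝ | 0 < e * x 0 ∧ |x 0| < 1}
  have hRo : IsOpen R := (isOpen_lt (by fun_prop) (by fun_prop)).and
    (isOpen_lt (by fun_prop) (by fun_prop))
  have hRb : Bornology.IsBounded R := by
    refine (Metric.isBounded_closedBall (x := 0) (r := 1)).subset fun x hx => ?_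
    rw [mem_closedBall_zero_iff, pi_norm_le_iff_of_nonneg zero_le_one]
    intro i
    rw [Subsingleton.elim i 0]
    exact hx.2.le
  have hRc : Convex ℝ R := by
    have h1 : Convex ℝ {x : Fin 1 → ℝ | 0 < e * x 0} :=
      convex_halfSpace_gt (f := fun x : Fin 1 → ℝ => e * x 0)
        ⟨fun x y => by simp [mul_add], fun c x => by simp; ring⟩ 0
    have h2 : Convex ℝ {x : Fin 1 → ℝ | x 0 < 1} :=
      convex_halfSpace_lt (f := fun x : Fin 1 → ℝ => x 0) ⟨fun x y => rfl, fun c x => rfl⟩ 1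
    have h3 : Convex ℝ {x : Fin 1 → ℝ | -1 < x 0} :=
      convex_halfSpace_gt (f := fun x : Fin 1 → ℝ => x 0) ⟨fun x y => rfl, fun c x => rfl⟩ (-1)
    convert h1.inter (h3.inter h2) using 1
    ext x
    simp [R, abs_lt]
  have ha : ∀ p ∈ P, fundMod p ≠ 0 := by
    intro p hp
    unfold fundMod
    split_ifs
    · norm_num
    · exact pow_ne_zero 2 (mem_filter.1 hp).2.ne_zero
  have hco : (P : Set ℕ).Pairwise (Function.onFun Nat.Coprime fundMod) := by
    intro p hp q hq hne
    have hpq := (Nat.coprime_primes (mem_filter.1 hp).2 (mem_filter.1 hq).2).2 hne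
    have h16 : ∀ {r : ℕ}, fundMod r = if r = 2 then r ^ 4 else r ^ 2 := by
      intro r
      unfold fundMod
      split_ifs with h
      · rw [h]; norm_num
      · rfl
    simp only [Function.onFun, h16]
    split_ifs <;> exact Nat.Coprime.pow _ _ hpq
  have key := tendsto_count_local hRb hRo.measurableSet (hRc.addHaar_frontier volume) P fundMod ha hco
    fun p => {x | fundAt p (x 0).val}
  rw [volume_signed he, mul_one] at key
  have hprod : ∏ p ∈ P, (({x : Fin 1 → ZMod (fundMod p) | fundAt p (x 0).val}.ncard : ℝ) /
      (fundMod p : ℝ) ^ 1) = kap M / 2 := by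
    have h2P : 2 ∈ P := mem_filter.2 ⟨mem_range.2 (by omega), Nat.prime_two⟩
    have hterm : ∀ p ∈ P, ({x : Fin 1 → ZMod (fundMod p) | fundAt p (x 0).val}.ncard : ℝ) /
      (fundMod p : ℝ) ^ 1 = (1 - 1 / (p : ℝ) ^ 2) * if p = 2 then 1 / 2 else 1 := by
      intro p hp
      have : NeZero (fundMod p) := ⟨ha p hp⟩
      rw [ncard_val (fundMod p) fun k => fundAt p k]
      by_cases hp2 : p = 2
      · subst hp2
        have : fundMod 2 = 16 := rfl
        rw [this, card_fundAt_two]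
        norm_num
      · have hf : fundMod p = p ^ 2 := if_neg hp2
        have hpp := (mem_filter.1 hp).2
        have hp0 : (p : ℝ) ≠ 0 := by exact_mod_cast hpp.ne_zero
        rw [hf, card_fundAt hpp hp2, if_neg hp2, Nat.cast_sub (Nat.one_le_pow _ _ hpp.pos)]
        push_cast
        field_simp
    rw [prod_congr rfl hterm, prod_mul_distrib, prod_ite_eq' P 2, if_pos h2P, kap, mul_one_div]
  rw [hprod] at key
  refine key.congr' ?_
  filter_upwards [eventually_gt_atTop 0] with X hX
  rw [pow_one]
  congr 3
  ext v
  rw [fundIn, Set.mem_ofPred_eq, Set.mem_ofPred_eq]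
  refine and_congr ?_ ?_
  · have : ∀ p ∈ P, ((fun j => (v j : ZMod (fundMod p))) ∈
        {x : Fin 1 → ZMod (fundMod p) | fundAt p (x 0).val} ↔ fundAt p (v 0)) := by
      intro p hp
      have : NeZero (fundMod p) := ⟨ha p hp⟩
      rw [Set.mem_ofPred_eq, ZMod.val_intCast, fundAt_emod]
    constructor
    · intro h p hp hpM
      have hpP : p ∈ P := mem_filter.2 ⟨mem_range.2 (by omega), hp⟩
      exact (this p hpP).1 (h p hpP)
    · intro h p hp
      exact (this p hp).2 (h p (mem_filter.1 hp).2 (by have := mem_range.1 (mem_filter.1 hp).1; omega))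
  · change (0 < e * ((v 0 : ℝ) / X) ∧ |(v 0 : ℝ) / X| < 1) ↔ _
    rw [abs_div, abs_of_pos hX, div_lt_one hX, ← mul_div_assoc, div_pos_iff_of_pos_right hX]

lemma finite_fundIn (e : ℝ) (M : ℕ) (X : ℝ) : (fundIn e M X).Finite := by
  refine (Set.Finite.pi' fun _ : Fin 1 => Set.finite_Icc (-⌈X⌉) ⌈X⌉).subset fun v hv i => ?_
  rw [Subsingleton.elim i 0]
  have := hv.2.2.le.trans (Int.le_ceil X)
  exact abs_le.1 (show |v 0| ≤ ⌈X⌉ by exact_mod_cast this)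

lemma card_famD_le (e : ℝ) (M : ℕ) (X : ℝ) : #(famD e X) ≤ (fundIn e M X).ncard := by
  rw [← Set.ncard_coe_finset]
  refine Set.ncard_le_ncard_of_injOn (fun D _ => D) ?_ ?_ (finite_fundIn e M X)
  · intro D hD
    obtain ⟨h1, h2, h3⟩ := mem_famD.1 hD
    exact ⟨fun p hp _ => fund_iff_fundAt.1 h1 p hp, h2, h3⟩
  · intro D _ D' _ h
    exact congrFun h 0

lemma card_multiples {m : ℕ} (hm : 0 < m) {X : ℝ} (hX : 0 < X) :
    (#((Icc (-⌊X⌋) ⌊X⌋).filter fun D : ℤ => D ≠ 0 ∧ (m : ℤ) ∣ D) : ℝ) ≤ 2 * X / m := by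
  have hmZ : (0 : ℤ) < m := by exact_mod_cast hm
  have hmR : (0 : ℝ) < m := by exact_mod_cast hm
  have hle : #((Icc (-⌊X⌋) ⌊X⌋).filter fun D : ℤ => D ≠ 0 ∧ (m : ℤ) ∣ D) ≤
      #((Icc (-⌊X / m⌋) ⌊X / m⌋).erase 0) := by
    refine card_le_card_of_injOn (fun D => D / m) ?_ ?_
    · intro D hD
      obtain ⟨hD, h0, k, rfl⟩ := mem_filter.1 hD
      rw [mem_Icc, ← abs_le, Int.le_floor] at hD
      simp only [Int.mul_ediv_cancel_left _ hmZ.ne']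
      rw [mem_coe, mem_erase, mem_Icc, ← abs_le, Int.le_floor,
        le_div_iff₀ hmR]
      refine ⟨right_ne_zero_of_mul h0, le_trans (le_of_eq ?_) hD⟩
      push_cast
      rw [abs_mul, abs_of_pos hmR, mul_comm]
    · intro D hD D' hD' h
      simp only at h
      rw [← Int.mul_ediv_cancel' (mem_filter.1 hD).2.2, h,
        Int.mul_ediv_cancel' (mem_filter.1 hD').2.2]
  have hnn : 0 ≤ ⌊X / m⌋ := Int.floor_nonneg.2 (by positivity)
  have hcard : (#((Icc (-⌊X / m⌋) ⌊X / m⌋).erase 0) : ℤ) = 2 * ⌊X / m⌋ := by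
    rw [card_erase_of_mem (mem_Icc.2 (by omega)), Int.card_Icc]
    omega
  calc (_ : ℝ) ≤ #((Icc (-⌊X / m⌋) ⌊X / m⌋).erase 0) := by exact_mod_cast hle
    _ = 2 * (⌊X / m⌋ : ℝ) := by exact_mod_cast congrArg (Int.cast : ℤ → ℝ) hcard
    _ ≤ 2 * (X / m) := by gcongr; exact Int.floor_le _
    _ = _ := by ring

lemma le_card_famD (e : ℝ) {M : ℕ} (hM : 2 ≤ M) {X : ℝ} (hX : 0 < X) :
    ((fundIn e M X).ncard : ℝ) ≤ #(famD e X) + 2 * X / M := by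
  classical
  let I := (Ioc M (M + ⌈X⌉₊)).filter Nat.Prime
  let Tl := I.biUnion fun p => (Icc (-⌊X⌋) ⌊X⌋).filter fun D : ℤ => D ≠ 0 ∧ ((p ^ 2 : ℕ) : ℤ) ∣ D
  have h1 : (fundIn e M X).ncard ≤ #(famD e X ∪ Tl) := by
    rw [← Set.ncard_coe_finset]
    refine Set.ncard_le_ncard_of_injOn (fun v => v 0) ?_ ?_ (finite_toSet _)
    · rintro v ⟨h1, h2, h3⟩
      rw [mem_coe, mem_union]
      by_cases hF : Fund (v 0)
      · exact Or.inl (mem_famD.2 ⟨hF, h2, h3⟩)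
      · right
        rw [fund_iff_fundAt] at hF
        push Not at hF
        obtain ⟨p, hp, hb⟩ := hF
        have hpM : M < p := by
          by_contra! hle
          exact hb (h1 p hp hle)
        rw [fundAt, if_neg (by omega), not_not] at hb
        have h0 : v 0 ≠ 0 := by rintro h0; simp [h0] at h2
        have hle : (p : ℤ) ^ 2 ≤ |v 0| := Int.le_of_dvd (abs_pos.2 h0) ((dvd_abs _ _).2 hb)
        have hle' : (p : ℝ) ^ 2 ≤ |(v 0 : ℝ)| := by exact_mod_cast hle
        have hp1 : (1 : ℝ) ≤ p := by exact_mod_cast hp.one_le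
        have hpX : (p : ℝ) ≤ ⌈X⌉₊ := le_trans (by nlinarith) (Nat.le_ceil X)
        have hpX' : p ≤ ⌈X⌉₊ := by exact_mod_cast hpX
        refine mem_biUnion.2 ⟨p, mem_filter.2 ⟨mem_Ioc.2 ⟨hpM, by omega⟩, hp⟩,
          mem_filter.2 ⟨?_, h0, by push_cast; exact hb⟩⟩
        rw [mem_Icc, ← abs_le, Int.le_floor]
        push_cast
        exact h3.le
    · intro v _ w _ h
      ext i
      rw [Subsingleton.elim i 0]
      exact h
  have h2 : (#Tl : ℝ) ≤ 2 * X / M := by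
    calc (#Tl : ℝ) ≤ ∑ p ∈ I, (#((Icc (-⌊X⌋) ⌊X⌋).filter
          fun D : ℤ => D ≠ 0 ∧ ((p ^ 2 : ℕ) : ℤ) ∣ D) : ℝ) := by exact_mod_cast card_biUnion_le
      _ ≤ ∑ p ∈ I, 2 * X * ((p : ℝ) ^ 2)⁻¹ := by
          refine sum_le_sum fun p hp => ?_
          refine (card_multiples (pow_pos (mem_filter.1 hp).2.pos 2) hX).trans ?_
          push_cast
          rw [div_eq_mul_inv]
      _ ≤ ∑ p ∈ Ioc M (M + ⌈X⌉₊), 2 * X * ((p : ℝ) ^ 2)⁻¹ :=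
          sum_le_sum_of_subset_of_nonneg (filter_subset _ _) fun _ _ _ => by positivity
      _ = 2 * X * ∑ p ∈ Ioc M (M + ⌈X⌉₊), ((p : ℝ) ^ 2)⁻¹ := by rw [mul_sum]
      _ ≤ 2 * X * (M : ℝ)⁻¹ := by
          gcongr
          refine (sum_Ioc_inv_sq_le_sub (by omega) (by omega)).trans ?_
          have : (0 : ℝ) ≤ ((M + ⌈X⌉₊ : ℕ) : ℝ)⁻¹ := by positivity
          linarith
      _ = _ := by rw [div_eq_mul_inv]
  have h3 : ((fundIn e M X).ncard : ℝ) ≤ #(famD e X) + #Tl := by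
    exact_mod_cast h1.trans (card_union_le _ _)
  linarith

theorem tendsto_card_famD (he : e = -1 ∨ e = 1 / 3) :
    Tendsto (fun X : ℝ => (#(famD e X) : ℝ) / X) atTop (𝓝 (3 / Real.pi ^ 2)) := by
  have hlim : Tendsto (fun M => kap M / 2) atTop (𝓝 (3 / Real.pi ^ 2)) := by
    convert tendsto_kap.div_const 2 using 2
    ring
  refine tendsto_order.2 ⟨fun c hc => ?_, fun c hc => ?_⟩
  · have hM := hlim.sub (tendsto_const_div_atTop_nhds_zero_nat 2)
    rw [sub_zero] at hM
    obtain ⟨M, hcM, hM2⟩ := ((hM.eventually (lt_mem_nhds hc)).and (eventually_ge_atTop 2)).exists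
    filter_upwards [(tendsto_fundIn he hM2).eventually (lt_mem_nhds (lt_sub_iff_add_lt.1 hcM)),
      eventually_gt_atTop 0] with X h hX
    rw [lt_div_iff₀ hX] at h ⊢
    have h1 := le_card_famD e hM2 hX
    have h2 : 2 * X / M = 2 / M * X := by ring
    rw [h2] at h1
    linarith
  · obtain ⟨M, hcM, hM2⟩ := ((hlim.eventually (gt_mem_nhds hc)).and (eventually_ge_atTop 2)).exists
    filter_upwards [(tendsto_fundIn he hM2).eventually (gt_mem_nhds hcM),
      eventually_gt_atTop 0] with X h hX
    refine lt_of_le_of_lt ?_ h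
    gcongr
    exact card_famD_le e M X

end FundCount

end CubicForm

namespace CubicForm

open Finset Filter Topology

section Main

variable {e : ℝ}

lemma tendsto_excess' (he : e = -1 ∨ e = 1 / 3) :
    Tendsto (fun X : ℝ => excess e X / X) atTop (𝓝 (6 / (Real.pi ^ 2 * |e|))) := by
  refine ((tendsto_excess he).comp
    (tendsto_rpow_atTop (by norm_num : (0 : ℝ) < 1 / 4))).congr' ?_
  filter_upwards [eventually_ge_atTop 0] with X hX
  have : (X ^ (1 / 4 : ℝ)) ^ 4 = X := by
    rw [← Real.rpow_natCast, ← Real.rpow_mul hX]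
    norm_num
  simp only [Function.comp_apply, this]

lemma tendsto_sum_numOrb (he : e = -1 ∨ e = 1 / 3) :
    Tendsto (fun X : ℝ => (∑ D ∈ famD e X, (numOrb D : ℝ)) / X) atTop
      (𝓝 (3 / Real.pi ^ 2 * (1 / |e| + 1))) := by
  have := ((tendsto_excess' he).div_const 2).add (tendsto_card_famD he)
  have he0 : 0 < |e| := by rcases he with rfl | rfl <;> norm_num
  have hpi := Real.pi_ne_zero
  convert this using 2 with X
  · rw [excess, sum_sub_distrib, sum_const, nsmul_eq_mul, ← mul_sum]
    ring
  · field_simp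
    ring

lemma tendsto_sum_of_eqOn {E : Finset ℤ} {f g : ℤ → ℝ} {S : ℝ → Finset ℤ}
    (h : ∀ X, ∀ D ∈ S X, D ∉ E → f D = g D) {L : ℝ}
    (hg : Tendsto (fun X : ℝ => (∑ D ∈ S X, g D) / X) atTop (𝓝 L)) :
    Tendsto (fun X : ℝ => (∑ D ∈ S X, f D) / X) atTop (𝓝 L) := by
  classical
  have hz : Tendsto (fun X : ℝ => (∑ D ∈ S X, (f D - g D)) / X) atTop (𝓝 0) := by
    refine squeeze_zero_norm' (a := fun X : ℝ => (∑ D ∈ E, |f D - g D|) / X) ?_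
      (tendsto_const_nhds.div_atTop tendsto_id)
    filter_upwards [eventually_gt_atTop 0] with X hX
    rw [Real.norm_eq_abs, abs_div, abs_of_pos hX]
    gcongr
    refine (abs_sum_le_sum_abs _ _).trans ?_
    rw [← sum_filter_add_sum_filter_not (S X) (· ∈ E), sum_eq_zero
      (s := (S X).filter (· ∉ E)), add_zero]
    · exact sum_le_sum_of_subset_of_nonneg (fun D hD => (mem_filter.1 hD).2)
        fun _ _ _ => abs_nonneg _
    · intro D hD
      rw [h X D (mem_filter.1 hD).1 (mem_filter.1 hD).2, sub_self, abs_zero]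
  have := hg.add hz
  rw [add_zero] at this
  refine this.congr fun X => ?_
  rw [← add_div, ← sum_add_distrib]
  simp

lemma discSum_eq {lo hi X : ℝ} (w : ℤ → ℝ)
    (h : ∀ D : ℤ, D ≠ 1 → (lo < D ∧ D < hi ↔ 0 < e * D ∧ |(D : ℝ)| < X)) :
    discSum lo hi w = ∑ D ∈ famD e X, if D = 1 then 0 else w D := by
  classical
  have hiff : ∀ D : ℤ, (lo < D ∧ D < hi ∧ IsQuadraticDisc D) ↔ D ∈ famD e X ∧ D ≠ 1 := by
    intro D
    rw [isQuadraticDisc_iff, mem_famD]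
    constructor
    · rintro ⟨h1, h2, h3, h4⟩
      exact ⟨⟨h3, (h D h4).1 ⟨h1, h2⟩⟩, h4⟩
    · rintro ⟨⟨h3, h12⟩, h4⟩
      exact ⟨((h D h4).2 h12).1, ((h D h4).2 h12).2, h3, h4⟩
  rw [discSum, tsum_eq_sum (s := famD e X)]
  · refine sum_congr rfl fun D hD => ?_
    by_cases h1 : D = 1
    · rw [if_pos h1, if_neg fun h' => ((hiff D).1 h').2 h1]
    · rw [if_neg h1, if_pos ((hiff D).2 ⟨hD, h1⟩)]
  · intro D hD
    exact if_neg fun h' => hD ((hiff D).1 h').1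

lemma tendsto_discSum_div (he : e = -1 ∨ e = 1 / 3) {k : ℝ} (hk : k ≠ 0) {E : Finset ℤ}
    (h1E : 1 ∈ E) (hE : ∀ D, Fund D → 0 < e * D → D ∉ E → (numOrb D : ℝ) = k * h3 D)
    {lo hi : ℝ → ℝ} (h : ∀ X : ℝ, ∀ D : ℤ, D ≠ 1 →
      (lo X < D ∧ D < hi X ↔ 0 < e * D ∧ |(D : ℝ)| < X)) :
    Tendsto (fun X : ℝ => discSum (lo X) (hi X) (fun D => (h3 D : ℝ)) /
      discSum (lo X) (hi X) (fun _ => 1)) atTop (𝓝 ((1 / |e| + 1) / k)) := by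
  have hpi := Real.pi_ne_zero
  have hnum : Tendsto (fun X : ℝ => discSum (lo X) (hi X) (fun D => (h3 D : ℝ)) / X) atTop
      (𝓝 (3 / Real.pi ^ 2 * (1 / |e| + 1) / k)) := by
    have hg := (tendsto_sum_numOrb he).div_const k
    simp only [discSum_eq _ (h _)]
    refine tendsto_sum_of_eqOn (E := E) (g := fun D => (numOrb D : ℝ) / k) ?_ ?_
    · intro X D hD hDE
      obtain ⟨hF, hpos, -⟩ := mem_famD.1 hD
      rw [if_neg fun h1 : D = 1 => hDE (h1 ▸ h1E), hE D hF hpos hDE]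
      field_simp
    · refine hg.congr fun X => ?_
      rw [← sum_div]
      ring
  have hden : Tendsto (fun X : ℝ => discSum (lo X) (hi X) (fun _ => 1) / X) atTop
      (𝓝 (3 / Real.pi ^ 2)) := by
    simp only [discSum_eq _ (h _)]
    refine tendsto_sum_of_eqOn (E := E) (g := fun _ => 1) ?_ ?_
    · intro X D _ hDE
      exact if_neg fun h1 : D = 1 => hDE (h1 ▸ h1E)
    · simpa using tendsto_card_famD he
  have hlim := hnum.div hden (by positivity)
  have : 3 / Real.pi ^ 2 * (1 / |e| + 1) / k / (3 / Real.pi ^ 2) = (1 / |e| + 1) / k := by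
    field_simp
  rw [this] at hlim
  refine hlim.congr' ?_
  filter_upwards [eventually_gt_atTop 0] with X hX
  exact div_div_div_cancel_right₀ hX.ne' _ _

theorem tendsto_mean_pos :
    Tendsto (fun X : ℝ => discSum 0 X (fun D => (h3 D : ℝ)) / discSum 0 X (fun _ => 1)) atTop
      (𝓝 (4 / 3)) := by
  have := tendsto_discSum_div (e := 1 / 3) (Or.inr rfl) (k := 3) (by norm_num) (E := {1})
    (lo := fun _ => 0) (hi := fun X => X) (by simp) ?_ ?_
  · convert this using 2
    rw [abs_of_pos (by norm_num)]
    norm_num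
  · intro D hF hD h1
    have hD' : 0 < D := by
      have : (0 : ℝ) < D := by linarith
      exact_mod_cast this
    have := (card_orbit_eq_h3 (isQuadraticDisc_iff.2 ⟨hF, by simpa using h1⟩)).1 hD'
    rw [numOrb, this]
    push_cast
    rfl
  · intro X D _
    rw [abs_lt]
    constructor
    · rintro ⟨h1, h2⟩; refine ⟨?_, ?_, ?_⟩ <;> linarith
    · rintro ⟨h1, h2, h3⟩; constructor <;> linarith

theorem tendsto_mean_neg :
    Tendsto (fun X : ℝ => discSum (-X) 0 (fun D => (h3 D : ℝ)) / discSum (-X) 0 (fun _ => 1)) atTop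
      (𝓝 2) := by
  have := tendsto_discSum_div (e := -1) (Or.inl rfl) (k := 1) one_ne_zero (E := Icc (-4) 1)
    (lo := fun X => -X) (hi := fun _ => 0) (by simp) ?_ ?_
  · convert this using 2
    norm_num
  · intro D hF hD h1
    have hD' : D < 0 := by
      have : (D : ℝ) < 0 := by linarith
      exact_mod_cast this
    rw [mem_Icc] at h1
    rw [numOrb, (card_orbit_eq_h3 (isQuadraticDisc_iff.2 ⟨hF, by omega⟩)).2 (by omega), one_mul]
  · intro X D _
    rw [abs_lt]
    constructor
    · rintro ⟨h1, h2⟩; refine ⟨?_, ?_, ?_⟩ <;> linarith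
    · rintro ⟨h1, h2, h3⟩; constructor <;> linarith

end Main

end CubicForm

theorem mean_three_torsion :
    Tendsto
      (fun X : ℝ => discSum 0 X (fun D => (h3 D : ℝ)) / discSum 0 X fun _ => 1)
      atTop (nhds (4 / 3)) ∧
    Tendsto
      (fun X : ℝ => discSum (-X) 0 (fun D => (h3 D : ℝ)) / discSum (-X) 0 fun _ => 1)
      atTop (nhds 2) :=
  ⟨CubicForm.tendsto_mean_pos, CubicForm.tendsto_mean_neg⟩
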